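/- If R is a commutative noetherian ring possessing a dualizing complex, then the class of Gorenstein injective R-modules is covering: every R-module has a Gorenstein injective cover. -/

import Mathlib

open CategoryTheory CategoryTheory.Limits

universe u

section GenericDefs

variable {𝒜 : Type*} [Category 𝒜] [Abelian 𝒜]

/-- An object `G` of an abelian category is *Gorenstein injective* if it is a cycle object of
an exact (ℤ-indexed) complex of injective objects which stays exact under `Hom(I, -)` for
every injective object `I`. -/
def IsGorensteinInjective (G : 𝒜) : Prop :=
  ∃ C : ChainComplex 𝒜 ℤ,
    (∀ n, Injective (C.X n)) ∧
    (∀ n, C.ExactAt n) ∧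
    (∀ (I : 𝒜), Injective I → ∀ n,
      (((preadditiveCoyoneda.obj (Opposite.op I)).mapHomologicalComplex _).obj C).ExactAt n) ∧
    Nonempty (G ≅ kernel (C.d 0 (-1)))

/-- An object `G` is *Gorenstein projective* if it is a cycle object of an exact complex of
projectives which stays exact under `Hom(-, P)` for every projective `P`. -/
def IsGorensteinProjective (G : 𝒜) : Prop :=
  ∃ C : ChainComplex 𝒜 ℤ,
    (∀ n, Projective (C.X n)) ∧
    (∀ n, C.ExactAt n) ∧
    (∀ (P : 𝒜), Projective P → ∀ n,
      (((preadditiveYoneda.obj P).mapHomologicalComplex _).obj C.op).ExactAt n) ∧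
    Nonempty (G ≅ kernel (C.d 0 (-1)))

/-- `φ : G ⟶ X` is a `𝒞`-precover of `X`. -/
def IsPrecover (𝒞 : 𝒜 → Prop) {G X : 𝒜} (φ : G ⟶ X) : Prop :=
  𝒞 G ∧ ∀ (G' : 𝒜), 𝒞 G' → ∀ ψ : G' ⟶ X, ∃ h : G' ⟶ G, h ≫ φ = ψ

/-- `φ : G ⟶ X` is a `𝒞`-cover of `X`. -/
def IsCover (𝒞 : 𝒜 → Prop) {G X : 𝒜} (φ : G ⟶ X) : Prop :=
  IsPrecover 𝒞 φ ∧ ∀ f : G ⟶ G, f ≫ φ = φ → IsIso f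

/-- `φ : X ⟶ G` is a `𝒞`-preenvelope of `X`. -/
def IsPreenvelope (𝒞 : 𝒜 → Prop) {X G : 𝒜} (φ : X ⟶ G) : Prop :=
  𝒞 G ∧ ∀ (G' : 𝒜), 𝒞 G' → ∀ ψ : X ⟶ G', ∃ h : G ⟶ G', φ ≫ h = ψ

/-- `φ : X ⟶ G` is a `𝒞`-envelope of `X`. -/
def IsEnvelope (𝒞 : 𝒜 → Prop) {X G : 𝒜} (φ : X ⟶ G) : Prop :=
  IsPreenvelope 𝒞 φ ∧ ∀ f : G ⟶ G, φ ≫ f = φ → IsIso f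

/-- `Ext¹(X, Y) = 0`, expressed by the splitting of every extension of `X` by `Y`. -/
def Ext1Zero (X Y : 𝒜) : Prop :=
  ∀ (E : 𝒜) (i : Y ⟶ E) (p : E ⟶ X) (w : i ≫ p = 0),
    (ShortComplex.mk i p w).ShortExact → ∃ s : X ⟶ E, s ≫ p = 𝟙 X

/-- `ExtSucZero n X Y` says `Ext^(n+1)(X, Y) = 0`; defined by dimension shifting along
short exact sequences `0 ⟶ Y ⟶ E ⟶ Y' ⟶ 0` with `E` injective. -/
def ExtSucZero : ℕ → 𝒜 → 𝒜 → Prop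
  | 0, X, Y => Ext1Zero X Y
  | (n+1), X, Y => ∀ (E Y' : 𝒜) (i : Y ⟶ E) (p : E ⟶ Y') (w : i ≫ p = 0),
      (ShortComplex.mk i p w).ShortExact → Injective E → ExtSucZero n X Y'

/-- A special `𝒞`-precover: an epimorphism `φ : G ⟶ X` with `G ∈ 𝒞` arising in a short exact
sequence `0 ⟶ A ⟶ G ⟶ X ⟶ 0` with `Ext¹(G', A) = 0` for all `G' ∈ 𝒞`. -/
def IsSpecialPrecover (𝒞 : 𝒜 → Prop) {G X : 𝒜} (φ : G ⟶ X) : Prop :=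
  IsPrecover 𝒞 φ ∧ ∃ (A : 𝒜) (i : A ⟶ G) (w : i ≫ φ = 0),
    (ShortComplex.mk i φ w).ShortExact ∧ ∀ (G' : 𝒜), 𝒞 G' → Ext1Zero G' A

/-- The left `Ext¹`-orthogonal class `⊥𝒞` of a class of objects `𝒞`. -/
def leftOrthogonal {𝒜 : Type*} [Category 𝒜] [Abelian 𝒜] (𝒞 : 𝒜 → Prop) (X : 𝒜) : Prop :=
  ∀ Y : 𝒜, 𝒞 Y → Ext1Zero X Y

/-- The right `Ext¹`-orthogonal class `𝒞⊥` of a class of objects `𝒞`. -/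
def rightOrthogonal {𝒜 : Type*} [Category 𝒜] [Abelian 𝒜] (𝒞 : 𝒜 → Prop) (Y : 𝒜) : Prop :=
  ∀ X : 𝒜, 𝒞 X → Ext1Zero X Y

end GenericDefs

section Dualizing

open ZeroObject

variable (R : Type u) [CommRing R]

/-- A dualizing complex for a commutative noetherian ring `R`: a bounded complex `D` of
injective `R`-modules whose cohomology modules are finitely generated, and such that the
canonical map `R ⟶ RHom(D, D)` is a quasi-isomorphism.  Since `D` is a bounded complex of
injectives, the latter condition says exactly that `H^n(Hom•(D,D)) = 0` for `n ≠ 0` (every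
chain map `D ⟶ D⟦n⟧` is null-homotopic) and that `H^0(Hom•(D,D)) = Hom_{K(R)}(D,D)` is, via
the canonical map, a free `R`-module generated by the identity (every chain self-map of `D` is
homotopic to `r • 𝟙 D` for a unique `r : R`). -/
def IsDualizingComplex (D : CochainComplex (ModuleCat.{u} R) ℤ) : Prop :=
  (∀ n, Injective (D.X n)) ∧
  (∃ a b : ℤ, ∀ n, (n < a ∨ b < n) → IsZero (D.X n)) ∧
  (∀ n, Module.Finite R (D.homology n)) ∧
  (∀ f : D ⟶ D, ∃! r : R, Nonempty (Homotopy f (r • 𝟙 D))) ∧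
  (∀ n : ℤ, n ≠ 0 → ∀ f : D ⟶ D⟦n⟧, Nonempty (Homotopy f 0))

end Dualizing

universe v w

section HomTensor

open TensorProduct

variable {R : Type u} [CommRing R]

/-- A finitely presented module has a presentation by finite free modules. -/
lemma exists_finite_free_presentation (N : Type u) [AddCommGroup N] [Module R N]
    [Module.FinitePresentation R N] :
    ∃ (m n : ℕ) (f : (Fin m → R) →ₗ[R] (Fin n → R)) (p : (Fin n → R) →ₗ[R] N),
      Function.Surjective p ∧ Function.Exact f p := by
  obtain ⟨n, p, hp⟩ := Module.Finite.exists_fin' R N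
  have hK : (LinearMap.ker p).FG := Module.FinitePresentation.fg_ker p hp
  have : Module.Finite R (LinearMap.ker p) := Module.Finite.iff_fg.mpr hK
  obtain ⟨m, f, hf⟩ := Module.Finite.exists_fin' R (LinearMap.ker p)
  refine ⟨m, n, (LinearMap.ker p).subtype ∘ₗ f, p, hp, ?_⟩
  rw [LinearMap.exact_iff, LinearMap.range_comp, LinearMap.range_eq_top.mpr hf]
  simp

section

variable (N E K : Type u) [AddCommGroup N] [Module R N] [AddCommGroup E] [Module R E]
  [AddCommGroup K] [Module R K]

lemma lcomp_exact {A B C : Type u} [AddCommGroup A] [Module R A] [AddCommGroup B] [Module R B]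
    [AddCommGroup C] [Module R C] {f : A →ₗ[R] B} {p : B →ₗ[R] C} (hfp : Function.Exact f p)
    (hp : Function.Surjective p) :
    Function.Exact (LinearMap.lcomp R E p) (LinearMap.lcomp R E f) := by
  intro g
  constructor
  · intro hg
    have hk : LinearMap.ker p ≤ LinearMap.ker g := by
      intro x hx
      obtain ⟨y, rfl⟩ := (hfp x).1 hx
      exact LinearMap.congr_fun hg y
    refine ⟨(LinearMap.ker p).liftQ g hk ∘ₗ (p.quotKerEquivOfSurjective hp).symm, ?_⟩
    ext x
    have : (p.quotKerEquivOfSurjective hp).symm (p x) = Submodule.Quotient.mk x := by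
      rw [LinearEquiv.symm_apply_eq]; rfl
    simp [this]
  · rintro ⟨h, rfl⟩
    ext x
    simp [hfp.apply_apply_eq_zero]

/-- Tensoring with a flat module commutes with `Hom` out of a finitely presented module. -/
lemma rTensorHomToHomRTensor_bijective [Module.FinitePresentation R N] [Module.Flat R K] :
    Function.Bijective (rTensorHomToHomRTensor (RingHom.id R) N E K) := by
  obtain ⟨m, n, f, p, hp, hfp⟩ := exists_finite_free_presentation (R := R) N
  have free : ∀ l : ℕ, Function.Bijective
      (rTensorHomToHomRTensor (RingHom.id R) (Fin l → R) E K) := fun l => by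
    have h := (rTensorHomEquivHomRTensor R (Fin l → R) E K).bijective
    have e : ⇑(rTensorHomEquivHomRTensor R (Fin l → R) E K) =
      ⇑(rTensorHomToHomRTensor (RingHom.id R) (Fin l → R) E K) :=
      congrArg DFunLike.coe (rTensorHomEquivHomRTensor_toLinearMap R (Fin l → R) E K)
    rwa [e] at h
  have nat : ∀ {A B : Type u} [AddCommGroup A] [Module R A] [AddCommGroup B] [Module R B]
      (g : A →ₗ[R] B) (x : (B →ₗ[R] E) ⊗[R] K),
      rTensorHomToHomRTensor (RingHom.id R) A E K ((LinearMap.lcomp R E g).rTensor K x) =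
        (rTensorHomToHomRTensor (RingHom.id R) B E K x) ∘ₗ g := by
    intro A B _ _ _ _ g x
    induction x with
    | zero => simp
    | tmul a b => ext; simp
    | add a b ha hb => simp only [map_add, ha, hb, LinearMap.add_comp]
  have hinj : Function.Injective (LinearMap.lcomp R E p) := fun a b h => by
    ext x
    obtain ⟨y, rfl⟩ := hp x
    exact LinearMap.congr_fun h y
  have hex : Function.Exact (LinearMap.lcomp R E p) (LinearMap.lcomp R E f) :=
    lcomp_exact E hfp hp
  constructor
  · rw [injective_iff_map_eq_zero]
    intro x hx
    apply (Module.Flat.rTensor_preserves_injective_linearMap (M := K) _ hinj)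
    apply (free n).1
    rw [nat, hx, map_zero, map_zero, LinearMap.zero_comp]
  · intro h
    obtain ⟨y, hy⟩ := (free n).2 (h ∘ₗ p)
    have : (LinearMap.lcomp R E f).rTensor K y = 0 := by
      apply (free m).1
      rw [nat, hy, map_zero, LinearMap.comp_assoc, hfp.linearMap_comp_eq_zero, LinearMap.comp_zero]
    obtain ⟨x, rfl⟩ := (Module.Flat.rTensor_exact K hex y).1 this
    refine ⟨x, ?_⟩
    ext z
    obtain ⟨w, rfl⟩ := hp z
    rw [nat] at hy
    exact LinearMap.congr_fun hy w

/-- The evaluation map `N ⊗ Hom(E, I) → Hom(Hom(N, E), I)`. -/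
noncomputable def tensorHomToHomHom :
    N ⊗[R] (E →ₗ[R] K) →ₗ[R] ((N →ₗ[R] E) →ₗ[R] K) :=
  TensorProduct.lift ((LinearMap.llcomp R (N →ₗ[R] E) E K).flip ∘ₗ
    (LinearMap.applyₗ (R := R) (M := N) (M₂ := E)))

@[simp]
lemma tensorHomToHomHom_tmul (n : N) (g : E →ₗ[R] K) (φ : N →ₗ[R] E) :
    tensorHomToHomHom N E K (n ⊗ₜ g) φ = g (φ n) := rfl

lemma tensorHomToHomHom_bijective_pi (l : ℕ) :
    Function.Bijective (tensorHomToHomHom (R := R) (Fin l → R) E K) := by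
  let ev (i : Fin l) : (((Fin l → R) →ₗ[R] E) →ₗ[R] K) →ₗ[R] (E →ₗ[R] K) :=
    LinearMap.lcomp R K (LinearMap.smulRightₗ (LinearMap.proj i))
  let inv : (((Fin l → R) →ₗ[R] E) →ₗ[R] K) →ₗ[R] (Fin l → R) ⊗[R] (E →ₗ[R] K) :=
    ∑ i, (TensorProduct.mk R (Fin l → R) (E →ₗ[R] K) (Pi.single i 1)) ∘ₗ ev i
  have h1 : ∀ x, inv (tensorHomToHomHom (R := R) (Fin l → R) E K x) = x := by
    intro x
    induction x with
    | zero => simp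
    | add a b ha hb => simp only [map_add, ha, hb]
    | tmul v h =>
      have : ∀ i, ev i (tensorHomToHomHom (R := R) (Fin l → R) E K (v ⊗ₜ h)) = v i • h := by
        intro i
        ext e
        simp [ev]
      simp only [inv, LinearMap.sum_apply, LinearMap.comp_apply, this, TensorProduct.mk_apply,
        TensorProduct.tmul_smul, TensorProduct.smul_tmul']
      rw [← TensorProduct.sum_tmul]
      congr 1
      exact (pi_eq_sum_univ' v).symm
  have h2 : ∀ g, tensorHomToHomHom (R := R) (Fin l → R) E K (inv g) = g := by
    intro g
    ext φ
    simp only [inv, LinearMap.sum_apply, LinearMap.comp_apply, map_sum, TensorProduct.mk_apply,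
      tensorHomToHomHom_tmul, ev, LinearMap.lcomp_apply]
    rw [← map_sum]
    congr 1
    ext j
    simp [Pi.single_apply]
  exact ⟨fun a b h => by rw [← h1 a, h, h1], fun g => ⟨_, h2 g⟩⟩

/-- `N ⊗ Hom(E, I) ≅ Hom(Hom(N, E), I)` for `N` finitely presented and `I` injective. -/
lemma tensorHomToHomHom_bijective [Module.FinitePresentation R N] [Module.Injective R K] :
    Function.Bijective (tensorHomToHomHom (R := R) N E K) := by
  obtain ⟨m, n, f, p, hp, hfp⟩ := exists_finite_free_presentation (R := R) N
  have nat : ∀ {A B : Type u} [AddCommGroup A] [Module R A] [AddCommGroup B] [Module R B]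
      (g : A →ₗ[R] B) (x : A ⊗[R] (E →ₗ[R] K)),
      tensorHomToHomHom B E K (g.rTensor _ x) =
        (tensorHomToHomHom A E K x) ∘ₗ (LinearMap.lcomp R E g) := by
    intro A B _ _ _ _ g x
    induction x with
    | zero => simp
    | tmul a b => ext; simp
    | add a b ha hb => simp only [map_add, ha, hb, LinearMap.add_comp]
  have hinj : Function.Injective (LinearMap.lcomp R E p) := fun a b h => by
    ext x
    obtain ⟨y, rfl⟩ := hp x
    exact LinearMap.congr_fun h y
  have hex : Function.Exact (LinearMap.lcomp R E p) (LinearMap.lcomp R E f) :=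
    lcomp_exact E hfp hp
  have hsurj : Function.Surjective (p.rTensor (E →ₗ[R] K)) := LinearMap.rTensor_surjective _ hp
  constructor
  · rw [injective_iff_map_eq_zero]
    intro x hx
    obtain ⟨y, rfl⟩ := hsurj x
    rw [nat] at hx
    obtain ⟨h, hh⟩ : ∃ h : ((Fin m → R) →ₗ[R] E) →ₗ[R] K, h ∘ₗ LinearMap.lcomp R E f =
        tensorHomToHomHom _ E K y := by
      let q := LinearMap.ker (LinearMap.lcomp R E f)
      have hq : q ≤ LinearMap.ker (tensorHomToHomHom _ E K y) := by
        intro z hz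
        obtain ⟨w, rfl⟩ := (hex z).1 hz
        exact LinearMap.congr_fun hx w
      obtain ⟨h, hh⟩ := Module.Injective.out (R := R) (Q := K)
        (q.liftQ (LinearMap.lcomp R E f) le_rfl)
        (LinearMap.ker_eq_bot.mp (Submodule.ker_liftQ_eq_bot _ _ _ le_rfl))
        (q.liftQ (tensorHomToHomHom _ E K y) hq)
      refine ⟨h, ?_⟩
      ext z
      exact hh (Submodule.Quotient.mk z)
    obtain ⟨w, rfl⟩ := (tensorHomToHomHom_bijective_pi E K m).2 h
    rw [← nat] at hh
    rw [← (tensorHomToHomHom_bijective_pi E K n).1 hh, ← LinearMap.comp_apply,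
      ← LinearMap.rTensor_comp, hfp.linearMap_comp_eq_zero]
    simp
  · intro g
    obtain ⟨h, hh⟩ := Module.Injective.out (R := R) (Q := K) _ hinj g
    obtain ⟨y, rfl⟩ := (tensorHomToHomHom_bijective_pi E K n).2 h
    refine ⟨p.rTensor _ y, ?_⟩
    rw [nat]
    ext z
    exact hh z

end

end HomTensor

section FlatInjective

open TensorProduct

variable {R : Type u} [CommRing R]

lemma exists_projective_surjective (A : Type u) [AddCommGroup A] [Module R A] :
    ∃ (P : Type u) (_ : AddCommGroup P) (_ : Module R P) (p : P →ₗ[R] A),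
      Module.Projective R P ∧ Function.Surjective p :=
  ⟨A →₀ R, inferInstance, inferInstance, Finsupp.linearCombination R id, inferInstance,
    fun n => ⟨Finsupp.single n 1, by simp⟩⟩

/-- A short exact sequence with flat cokernel is pure. -/
lemma lTensor_injective_of_flat_cokernel {A P F : Type u} (N : Type u) [AddCommGroup A] [Module R A]
    [AddCommGroup P] [Module R P] [AddCommGroup F] [Module R F] [AddCommGroup N] [Module R N]
    [Module.Flat R F] {i : A →ₗ[R] P} {p : P →ₗ[R] F} (hi : Function.Injective i)
    (hip : Function.Exact i p) (hp : Function.Surjective p) :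
    Function.Injective (i.lTensor N) := by
  rw [injective_iff_map_eq_zero]
  intro x hx
  obtain ⟨L, _, _, q, _, hq⟩ := exists_projective_surjective (R := R) N
  obtain ⟨K, _, _, k, hk, hkq⟩ : ∃ (K : Type u) (_ : AddCommGroup K) (_ : Module R K)
      (k : K →ₗ[R] L), Function.Injective k ∧ Function.Exact k q :=
    ⟨LinearMap.ker q, inferInstance, inferInstance, (LinearMap.ker q).subtype,
      Submodule.subtype_injective _, LinearMap.exact_subtype_ker_map q⟩
  obtain ⟨y, rfl⟩ := LinearMap.rTensor_surjective A hq x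
  rw [← LinearMap.comp_apply, LinearMap.lTensor_comp_rTensor,
    ← LinearMap.rTensor_comp_lTensor, LinearMap.comp_apply] at hx
  obtain ⟨z, hz⟩ := (rTensor_exact P hkq hq _).1 hx
  have hz0 : p.lTensor _ z = 0 := by
    apply Module.Flat.rTensor_preserves_injective_linearMap (M := F) k hk
    rw [map_zero, ← LinearMap.comp_apply, LinearMap.rTensor_comp_lTensor,
      ← LinearMap.lTensor_comp_rTensor, LinearMap.comp_apply, hz, ← LinearMap.comp_apply,
      ← LinearMap.lTensor_comp, hip.linearMap_comp_eq_zero]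
    simp
  obtain ⟨w, rfl⟩ := (lTensor_exact _ hip hp z).1 hz0
  have hy : y = k.rTensor A w := by
    apply Module.Flat.lTensor_preserves_injective_linearMap (M := L) i hi
    rw [← hz, ← LinearMap.comp_apply, ← LinearMap.comp_apply, LinearMap.lTensor_comp_rTensor,
      ← LinearMap.rTensor_comp_lTensor]
  rw [hy, ← LinearMap.comp_apply, ← LinearMap.rTensor_comp, hkq.linearMap_comp_eq_zero]
  simp

/-- The kernel of an epimorphism of flat modules is flat. -/
lemma flat_of_exact {A P F : Type u} [AddCommGroup A] [Module R A]
    [AddCommGroup P] [Module R P] [AddCommGroup F] [Module R F]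
    [Module.Flat R P] [Module.Flat R F] {i : A →ₗ[R] P} {p : P →ₗ[R] F} (hi : Function.Injective i)
    (hip : Function.Exact i p) (hp : Function.Surjective p) : Module.Flat R A := by
  rw [Module.Flat.iff_rTensor_injective']
  intro I
  have h := (Module.Flat.rTensor_preserves_injective_linearMap (M := P) I.subtype
    (Submodule.subtype_injective _)).comp (lTensor_injective_of_flat_cokernel I hi hip hp)
  rw [← LinearMap.coe_comp, LinearMap.rTensor_comp_lTensor, ← LinearMap.lTensor_comp_rTensor,
    LinearMap.coe_comp] at h
  exact h.of_comp

/-- Over a noetherian ring, tensoring an injective module with a flat one gives an injective one. -/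
lemma injective_tensor_flat [IsNoetherianRing R] (E K : Type u) [AddCommGroup E] [Module R E]
    [AddCommGroup K] [Module R K] [Module.Injective R E] [Module.Flat R K] :
    Module.Injective R (E ⊗[R] K) := by
  apply Module.Baer.injective
  intro I g
  have : Module.FinitePresentation R I := Module.finitePresentation_of_finite R I
  obtain ⟨x, rfl⟩ := (rTensorHomToHomRTensor_bijective I E K).2 g
  have hs : Function.Surjective (LinearMap.lcomp R E I.subtype) := fun f => by
    obtain ⟨h, hh⟩ := Module.Injective.out (R := R) (Q := E) I.subtype
      (Submodule.subtype_injective _) f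
    exact ⟨h, LinearMap.ext hh⟩
  obtain ⟨y, rfl⟩ := LinearMap.rTensor_surjective K hs x
  refine ⟨rTensorHomToHomRTensor (RingHom.id R) R E K y, fun x hx => ?_⟩
  induction y with
  | zero => simp
  | tmul a b => simp
  | add a b ha hb => simp only [map_add, LinearMap.add_apply, ha, hb]

/-- Over a noetherian ring, the module of homomorphisms between injectives is flat. -/
lemma flat_hom_injective [IsNoetherianRing R] (E I : Type u) [AddCommGroup E] [Module R E]
    [AddCommGroup I] [Module R I] [Module.Injective R E] [Module.Injective R I] :
    Module.Flat R (E →ₗ[R] I) := by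
  rw [Module.Flat.iff_rTensor_injective']
  intro J
  have : Module.FinitePresentation R J := Module.finitePresentation_of_finite R J
  rw [injective_iff_map_eq_zero]
  intro x hx
  apply (tensorHomToHomHom_bijective J E I).1
  ext f
  obtain ⟨h, hh⟩ := Module.Injective.out (R := R) (Q := E) J.subtype
    (Submodule.subtype_injective _) f
  obtain rfl : h ∘ₗ J.subtype = f := LinearMap.ext hh
  have : tensorHomToHomHom R E I (J.subtype.rTensor _ x) h =
      tensorHomToHomHom J E I x (h ∘ₗ J.subtype) := by
    clear hx
    induction x with
    | zero => simp
    | tmul a b => simp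
    | add a b ha hb => simp only [map_add, LinearMap.add_apply, ha, hb]
  rw [← this, hx]
  simp

/-- `Ext¹(F, M) = 0`, in terms of extensions of homomorphisms from kernels of projective covers. -/
def ExtOneVanishes (F M : Type u) [AddCommGroup F] [Module R F] [AddCommGroup M] [Module R M] :
    Prop :=
  ∀ (P : Type u) [AddCommGroup P] [Module R P] [Module.Projective R P] (p : P →ₗ[R] F),
    Function.Surjective p → ∀ f : LinearMap.ker p →ₗ[R] M, ∃ g : P →ₗ[R] M,
      g ∘ₗ (LinearMap.ker p).subtype = f

variable (R) in
/-- The `n`-th syzygies of flat modules. -/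
def FlatSyzygy : ℕ → ∀ (A : Type u) [AddCommGroup A] [Module R A], Prop
  | 0, A, _, _ => Module.Flat R A
  | n + 1, A, _, _ => ∃ (F P : Type u) (_ : AddCommGroup F) (_ : Module R F) (_ : AddCommGroup P)
      (_ : Module R P) (p : P →ₗ[R] F), FlatSyzygy n F ∧ Module.Projective R P ∧
      Function.Surjective p ∧ Nonempty (A ≃ₗ[R] LinearMap.ker p)

lemma FlatSyzygy.flat {n : ℕ} {A : Type u} [AddCommGroup A] [Module R A] (h : FlatSyzygy R n A) :
    Module.Flat R A := by
  induction n generalizing A with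
  | zero => exact h
  | succ n ih =>
    obtain ⟨F, P, _, _, _, _, p, hF, _, hp, ⟨e⟩⟩ := h
    have := ih hF
    have : Module.Flat R (LinearMap.ker p) :=
      flat_of_exact (Submodule.subtype_injective _) (LinearMap.exact_subtype_ker_map p) hp
    exact Module.Flat.of_linearEquiv e

/-- `Ext^i(F, M) = 0` for all flat modules `F` and all `i > n`. -/
def FlatExtVanishesAbove (n : ℕ) (M : Type u) [AddCommGroup M] [Module R M] : Prop :=
  ∀ (F : Type u) [AddCommGroup F] [Module R F], FlatSyzygy R n F → ExtOneVanishes (R := R) F M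

section

variable {M' M M'' : Type u} [AddCommGroup M'] [Module R M'] [AddCommGroup M] [Module R M]
  [AddCommGroup M''] [Module R M''] {i : M' →ₗ[R] M} {p : M →ₗ[R] M''}

lemma exists_comp_eq_of_exact {A : Type u} [AddCommGroup A] [Module R A]
    (hi : Function.Injective i) (hip : Function.Exact i p) (f : A →ₗ[R] M) (hf : p ∘ₗ f = 0) :
    ∃ g : A →ₗ[R] M', i ∘ₗ g = f := by
  have h : ∀ a, f a ∈ LinearMap.range i := fun a => (hip _).1 (LinearMap.congr_fun hf a)
  refine ⟨(LinearEquiv.ofInjective i hi).symm ∘ₗ f.codRestrict _ h, ?_⟩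
  ext a
  have := LinearEquiv.apply_symm_apply (LinearEquiv.ofInjective i hi) ⟨f a, h a⟩
  exact congrArg Subtype.val this

lemma exists_eq_comp_of_surjective {A : Type u} [AddCommGroup A] [Module R A]
    (hp : Function.Surjective p) (f : M →ₗ[R] A) (hf : ∀ x, p x = 0 → f x = 0) :
    ∃ g : M'' →ₗ[R] A, g ∘ₗ p = f := by
  refine ⟨(LinearMap.ker p).liftQ f (fun x hx => hf x hx) ∘ₗ
    (p.quotKerEquivOfSurjective hp).symm, ?_⟩
  ext x
  have : (p.quotKerEquivOfSurjective hp).symm (p x) = Submodule.Quotient.mk x := by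
    rw [LinearEquiv.symm_apply_eq]; rfl
  simp only [LinearMap.comp_apply, LinearEquiv.coe_coe, this]
  rfl

lemma FlatExtVanishesAbove.of_surjective {n : ℕ} (h' : FlatExtVanishesAbove (R := R) 0 M')
    (h : FlatExtVanishesAbove (R := R) n M) (hi : Function.Injective i)
    (hip : Function.Exact i p) (hp : Function.Surjective p) :
    FlatExtVanishesAbove (R := R) n M'' := by
  intro F _ _ hF P _ _ _ π hπ f
  have := hF.flat
  have hA : Module.Flat R (LinearMap.ker π) :=
    flat_of_exact (Submodule.subtype_injective _) (LinearMap.exact_subtype_ker_map π) hπ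
  obtain ⟨P', _, _, π', _, hπ'⟩ := exists_projective_surjective (R := R) (LinearMap.ker π)
  obtain ⟨l, hl⟩ := Module.projective_lifting_property p (f ∘ₗ π') hp
  obtain ⟨l', hl'⟩ := exists_comp_eq_of_exact hi hip (l ∘ₗ (LinearMap.ker π').subtype) (by
    rw [← LinearMap.comp_assoc, hl, LinearMap.comp_assoc]
    ext x
    have hx : π' x = 0 := x.2
    simp [hx])
  obtain ⟨m, hm⟩ := h' _ hA P' π' hπ' l'
  obtain ⟨g, hg⟩ := exists_eq_comp_of_surjective hπ' (l - i ∘ₗ m) (fun x hx => by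
    have h1 := LinearMap.congr_fun hm ⟨x, hx⟩
    have h2 := LinearMap.congr_fun hl' ⟨x, hx⟩
    simp only [LinearMap.comp_apply, Submodule.subtype_apply] at h1 h2
    simp [h1, h2])
  obtain ⟨k, hk⟩ := h F hF P π hπ g
  refine ⟨p ∘ₗ k, ?_⟩
  rw [LinearMap.comp_assoc, hk]
  ext x
  obtain ⟨y, rfl⟩ := hπ' x
  have h1 := LinearMap.congr_fun hg y
  have h2 := LinearMap.congr_fun hl y
  simp only [LinearMap.comp_apply, LinearMap.sub_apply] at h1 h2 ⊢
  rw [h1, map_sub, h2, hip.apply_apply_eq_zero, sub_zero]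

lemma FlatExtVanishesAbove.of_injective {n : ℕ} (h : FlatExtVanishesAbove (R := R) 0 M)
    (h'' : FlatExtVanishesAbove (R := R) n M'') (hi : Function.Injective i)
    (hip : Function.Exact i p) (hp : Function.Surjective p) :
    FlatExtVanishesAbove (R := R) (n + 1) M' := by
  intro F _ _ hF P _ _ _ π hπ f
  obtain ⟨g, hg⟩ := h F hF.flat P π hπ (i ∘ₗ f)
  obtain ⟨F₂, P₂, _, _, _, _, π₂, hF₂, _, hπ₂, ⟨e⟩⟩ := hF
  obtain ⟨k, hk⟩ := exists_eq_comp_of_surjective hπ (p ∘ₗ g) (fun x hx => by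
    have h1 := LinearMap.congr_fun hg ⟨x, hx⟩
    simp only [LinearMap.comp_apply, Submodule.subtype_apply] at h1 ⊢
    rw [h1, hip.apply_apply_eq_zero])
  obtain ⟨l, hl⟩ := h'' F₂ hF₂ P₂ π₂ hπ₂ (k ∘ₗ e.symm)
  obtain ⟨m, hm⟩ := Module.projective_lifting_property p l hp
  obtain ⟨r, hr⟩ := exists_comp_eq_of_exact hi hip
      (g - m ∘ₗ (LinearMap.ker π₂).subtype ∘ₗ e.toLinearMap ∘ₗ π) (by
    rw [LinearMap.comp_sub, ← LinearMap.comp_assoc, hm, ← LinearMap.comp_assoc, hl, ← hk,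
      sub_eq_zero]
    ext x
    simp)
  refine ⟨r, ?_⟩
  ext x
  apply hi
  have h1 := LinearMap.congr_fun hr x
  have h2 := LinearMap.congr_fun hg x
  have h3 : π x = 0 := x.2
  simp only [LinearMap.comp_apply, LinearMap.sub_apply, Submodule.subtype_apply, h3, map_zero,
    sub_zero] at h1 h2 ⊢
  rw [h1, h2]

end

lemma FlatExtVanishesAbove.of_equiv {n : ℕ} {M N : Type u} [AddCommGroup M] [Module R M]
    [AddCommGroup N] [Module R N] (h : FlatExtVanishesAbove (R := R) n M) (e : M ≃ₗ[R] N) :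
    FlatExtVanishesAbove (R := R) n N := by
  intro F _ _ hF P _ _ _ π hπ f
  obtain ⟨g, hg⟩ := h F hF P π hπ (e.symm ∘ₗ f)
  exact ⟨e ∘ₗ g, by rw [LinearMap.comp_assoc, hg]; ext; simp⟩

/-- `Hom(N, E)` is cotorsion for `E` injective. -/
lemma flatExtVanishesAbove_hom (N E : Type u) [AddCommGroup N] [Module R N]
    [AddCommGroup E] [Module R E] [Module.Injective R E] :
    FlatExtVanishesAbove (R := R) 0 (N →ₗ[R] E) := by
  intro F _ _ hF P _ _ _ π hπ f
  have : Module.Flat R F := hF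
  have hinj := lTensor_injective_of_flat_cokernel (R := R) N (Submodule.subtype_injective _)
    (LinearMap.exact_subtype_ker_map π) hπ
  obtain ⟨h, hh⟩ := Module.Injective.out (R := R) (Q := E) _ hinj (TensorProduct.lift f.flip)
  refine ⟨(TensorProduct.curry h).flip, ?_⟩
  ext x n
  simpa using hh (n ⊗ₜ x)

lemma FlatExtVanishesAbove.pi {ι : Type} [Finite ι] {n : ℕ} (M : ι → Type u)
    [∀ i, AddCommGroup (M i)] [∀ i, Module R (M i)]
    (h : ∀ i, FlatExtVanishesAbove (R := R) n (M i)) :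
    FlatExtVanishesAbove (R := R) n (∀ i, M i) := by
  intro F _ _ hF P _ _ _ π hπ f
  choose g hg using fun i => h i F hF P π hπ (LinearMap.proj i ∘ₗ f)
  refine ⟨LinearMap.pi g, ?_⟩
  ext x i
  exact LinearMap.congr_fun (hg i) x

/-- If `Ext^i(F, K) = 0` for all flat `F, K` and `i > n`, then `n`-th syzygies of flat modules are
projective. -/
lemma FlatSyzygy.projective {n : ℕ}
    (hn : ∀ (K : Type u) [AddCommGroup K] [Module R K], Module.Flat R K →
      FlatExtVanishesAbove (R := R) n K)
    {F : Type u} [AddCommGroup F] [Module R F] (hF : FlatSyzygy R n F) : Module.Projective R F := by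
  have := hF.flat
  obtain ⟨P, _, _, π, _, hπ⟩ := exists_projective_surjective (R := R) F
  have hA : Module.Flat R (LinearMap.ker π) :=
    flat_of_exact (Submodule.subtype_injective _) (LinearMap.exact_subtype_ker_map π) hπ
  obtain ⟨g, hg⟩ := hn _ hA F hF P π hπ LinearMap.id
  obtain ⟨s, hs⟩ := exists_eq_comp_of_surjective hπ
    (LinearMap.id - (LinearMap.ker π).subtype ∘ₗ g) (fun x hx => by
      have := LinearMap.congr_fun hg ⟨x, hx⟩
      simp only [LinearMap.comp_apply, Submodule.subtype_apply, LinearMap.id_apply] at this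
      simp [this])
  refine Module.Projective.of_split s π ?_
  ext x
  obtain ⟨y, rfl⟩ := hπ x
  have h1 := LinearMap.congr_fun hs y
  have h2 : π (g y) = 0 := (g y).2
  simp only [LinearMap.comp_apply, LinearMap.sub_apply, LinearMap.id_apply,
    Submodule.subtype_apply] at h1 ⊢
  rw [h1, map_sub, h2, sub_zero]

/-- Descending induction along a projective resolution of a flat module of finite projective
dimension. -/
lemma flat_induction {n : ℕ}
    (hn : ∀ (K : Type u) [AddCommGroup K] [Module R K], Module.Flat R K →
      FlatExtVanishesAbove (R := R) n K)
    (κ : ∀ (F : Type u) [AddCommGroup F] [Module R F], Prop)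
    (hproj : ∀ (F : Type u) [AddCommGroup F] [Module R F], Module.Projective R F → κ F)
    (hexact : ∀ (A P F : Type u) [AddCommGroup A] [Module R A] [AddCommGroup P] [Module R P]
      [AddCommGroup F] [Module R F] (i : A →ₗ[R] P) (p : P →ₗ[R] F), Module.Flat R F →
      Function.Injective i → Function.Exact i p → Function.Surjective p → κ A → κ P → κ F)
    (F : Type u) [AddCommGroup F] [Module R F] (hF : Module.Flat R F) : κ F := by
  have key : ∀ j k : ℕ, j + k = n → ∀ (F : Type u) [AddCommGroup F] [Module R F],
      FlatSyzygy R k F → κ F := by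
    intro j
    induction j with
    | zero =>
      intro k hk F _ _ hF
      obtain rfl : k = n := by omega
      exact hproj F (hF.projective hn)
    | succ j ih =>
      intro k hk F _ _ hF
      obtain ⟨P, _, _, π, hP, hπ⟩ := exists_projective_surjective (R := R) F
      exact hexact _ P F _ π hF.flat (Submodule.subtype_injective _)
        (LinearMap.exact_subtype_ker_map π) hπ
        (ih (k + 1) (by omega) _ ⟨F, P, _, _, _, _, π, hF, hP, hπ, ⟨LinearEquiv.refl R _⟩⟩)
        (hproj P hP)
  exact key n 0 (by omega) F hF

end FlatInjective

section Chase

variable {R : Type u} [CommRing R]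

/-- Dimension shifting along a bounded complex of modules `T` whose only cohomology is `N`,
in degree zero. -/
lemma bounded_complex_chase {T : ℤ → Type u} [∀ n, AddCommGroup (T n)] [∀ n, Module R (T n)]
    (d : ∀ i j, T i →ₗ[R] T j) (a : ℤ) (b : ℕ) (ha : ∀ n < a, Subsingleton (T n))
    (hb : ∀ n > (b : ℤ), Subsingleton (T n))
    (hd : ∀ i j k, i + 1 = j → j + 1 = k → ∀ x, d j k (d i j x) = 0)
    (hex : ∀ i j k, i + 1 = j → j + 1 = k → j ≠ 0 → ∀ x, d j k x = 0 → ∃ y, d i j y = x)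
    {N : Type u} [AddCommGroup N] [Module R N] (v : N →ₗ[R] T 0) (hv : ∀ x, d 0 1 (v x) = 0)
    (hsurj : ∀ x, d 0 1 x = 0 → ∃ r y, x = v r + d (-1) 0 y)
    (hinj : ∀ r y, v r = d (-1) 0 y → r = 0)
    (κ : ℕ → ∀ (M : Type u) [AddCommGroup M] [Module R M], Prop)
    (hzero : ∀ (M : Type u) [AddCommGroup M] [Module R M], Subsingleton M → κ 0 M)
    (hequiv : ∀ k (M M' : Type u) [AddCommGroup M] [Module R M] [AddCommGroup M'] [Module R M'],
      (M ≃ₗ[R] M') → κ k M → κ k M')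
    (hcoker : ∀ k (M' M M'' : Type u) [AddCommGroup M'] [Module R M'] [AddCommGroup M] [Module R M]
      [AddCommGroup M''] [Module R M''] (i : M' →ₗ[R] M) (p : M →ₗ[R] M''),
      Function.Injective i → Function.Exact i p → Function.Surjective p → κ 0 M' → κ k M → κ k M'')
    (hker : ∀ k (M' M M'' : Type u) [AddCommGroup M'] [Module R M'] [AddCommGroup M] [Module R M]
      [AddCommGroup M''] [Module R M''] (i : M' →ₗ[R] M) (p : M →ₗ[R] M''),
      Function.Injective i → Function.Exact i p → Function.Surjective p → κ 0 M → κ k M'' →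
      κ (k + 1) M')
    (hT : ∀ n, κ 0 (T n)) : κ (b + 1) N := by
  have hB : ∀ k : ℕ, ∀ n : ℤ, n ≤ 0 → n = a + k → κ 0 (LinearMap.range (d (n - 1) n)) := by
    intro k
    induction k with
    | zero =>
      intro n hn hk
      apply hzero
      have := ha (n - 1) (by simp at hk; omega)
      refine ⟨fun ⟨x, y, hy⟩ ⟨x', y', hy'⟩ => ?_⟩
      obtain rfl : y = y' := Subsingleton.elim _ _
      exact Subtype.ext (hy.symm.trans hy')
    | succ k ih =>
      intro n hn hk
      have h := ih (n - 1) (by omega) (by push_cast at hk; omega)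
      refine hcoker 0 _ _ _ (LinearMap.range (d (n - 1 - 1) (n - 1))).subtype
        (d (n - 1) n).rangeRestrict (Submodule.subtype_injective _) ?_
        (LinearMap.surjective_rangeRestrict _) h (hT _)
      intro x
      constructor
      · intro hx
        obtain ⟨y, hy⟩ := hex (n - 1 - 1) (n - 1) n (by omega) (by omega) (by omega) x
          (congrArg Subtype.val hx)
        exact ⟨⟨x, y, hy⟩, rfl⟩
      · rintro ⟨⟨x, y, rfl⟩, rfl⟩
        exact Subtype.ext (hd _ _ _ (by omega) (by omega) y)
  have hB0 : κ 0 (LinearMap.range (d (-1) 0)) := by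
    by_cases h : a ≤ 0
    · exact hB (-a).toNat 0 le_rfl (by omega)
    · have := ha (-1) (by omega)
      apply hzero
      refine ⟨fun ⟨x, y, hy⟩ ⟨x', y', hy'⟩ => ?_⟩
      obtain rfl : y = y' := Subsingleton.elim _ _
      exact Subtype.ext (hy.symm.trans hy')
  have hZ : ∀ k : ℕ, ∀ n : ℤ, 0 ≤ n → n = b + 1 - k → κ k (LinearMap.ker (d n (n + 1))) := by
    intro k
    induction k with
    | zero =>
      intro n hn hk
      have := hb n (by simp at hk; omega)
      exact hzero _ inferInstance
    | succ k ih =>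
      intro n hn hk
      have h := ih (n + 1) (by omega) (by push_cast at hk; omega)
      refine hker k _ _ _ (LinearMap.ker (d n (n + 1))).subtype
        ((d n (n + 1)).codRestrict (LinearMap.ker (d (n + 1) (n + 1 + 1)))
          (fun x => hd _ _ _ rfl rfl x)) (Submodule.subtype_injective _) ?_ ?_ (hT n) h
      · intro x
        constructor
        · intro hx
          exact ⟨⟨x, congrArg Subtype.val hx⟩, rfl⟩
        · rintro ⟨⟨x, hx⟩, rfl⟩
          exact Subtype.ext hx
      · rintro ⟨x, hx⟩
        obtain ⟨y, hy⟩ := hex n (n + 1) (n + 1 + 1) rfl rfl (by omega) x hx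
        exact ⟨y, Subtype.ext hy⟩
  have hZ0 : κ (b + 1) (LinearMap.ker (d 0 1)) := hZ (b + 1) 0 le_rfl (by push_cast; omega)
  let B := (LinearMap.range (d (-1) 0)).comap (LinearMap.ker (d 0 1)).subtype
  let e : LinearMap.range (d (-1) 0) →ₗ[R] LinearMap.ker (d 0 1) :=
    Submodule.inclusion (by
      rintro _ ⟨y, rfl⟩
      exact hd _ _ _ (by omega) (by omega) y)
  have hquot : κ (b + 1) (LinearMap.ker (d 0 1) ⧸ B) := by
    refine hcoker _ _ _ _ e B.mkQ (Submodule.inclusion_injective _) ?_ (Submodule.mkQ_surjective _)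
      hB0 hZ0
    intro x
    rw [Submodule.mkQ_apply, Submodule.Quotient.mk_eq_zero]
    constructor
    · rintro ⟨y, hy⟩
      exact ⟨⟨x.1, y, hy⟩, rfl⟩
    · rintro ⟨⟨x, y, rfl⟩, rfl⟩
      exact ⟨y, rfl⟩
  let w : N →ₗ[R] (LinearMap.ker (d 0 1) ⧸ B) := B.mkQ ∘ₗ v.codRestrict _ hv
  have hw : Function.Bijective w := by
    constructor
    · rw [injective_iff_map_eq_zero]
      intro x hx
      obtain ⟨y, hy⟩ := (Submodule.Quotient.mk_eq_zero B).1 hx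
      exact hinj x y hy.symm
    · intro x
      obtain ⟨⟨x, hx⟩, rfl⟩ := Submodule.mkQ_surjective _ x
      obtain ⟨r, y, rfl⟩ := hsurj x hx
      refine ⟨r, ?_⟩
      refine (Submodule.Quotient.eq B).2 ⟨-y, ?_⟩
      rw [map_neg]
      change _ = v r - (v r + d (-1) 0 y)
      abel
  exact hequiv _ _ _ (LinearEquiv.ofBijective w hw).symm hquot

/-- In a bounded exact complex, if all terms but one belong to a class of modules with the
two-out-of-three property, then so does the remaining one. -/
lemma bounded_exact_chase {E : ℤ → Type u} [∀ n, AddCommGroup (E n)] [∀ n, Module R (E n)]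
    (d : ∀ i j, E i →ₗ[R] E j) (a b m : ℤ) (ha : ∀ n < a, Subsingleton (E n))
    (hb : ∀ n > b, Subsingleton (E n))
    (hd : ∀ i j k, i + 1 = j → j + 1 = k → ∀ x, d j k (d i j x) = 0)
    (hex : ∀ i j k, i + 1 = j → j + 1 = k → ∀ x, d j k x = 0 → ∃ y, d i j y = x)
    (κ : ∀ (M : Type u) [AddCommGroup M] [Module R M], Prop)
    (hzero : ∀ (M : Type u) [AddCommGroup M] [Module R M], Subsingleton M → κ M)
    (hcoker : ∀ (M' M M'' : Type u) [AddCommGroup M'] [Module R M'] [AddCommGroup M] [Module R M]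
      [AddCommGroup M''] [Module R M''] (i : M' →ₗ[R] M) (p : M →ₗ[R] M''),
      Function.Injective i → Function.Exact i p → Function.Surjective p → κ M' → κ M → κ M'')
    (hker : ∀ (M' M M'' : Type u) [AddCommGroup M'] [Module R M'] [AddCommGroup M] [Module R M]
      [AddCommGroup M''] [Module R M''] (i : M' →ₗ[R] M) (p : M →ₗ[R] M''),
      Function.Injective i → Function.Exact i p → Function.Surjective p → κ M → κ M'' → κ M')
    (hext : ∀ (M' M M'' : Type u) [AddCommGroup M'] [Module R M'] [AddCommGroup M] [Module R M]
      [AddCommGroup M''] [Module R M''] (i : M' →ₗ[R] M) (p : M →ₗ[R] M''),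
      Function.Injective i → Function.Exact i p → Function.Surjective p → κ M' → κ M'' → κ M)
    (hE : ∀ n, n ≠ m → κ (E n)) : κ (E m) := by
  let Z (n : ℤ) := LinearMap.ker (d n (n + 1))
  let p (n : ℤ) : E n →ₗ[R] Z (n + 1) := (d n (n + 1)).codRestrict (Z (n + 1))
          (fun x => hd _ _ _ rfl rfl x)
  have hp (n : ℤ) : Function.Surjective (p n) := by
    rintro ⟨x, hx⟩
    obtain ⟨y, hy⟩ := hex n (n + 1) (n + 1 + 1) rfl rfl x hx
    exact ⟨y, Subtype.ext hy⟩
  have hpe (n : ℤ) : Function.Exact (Z n).subtype (p n) := by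
    intro x
    constructor
    · intro hx
      exact ⟨⟨x, congrArg Subtype.val hx⟩, rfl⟩
    · rintro ⟨⟨x, hx⟩, rfl⟩
      exact Subtype.ext hx
  have h1 : ∀ k : ℕ, ∀ n ≤ m, n < a + k → κ (Z n) := by
    intro k
    induction k with
    | zero =>
      intro n _ hn
      have := ha n (by simpa using hn)
      exact hzero _ inferInstance
    | succ k ih =>
      intro n hm hn
      obtain ⟨n, rfl⟩ : ∃ l, n = l + 1 := ⟨n - 1, by omega⟩
      exact hcoker _ _ _ (Z n).subtype (p n) (Submodule.subtype_injective _) (hpe n) (hp n)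
        (ih n (by omega) (by push_cast at hn; omega)) (hE n (by omega))
  have h2 : ∀ k : ℕ, ∀ n > m, n > b - k → κ (Z n) := by
    intro k
    induction k with
    | zero =>
      intro n _ hn
      have := hb n (by simpa using hn)
      exact hzero _ inferInstance
    | succ k ih =>
      intro n hm hn
      exact hker _ _ _ (Z n).subtype (p n) (Submodule.subtype_injective _) (hpe n) (hp n)
        (hE n (by omega)) (ih (n + 1) (by omega) (by push_cast at hn; omega))
  exact hext _ _ _ (Z m).subtype (p m) (Submodule.subtype_injective _) (hpe m) (hp m)
    (h1 (m - a + 1).toNat m le_rfl (by omega)) (h2 (b - m).toNat (m + 1) (by omega) (by omega))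

end Chase

section Lifts

open CategoryTheory TensorProduct

variable {R : Type u} [CommRing R]

/-- Every homomorphism from `N` to the cycles of `C` lifts along the differential: the complex
`Hom(N, C)` is exact. -/
def Lifts (C : ChainComplex (ModuleCat.{u} R) ℤ) (N : Type u) [AddCommGroup N]
    [Module R N] : Prop :=
  ∀ i j k : ℤ, j + 1 = i → k + 1 = j → ∀ f : N →ₗ[R] C.X j, (C.d j k).hom ∘ₗ f = 0 →
    ∃ g : N →ₗ[R] C.X i, (C.d i j).hom ∘ₗ g = f

variable {C : ChainComplex (ModuleCat.{u} R) ℤ}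

lemma ChainComplex.hom_d_comp_hom_d (i j k : ℤ) : (C.d j k).hom ∘ₗ (C.d i j).hom = 0 := by
  rw [← ModuleCat.hom_comp, C.d_comp_d, ModuleCat.hom_zero]

lemma exists_extension {A B E : Type u} [AddCommGroup A] [Module R A] [AddCommGroup B] [Module R B]
    [AddCommGroup E] [Module R E] [Module.Injective R E] {i : A →ₗ[R] B} (hi : Function.Injective i)
    (f : A →ₗ[R] E) : ∃ g : B →ₗ[R] E, g ∘ₗ i = f := by
  obtain ⟨g, hg⟩ := Module.Injective.out i hi f
  exact ⟨g, LinearMap.ext hg⟩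

namespace Lifts

section

variable {M' M M'' : Type u} [AddCommGroup M'] [Module R M'] [AddCommGroup M] [Module R M]
  [AddCommGroup M''] [Module R M''] {i : M' →ₗ[R] M} {p : M →ₗ[R] M''}
  (hC : ∀ n, Module.Injective R (C.X n))

include hC

lemma extension (hi : Function.Injective i) (hip : Function.Exact i p) (hp : Function.Surjective p)
    (h' : Lifts C M') (h'' : Lifts C M'') : Lifts C M := by
  intro i₁ j₁ k₁ hij hjk f hf
  obtain ⟨g, hg⟩ := h' i₁ j₁ k₁ hij hjk (f ∘ₗ i) (by
    rw [← LinearMap.comp_assoc, hf, LinearMap.zero_comp])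
  have := hC i₁
  obtain ⟨g', rfl⟩ := exists_extension hi g
  obtain ⟨h, hh⟩ := exists_eq_comp_of_surjective hp (f - (C.d i₁ j₁).hom ∘ₗ g') (fun x hx => by
    obtain ⟨y, rfl⟩ := (hip x).1 hx
    have := LinearMap.congr_fun hg y
    simp only [LinearMap.comp_apply] at this
    simp [this])
  obtain ⟨k, hk⟩ := h'' i₁ j₁ k₁ hij hjk h (by
    rw [← LinearMap.cancel_right hp, LinearMap.comp_assoc, hh, LinearMap.comp_sub, hf,
      ← LinearMap.comp_assoc, ChainComplex.hom_d_comp_hom_d]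
    simp)
  refine ⟨g' + k ∘ₗ p, ?_⟩
  rw [LinearMap.comp_add, ← LinearMap.comp_assoc, hk, hh]
  abel

lemma of_surjective (hi : Function.Injective i) (hip : Function.Exact i p)
    (hp : Function.Surjective p) (h' : Lifts C M') (h : Lifts C M) : Lifts C M'' := by
  intro i₁ j₁ k₁ hij hjk f hf
  obtain ⟨g, hg⟩ := h i₁ j₁ k₁ hij hjk (f ∘ₗ p) (by
    rw [← LinearMap.comp_assoc, hf, LinearMap.zero_comp])
  obtain ⟨l, hl⟩ := h' (i₁ + 1) i₁ j₁ rfl hij (g ∘ₗ i) (by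
    rw [← LinearMap.comp_assoc, hg, LinearMap.comp_assoc, hip.linearMap_comp_eq_zero]
    simp)
  have := hC (i₁ + 1)
  obtain ⟨l', rfl⟩ := exists_extension hi l
  obtain ⟨k, hk⟩ := exists_eq_comp_of_surjective hp (g - (C.d (i₁ + 1) i₁).hom ∘ₗ l')
    (fun x hx => by
      obtain ⟨y, rfl⟩ := (hip x).1 hx
      have := LinearMap.congr_fun hl y
      simp only [LinearMap.comp_apply] at this
      simp [this])
  refine ⟨k, ?_⟩
  rw [← LinearMap.cancel_right hp, LinearMap.comp_assoc, hk, LinearMap.comp_sub, hg,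
    ← LinearMap.comp_assoc, ChainComplex.hom_d_comp_hom_d]
  simp

lemma of_injective (hi : Function.Injective i) (hip : Function.Exact i p)
    (hp : Function.Surjective p) (h : Lifts C M) (h'' : Lifts C M'') : Lifts C M' := by
  intro i₁ j₁ k₁ hij hjk f hf
  have := hC j₁
  obtain ⟨f', rfl⟩ := exists_extension hi f
  obtain ⟨l, hl⟩ := exists_eq_comp_of_surjective hp ((C.d j₁ k₁).hom ∘ₗ f') (fun x hx => by
      obtain ⟨y, rfl⟩ := (hip x).1 hx
      exact LinearMap.congr_fun hf y)
  obtain ⟨k, hk⟩ := h'' j₁ k₁ (k₁ - 1) hjk (by omega) l (by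
    rw [← LinearMap.cancel_right hp, LinearMap.comp_assoc, hl, 
      ← LinearMap.comp_assoc, ChainComplex.hom_d_comp_hom_d]
    simp)
  obtain ⟨g, hg⟩ := h i₁ j₁ k₁ hij hjk (f' - k ∘ₗ p) (by
    rw [LinearMap.comp_sub, ← LinearMap.comp_assoc, hk, hl, sub_self])
  refine ⟨g ∘ₗ i, ?_⟩
  rw [← LinearMap.comp_assoc, hg, LinearMap.sub_comp, LinearMap.comp_assoc,
    hip.linearMap_comp_eq_zero]
  simp

end

lemma of_retract {A B : Type u} [AddCommGroup A] [Module R A] [AddCommGroup B] [Module R B]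
    (s : A →ₗ[R] B) (r : B →ₗ[R] A) (h : r ∘ₗ s = LinearMap.id) (hB : Lifts C B) : Lifts C A := by
  intro i j k hij hjk f hf
  obtain ⟨g, hg⟩ := hB i j k hij hjk (f ∘ₗ r) (by
    rw [← LinearMap.comp_assoc, hf, LinearMap.zero_comp])
  exact ⟨g ∘ₗ s, by rw [← LinearMap.comp_assoc, hg, LinearMap.comp_assoc, h, LinearMap.comp_id]⟩

lemma of_equiv {A B : Type u} [AddCommGroup A] [Module R A] [AddCommGroup B] [Module R B]
    (e : A ≃ₗ[R] B) (h : Lifts C A) : Lifts C B :=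
  of_retract e.symm.toLinearMap e.toLinearMap (by ext; simp) h

lemma of_subsingleton (A : Type u) [AddCommGroup A] [Module R A] [Subsingleton A] : Lifts C A :=
  fun _ _ _ _ _ f _ => ⟨0, by ext x; rw [Subsingleton.elim x 0]; simp⟩

lemma finsupp (ι : Type u) {A : Type u} [AddCommGroup A] [Module R A] (h : Lifts C A) :
    Lifts C (ι →₀ A) := by
  intro i j k hij hjk f hf
  choose g hg using fun x : ι => h i j k hij hjk (f ∘ₗ Finsupp.lsingle x) (by
    rw [← LinearMap.comp_assoc, hf, LinearMap.zero_comp])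
  refine ⟨Finsupp.lsum R g, ?_⟩
  ext x a
  simpa using LinearMap.congr_fun (hg x) a

lemma pi {ι : Type} [Finite ι] (M : ι → Type u) [∀ i, AddCommGroup (M i)] [∀ i, Module R (M i)]
    (h : ∀ i, Lifts C (M i)) : Lifts C (∀ i, M i) := by
  classical
  have := Fintype.ofFinite ι
  intro i j k hij hjk f hf
  choose g hg using fun x : ι => h x i j k hij hjk (f ∘ₗ LinearMap.single R M x) (by
    rw [← LinearMap.comp_assoc, hf, LinearMap.zero_comp])
  refine ⟨LinearMap.lsum R M R g, ?_⟩
  refine LinearMap.pi_ext fun x a => ?_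
  have := LinearMap.congr_fun (hg x) a
  rw [LinearMap.comp_apply, LinearMap.lsum_piSingle]
  exact this

lemma of_projective (hR : Lifts C R) (A : Type u) [AddCommGroup A] [Module R A]
    [Module.Projective R A] : Lifts C A := by
  obtain ⟨s, hs⟩ := Module.projective_def'.1 (inferInstance : Module.Projective R A)
  exact of_retract s _ hs (hR.finsupp A)

lemma tensor_projective {Q : Type u} [AddCommGroup Q] [Module R Q] (hQ : Lifts C Q)
    (A : Type u) [AddCommGroup A] [Module R A] [Module.Projective R A] : Lifts C (Q ⊗[R] A) := by
  classical
  obtain ⟨s, hs⟩ := Module.projective_def'.1 (inferInstance : Module.Projective R A)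
  refine of_retract (s.lTensor Q) (LinearMap.lTensor Q (Finsupp.linearCombination R id)) ?_
    (of_equiv (TensorProduct.finsuppScalarRight R R Q A).symm (hQ.finsupp A))
  rw [← LinearMap.lTensor_comp, hs, LinearMap.lTensor_id]

end Lifts

end Lifts

section DualizingModules

open TensorProduct CategoryTheory

variable {R : Type u} [CommRing R] [IsNoetherianRing R]
  {X D T : ℤ → Type u} [∀ n, AddCommGroup (X n)] [∀ n, Module R (X n)]
  [∀ n, AddCommGroup (D n)] [∀ n, Module R (D n)] [∀ n, AddCommGroup (T n)] [∀ n, Module R (T n)]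
  [∀ n, Module.Finite R (X n)] [∀ n, Module.Injective R (D n)]
  (hT : ∀ n, ∃ (ι : Type) (_ : Finite ι) (s t : ι → ℤ),
    Nonempty (T n ≃ₗ[R] ∀ i : ι, (X (s i) →ₗ[R] D (t i))))
  (d : ∀ i j, T i →ₗ[R] T j) (a : ℤ) (b : ℕ) (ha : ∀ n < a, Subsingleton (T n))
  (hb : ∀ n > (b : ℤ), Subsingleton (T n))
  (hd : ∀ i j k, i + 1 = j → j + 1 = k → ∀ x, d j k (d i j x) = 0)
  (hex : ∀ i j k, i + 1 = j → j + 1 = k → j ≠ 0 → ∀ x, d j k x = 0 → ∃ y, d i j y = x)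
  (v : R →ₗ[R] T 0) (hv : ∀ x, d 0 1 (v x) = 0)
  (hsurj : ∀ x, d 0 1 x = 0 → ∃ r y, x = v r + d (-1) 0 y)
  (hinj : ∀ r y, v r = d (-1) 0 y → r = 0)

include hT ha hb hd hex hv hsurj hinj

/-- Over a noetherian ring with a dualizing complex, flat modules have bounded cotorsion
dimension. -/
lemma flatExtVanishesAbove_of_dualizing (K : Type u) [AddCommGroup K] [Module R K]
    (hK : Module.Flat R K) : FlatExtVanishesAbove (R := R) (b + 1) K := by
  have key := bounded_complex_chase d a b ha hb hd hex v hv hsurj hinj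
    (fun k M _ _ => FlatExtVanishesAbove (R := R) k (M ⊗[R] K)) ?_ ?_ ?_ ?_ ?_
  · exact key.of_equiv (TensorProduct.lid R K)
  · intro M _ _ hM F _ _ hF P _ _ _ π hπ f
    have : Subsingleton (M ⊗[R] K) := by
      refine ⟨fun x y => ?_⟩
      have h0 : ∀ x : M ⊗[R] K, x = 0 := fun x => by
        induction x with
        | zero => rfl
        | tmul m k => rw [Subsingleton.elim m 0, zero_tmul]
        | add x y hx hy => rw [hx, hy, add_zero]
      rw [h0 x, h0 y]
    exact ⟨0, LinearMap.ext fun _ => Subsingleton.elim _ _⟩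
  · intro k M M' _ _ _ _ e h
    exact h.of_equiv (TensorProduct.congr e (LinearEquiv.refl R K))
  · intro k M' M M'' _ _ _ _ _ _ i p hi hip hp h' h
    exact h'.of_surjective h (i := i.rTensor K) (p := p.rTensor K)
      (Module.Flat.rTensor_preserves_injective_linearMap i hi) (rTensor_exact K hip hp)
      (LinearMap.rTensor_surjective K hp)
  · intro k M' M M'' _ _ _ _ _ _ i p hi hip hp h h''
    exact h.of_injective h'' (i := i.rTensor K) (p := p.rTensor K)
      (Module.Flat.rTensor_preserves_injective_linearMap i hi) (rTensor_exact K hip hp)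
      (LinearMap.rTensor_surjective K hp)
  · intro n
    classical
    obtain ⟨ι, _, s, t, ⟨e⟩⟩ := hT n
    have := Fintype.ofFinite ι
    refine FlatExtVanishesAbove.of_equiv (FlatExtVanishesAbove.pi
      (fun i => K ⊗[R] (X (s i) →ₗ[R] D (t i))) fun i => ?_)
      ((TensorProduct.piRight R R K (fun i => X (s i) →ₗ[R] D (t i))).symm ≪≫ₗ
        TensorProduct.comm R _ _ ≪≫ₗ TensorProduct.congr e.symm (LinearEquiv.refl R K))
    have : Module.FinitePresentation R (X (s i)) := Module.finitePresentation_of_finite R _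
    have := injective_tensor_flat (R := R) (D (t i)) K
    exact (flatExtVanishesAbove_hom (X (s i)) (D (t i) ⊗[R] K)).of_equiv
      ((LinearEquiv.ofBijective _ (rTensorHomToHomRTensor_bijective (X (s i)) (D (t i)) K)).symm
        ≪≫ₗ TensorProduct.comm R _ _)

/-- An exact complex of injectives to which maps out of the single nonprojective term of `X` lift
is totally acyclic. -/
lemma Lifts.injective_of_dualizing {C : ChainComplex (ModuleCat.{u} R) ℤ}
    (hC : ∀ n, Module.Injective R (C.X n)) (hR : Lifts C R) (m : ℤ) (hQ : Lifts C (X m))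
    (hX : ∀ n ≠ m, Module.Projective R (X n)) (I : Type u) [AddCommGroup I] [Module R I]
    [Module.Injective R I] : Lifts C I := by
  have hflat : ∀ (F : Type u) [AddCommGroup F] [Module R F], Module.Flat R F → Lifts C F :=
    flat_induction (flatExtVanishesAbove_of_dualizing hT d a b ha hb hd hex v hv hsurj hinj)
      (fun F _ _ => Lifts C F) (fun F _ _ _ => of_projective hR F)
      (fun A P F _ _ _ _ _ _ i p _ hi hip hp hA hP => of_surjective hC hi hip hp hA hP)
  have hQF : ∀ (F : Type u) [AddCommGroup F] [Module R F], Module.Flat R F →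
      Lifts C (X m ⊗[R] F) :=
    flat_induction (flatExtVanishesAbove_of_dualizing hT d a b ha hb hd hex v hv hsurj hinj)
      (fun F _ _ => Lifts C (X m ⊗[R] F)) (fun F _ _ _ => tensor_projective hQ F)
      (fun A P F _ _ _ _ _ _ i p _ hi hip hp hA hP => of_surjective hC
        (i := i.lTensor (X m)) (p := p.lTensor (X m))
        (lTensor_injective_of_flat_cokernel _ hi hip hp) (lTensor_exact _ hip hp)
        (LinearMap.lTensor_surjective _ hp) hA hP)
  have key := bounded_complex_chase d a b ha hb hd hex v hv hsurj hinj
    (fun k M _ _ => Lifts C (M →ₗ[R] I)) ?_ ?_ ?_ ?_ ?_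
  · exact of_equiv (LinearMap.ringLmapEquivSelf R R I) key
  · intro M _ _ hM
    have : Subsingleton (M →ₗ[R] I) :=
      ⟨fun f g => LinearMap.ext fun x => by rw [Subsingleton.elim x 0, map_zero, map_zero]⟩
    exact of_subsingleton _
  · intro k M M' _ _ _ _ e h
    exact of_equiv (e.congrLeft I R) h
  · intro k M' M M'' _ _ _ _ _ _ i p hi hip hp h' h
    refine of_injective hC (i := LinearMap.lcomp R I p) (p := LinearMap.lcomp R I i) ?_
      (lcomp_exact _ hip hp) (fun g => exists_extension hi g) h h'
    intro f g hfg
    exact (LinearMap.cancel_right hp).1 hfg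
  · intro k M' M M'' _ _ _ _ _ _ i p hi hip hp h h''
    refine of_surjective hC (i := LinearMap.lcomp R I p) (p := LinearMap.lcomp R I i) ?_
      (lcomp_exact _ hip hp) (fun g => exists_extension hi g) h'' h
    intro f g hfg
    exact (LinearMap.cancel_right hp).1 hfg
  · intro n
    classical
    obtain ⟨ι, _, s, t, ⟨e⟩⟩ := hT n
    have := Fintype.ofFinite ι
    refine of_equiv ((LinearMap.lsum R (fun i => X (s i) →ₗ[R] D (t i)) R) ≪≫ₗ
      e.symm.congrLeft I R) (pi (fun i => (X (s i) →ₗ[R] D (t i)) →ₗ[R] I) fun i => ?_)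
    have : Module.FinitePresentation R (X (s i)) := Module.finitePresentation_of_finite R _
    have hF := flat_hom_injective (R := R) (D (t i)) I
    refine of_equiv (LinearEquiv.ofBijective _
      (tensorHomToHomHom_bijective (R := R) (X (s i)) (D (t i)) I)) ?_
    by_cases h : s i = m
    · rw [h]
      exact hQF _ hF
    · have := hX _ h
      exact hflat _ inferInstance

end DualizingModules

section Attach

open CategoryTheory CategoryTheory.Limits CochainComplex CochainComplex.HomComplex

variable {𝒜 : Type*} [Category 𝒜] [Abelian 𝒜]

/-- Attach an object in a single degree to a complex over `D`. -/
lemma CochainComplex.exists_attach {K D : CochainComplex 𝒜 ℤ} (φ : K ⟶ D) (k n : ℤ)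
    (hkn : k + 1 = n)
    (hK : IsZero (K.X k)) (L : 𝒜) (g : L ⟶ K.X n) (hg : ∀ j, g ≫ K.d n j = 0) (h : L ⟶ D.X k)
    (hgh : h ≫ D.d k n = g ≫ φ.f n) :
    ∃ (K' : CochainComplex 𝒜 ℤ) (φ' : K' ⟶ D) (r : K ⟶ K') (ι : L ⟶ K'.X k), r ≫ φ' = φ ∧
      (∀ i ≠ k, IsIso (r.f i)) ∧ IsIso ι ∧ ι ≫ K'.d k n = g ≫ r.f n ∧ ι ≫ φ'.f k = h := by
  let F := (HomologicalComplex.single 𝒜 (.up ℤ) n).obj L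
  let γ : F ⟶ K := HomologicalComplex.mkHomFromSingle g (fun j _ => hg j)
  let s : L ⟶ F.X n := (HomologicalComplex.singleObjXSelf (.up ℤ) n L).inv
  have hs : s ≫ γ.f n = g := by
    simp [s, γ, HomologicalComplex.mkHomFromSingle_f]
  have hF : ∀ i ≠ n, IsZero (F.X i) := fun i hi =>
    HomologicalComplex.isZero_single_obj_X _ _ _ _ hi
  have hFd : ∀ i j, F.d i j = 0 := fun i j => HomologicalComplex.single_obj_d _ _ _ _ _
  let α : Cochain F D (-1) :=
    Cochain.single ((HomologicalComplex.singleObjXSelf (.up ℤ) n L).hom ≫ h) (-1)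
  have hα : s ≫ α.v n k (by omega) = h := by
    simp [s, α]
  have hαδ : δ (-1) 0 α = Cochain.ofHom (γ ≫ φ) := by
    ext p
    by_cases hp : p = n
    · subst hp
      rw [← cancel_epi s, δ_v (-1) 0 (by omega) α p p (by omega) k (p + 1) (by omega) rfl, hFd]
      simp only [zero_comp, smul_zero, add_zero, Cochain.ofHom_v, HomologicalComplex.comp_f]
      rw [reassoc_of% hα, reassoc_of% hs, hgh]
    · exact (hF p hp).eq_of_src _ _
  refine ⟨mappingCone γ, mappingCone.desc γ α φ hαδ, mappingCone.inr γ,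
    s ≫ (mappingCone.inl γ).v n k (by omega), by simp, ?_, ?_, ?_, ?_⟩
  · intro i hi
    refine ⟨(mappingCone.snd γ).v i i (add_zero i), by simp, ?_⟩
    apply mappingCone.ext_from γ (i + 1) i rfl
    · exact (hF _ (by omega)).eq_of_src _ _
    · simp
  · refine ⟨(mappingCone.fst γ).1.v k n hkn ≫
      (HomologicalComplex.singleObjXSelf (.up ℤ) n L).hom, by simp [s], ?_⟩
    apply mappingCone.ext_from γ n k hkn
    · simp [s]
    · exact hK.eq_of_src _ _
  · rw [Category.assoc, mappingCone.inl_v_d γ n k (n + 1) (by omega) (by omega), hFd, zero_comp,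
      sub_zero, reassoc_of% hs]
  · simp [hα]

end Attach

section ConeExact

open CategoryTheory CategoryTheory.Limits
open scoped ZeroObject

variable {R : Type u} [CommRing R]

/-- Exactness of the mapping cone of `φ : K ⟶ D` at the term `K.X (i + 1) ⊞ D.X i`. -/
def ConeExact {K D : CochainComplex (ModuleCat.{u} R) ℤ} (φ : K ⟶ D) (i : ℤ) : Prop :=
  ∀ j l, i + 1 = j → l + 1 = i → ∀ (x : K.X j) (y : D.X i), (∀ m, (K.d j m).hom x = 0) →
    (φ.f j).hom x = (D.d i j).hom y →
    ∃ (x' : K.X i) (y' : D.X l), (K.d i j).hom x' = x ∧ (φ.f i).hom x' + (D.d l i).hom y' = y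

lemma ModuleCat.hom_congr {A B : ModuleCat.{u} R} {f g : A ⟶ B} (h : f = g) (x : A) :
    f.hom x = g.hom x := by rw [h]

lemma ModuleCat.bijective_of_isIso {A B : ModuleCat.{u} R} (f : A ⟶ B) [IsIso f] :
    Function.Bijective f.hom :=
  (asIso f).toLinearEquiv.bijective

lemma exists_attach_coneExact {K D : CochainComplex (ModuleCat.{u} R) ℤ} (φ : K ⟶ D) (k n : ℤ)
    (hkn : k + 1 = n) (hK : IsZero (K.X k)) (L : ModuleCat.{u} R) (g : L ⟶ K.X n)
    (hg : ∀ j, g ≫ K.d n j = 0) (h : L ⟶ D.X k) (hgh : h ≫ D.d k n = g ≫ φ.f n)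
    (hsurj : ∀ l, l + 1 = k → ∀ (x : K.X n) (y : D.X k), (∀ m, (K.d n m).hom x = 0) →
      (φ.f n).hom x = (D.d k n).hom y →
      ∃ (x' : L) (y' : D.X l), g.hom x' = x ∧ h.hom x' + (D.d l k).hom y' = y)
    (hφ : ∀ i ≥ n, ConeExact φ i) :
    ∃ (K' : CochainComplex (ModuleCat.{u} R) ℤ) (φ' : K' ⟶ D) (ι : L ⟶ K'.X k)
      (r : K ⟶ K'), (∀ i ≠ k, IsIso (r.f i)) ∧ IsIso ι ∧ ι ≫ K'.d k n = g ≫ r.f n ∧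
      (∀ i ≥ k, ConeExact φ' i) := by
  obtain ⟨K', φ', r, ι, hr, hri, hι, hιd, hιφ⟩ :=
    CochainComplex.exists_attach φ k n hkn hK L g hg h hgh
  refine ⟨K', φ', ι, r, hri, hι, hιd, ?_⟩
  have hrφ : ∀ i x, (φ'.f i).hom ((r.f i).hom x) = (φ.f i).hom x := fun i x => by
    rw [← hr]; rfl
  have hrd : ∀ i j x, (K'.d i j).hom ((r.f i).hom x) = (r.f j).hom ((K.d i j).hom x) :=
    fun i j x => ModuleCat.hom_congr (r.comm i j) x
  intro i hi j l hij hli x y hx hxy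
  have := hri j (by omega)
  obtain ⟨x, rfl⟩ := (ModuleCat.bijective_of_isIso (r.f j)).2 x
  have hx0 : ∀ m, (K.d j m).hom x = 0 := fun m => by
    by_cases hm : m = k
    · subst hm
      have := ModuleCat.subsingleton_of_isZero hK
      exact Subsingleton.elim _ _
    · have := hri m hm
      apply (ModuleCat.bijective_of_isIso (r.f m)).1
      rw [← hrd, hx, map_zero]
  rw [hrφ] at hxy
  by_cases hik : i = k
  · subst hik
    obtain rfl : j = n := by omega
    obtain ⟨x', y', rfl, rfl⟩ := hsurj l hli x y hx0 hxy
    exact ⟨ι.hom x', y', ModuleCat.hom_congr hιd x',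
      congrArg (· + _) (ModuleCat.hom_congr hιφ x')⟩
  · obtain ⟨x', y', rfl, rfl⟩ := hφ i (by omega) j l hij hli x y hx0 hxy
    exact ⟨(r.f i).hom x', y', hrd _ _ _, by rw [hrφ]⟩

lemma exists_fin_generators {M N : Type u} [AddCommGroup M] [Module R M] [AddCommGroup N]
    [Module R N] [IsNoetherian R N] (p : M →ₗ[R] N) (B S : Submodule R M) (hS : S.FG)
    (hp : LinearMap.ker p ≤ S ⊔ B) :
    ∃ (c : ℕ) (f : (Fin c → R) →ₗ[R] M), ∀ x, ∃ y, ∃ b ∈ B, x = f y + b := by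
  obtain ⟨S', hS', hpS⟩ : ∃ S' : Submodule R M, S'.FG ∧ S'.map p = LinearMap.range p := by
    have h := IsNoetherian.noetherian (LinearMap.range p)
    have : Module.Finite R (LinearMap.range p) := Module.Finite.iff_fg.mpr h
    obtain ⟨t, ht⟩ := h
    choose! s hs using fun x : N => fun hx : x ∈ LinearMap.range p => hx
    classical
    refine ⟨Submodule.span R (t.image s), ⟨_, rfl⟩, ?_⟩
    rw [Submodule.map_span, Finset.coe_image, ← Set.image_comp, ← ht]
    congr 1
    conv_rhs => rw [← Set.image_id (t : Set N)]
    refine Set.image_congr fun x hx => hs x ?_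
    rw [← ht]
    exact Submodule.subset_span hx
  have hfin : Module.Finite R (S' ⊔ S : Submodule R M) :=
    Module.Finite.iff_fg.mpr (hS'.sup hS)
  obtain ⟨c, f, hf⟩ := Module.Finite.exists_fin' R (S' ⊔ S : Submodule R M)
  refine ⟨c, (S' ⊔ S).subtype ∘ₗ f, fun x => ?_⟩
  have hx : p x ∈ S'.map p := hpS ▸ ⟨x, rfl⟩
  obtain ⟨s', hs', hsx⟩ := hx
  obtain ⟨s, hs, b, hb, hsb⟩ := Submodule.mem_sup.1 (hp (show x - s' ∈ LinearMap.ker p by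
    rw [LinearMap.mem_ker, map_sub, hsx, sub_self]))
  obtain ⟨y, hy⟩ := hf ⟨s' + s, Submodule.add_mem_sup hs' hs⟩
  refine ⟨y, b, hb, ?_⟩
  rw [LinearMap.comp_apply, hy, Submodule.subtype_apply, add_assoc, hsb]
  abel

lemma CochainComplex.exists_fg_ker_le (D : CochainComplex (ModuleCat.{u} R) ℤ) (i j k : ℤ)
    (hij : i + 1 = j) (hjk : j + 1 = k) (h : Module.Finite R (D.homology j)) :
    ∃ S : Submodule R (D.X j), S.FG ∧ S ≤ LinearMap.ker (D.d j k).hom ∧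
      LinearMap.ker (D.d j k).hom ≤ S ⊔ LinearMap.range (D.d i j).hom := by
  let e := (ShortComplex.homologyMapIso (D.isoSc' i j k (by simp [← hij]) (by simp [hjk])) ≪≫
    (D.sc' i j k).moduleCatHomologyIso).toLinearEquiv
  have hfin : Module.Finite R (LinearMap.ker (D.d j k).hom ⧸
      LinearMap.range (D.sc' i j k).moduleCatToCycles) :=
    have : Module.Finite R (D.sc j).homology := h
    Module.Finite.equiv e
  obtain ⟨c, f, hf⟩ := Module.Finite.exists_fin' R (LinearMap.ker (D.d j k).hom ⧸
      LinearMap.range (D.sc' i j k).moduleCatToCycles)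
  obtain ⟨g, hg⟩ := Module.projective_lifting_property
    (LinearMap.range (D.sc' i j k).moduleCatToCycles).mkQ f (Submodule.mkQ_surjective _)
  refine ⟨LinearMap.range ((LinearMap.ker (D.d j k).hom).subtype ∘ₗ g), ?_, ?_, ?_⟩
  · exact Module.Finite.iff_fg.1 inferInstance
  · rintro _ ⟨x, rfl⟩
    exact (g x).2
  · intro x hx
    obtain ⟨y, hy⟩ := hf (Submodule.Quotient.mk ⟨x, hx⟩)
    have h1 := LinearMap.congr_fun hg y
    rw [hy] at h1
    obtain ⟨z, hz⟩ := (Submodule.Quotient.eq _).1 h1.symm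
    refine Submodule.mem_sup.2 ⟨_, ⟨y, rfl⟩, _, ⟨z, rfl⟩, ?_⟩
    have h2 : (D.d i j).hom z = x - (LinearMap.ker (D.d j k).hom).subtype (g y) :=
      congrArg Subtype.val hz
    change (LinearMap.ker (D.d j k).hom).subtype (g y) + (D.d i j).hom z = x
    rw [h2]
    exact add_sub_cancel _ _


/-- A bounded complex with finitely generated cohomology over a noetherian ring admits a
finitely generated bounded resolution, projective in all degrees but one. -/
lemma exists_finite_resolution [IsNoetherianRing R] (D : CochainComplex (ModuleCat.{u} R) ℤ)
    (a b : ℤ) (hD : ∀ n, (n < a ∨ b < n) → IsZero (D.X n))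
    (hfin : ∀ n, Module.Finite R (D.homology n)) :
    ∃ (K : CochainComplex (ModuleCat.{u} R) ℤ) (φ : K ⟶ D) (m a' b' : ℤ),
      (∀ i, Module.Finite R (K.X i)) ∧ (∀ i ≠ m, Module.Projective R (K.X i)) ∧
      (∀ i, (i < a' ∨ b' < i) → IsZero (K.X i)) ∧ ∀ i, ConeExact φ i := by
  have key : ∀ t : ℕ, ∃ (K : CochainComplex (ModuleCat.{u} R) ℤ) (φ : K ⟶ D),
      (∀ i, Module.Finite R (K.X i)) ∧ (∀ i, Module.Projective R (K.X i)) ∧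
      (∀ i, (i < b + 1 - t ∨ b < i) → IsZero (K.X i)) ∧ ∀ i ≥ b + 1 - t, ConeExact φ i := by
    intro t
    induction t with
    | zero =>
      have h0 : ∀ i, IsZero ((0 : CochainComplex (ModuleCat.{u} R) ℤ).X i) := fun i =>
        (HomologicalComplex.eval _ _ i).map_isZero (isZero_zero _)
      refine ⟨0, 0, fun i => ?_, fun i => ?_, fun i _ => h0 i,
        fun i hi j l hij hli x y hx hxy => ?_⟩
      · have := ModuleCat.subsingleton_of_isZero (h0 i)
        infer_instance
      · have := ModuleCat.subsingleton_of_isZero (h0 i)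
        infer_instance
      · have := ModuleCat.subsingleton_of_isZero (h0 j)
        have := ModuleCat.subsingleton_of_isZero (hD i (by simp at hi; omega))
        exact ⟨0, 0, Subsingleton.elim _ _, Subsingleton.elim _ _⟩
    | succ t ih =>
      obtain ⟨K, φ, hKf, hKp, hK0, hφ⟩ := ih
      obtain ⟨n, hn⟩ : ∃ n : ℤ, n = b + 1 - t := ⟨_, rfl⟩
      obtain ⟨k, hk⟩ : ∃ k, k + 1 = n := ⟨n - 1, by omega⟩
      obtain ⟨l, hl⟩ : ∃ l, l + 1 = k := ⟨k - 1, by omega⟩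
      have hKk := hK0 k (by omega)
      let M : Submodule R (K.X n × D.X k) :=
        LinearMap.ker ((K.d n (n + 1)).hom ∘ₗ LinearMap.fst R _ _) ⊓
        LinearMap.ker ((φ.f n).hom ∘ₗ LinearMap.fst R _ _ - (D.d k n).hom ∘ₗ LinearMap.snd R _ _)
      let B : Submodule R M := (LinearMap.range
        (LinearMap.inr R (K.X n) (D.X k) ∘ₗ (D.d l k).hom)).comap M.subtype
      obtain ⟨S, hS, hSk, hSB⟩ := D.exists_fg_ker_le l k n hl hk (hfin k)
      let inc : LinearMap.ker (D.d k n).hom →ₗ[R] M :=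
        (LinearMap.inr R (K.X n) (D.X k) ∘ₗ (LinearMap.ker (D.d k n).hom).subtype).codRestrict M
        (fun x => by
          refine ⟨?_, ?_⟩
          · simp
          · have : (D.d k n).hom x.1 = 0 := x.2
            simp [this])
      have hKfn := hKf n
      have hS2 : (S.comap (LinearMap.ker (D.d k n).hom).subtype).FG := by
        refine Submodule.fg_of_fg_map_injective _ (Submodule.subtype_injective _) ?_
        rwa [Submodule.map_comap_subtype, inf_eq_right.2 hSk]
      obtain ⟨c, f, hf⟩ := exists_fin_generators (R := R) (LinearMap.fst R _ _ ∘ₗ M.subtype) B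
        ((S.comap (LinearMap.ker (D.d k n).hom).subtype).map inc) (hS2.map _) (by
          rintro ⟨⟨x, y⟩, hx, hy⟩ h
          obtain rfl : x = 0 := h
          have hy0 : (D.d k n).hom y = 0 := by simpa using hy
          obtain ⟨s, hs, _, ⟨z, rfl⟩, hsz⟩ := Submodule.mem_sup.1 (hSB hy0)
          have hz : (D.d k n).hom ((D.d l k).hom z) = 0 := by
            rw [← LinearMap.comp_apply, ← ModuleCat.hom_comp, D.d_comp_d]; rfl
          refine Submodule.mem_sup.2 ⟨_, ⟨⟨s, hSk hs⟩, hs, rfl⟩, inc ⟨_, hz⟩, ⟨z, rfl⟩, ?_⟩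
          rw [← map_add]
          apply Subtype.ext
          exact congrArg (Prod.mk 0) hsz)
      have hf1 : ∀ x, (K.d n (n + 1)).hom (f x).1.1 = 0 := fun x => (f x).2.1
      have hf2 : ∀ x, (φ.f n).hom (f x).1.1 = (D.d k n).hom (f x).1.2 := fun x =>
        sub_eq_zero.1 (f x).2.2
      obtain ⟨K', φ', ι, r, hr, hι, -, hφ'⟩ := exists_attach_coneExact φ k n hk hKk
        (ModuleCat.of R (ULift.{u} (Fin c → R)))
        (ModuleCat.ofHom (LinearMap.fst R _ _ ∘ₗ M.subtype ∘ₗ f ∘ₗ ULift.moduleEquiv.toLinearMap))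
        (fun j => by
          by_cases hj : n + 1 = j
          · subst hj
            ext x
            exact hf1 _
          · rw [K.shape n j (by simpa using hj), comp_zero])
        (ModuleCat.ofHom (LinearMap.snd R _ _ ∘ₗ M.subtype ∘ₗ f ∘ₗ ULift.moduleEquiv.toLinearMap))
        (by
          ext x
          exact (hf2 _).symm)
        (by
          intro l' hl' x y hx hxy
          obtain rfl : l' = l := by omega
          obtain ⟨z, bb, ⟨w, hw⟩, hz⟩ := hf ⟨(x, y), hx _, sub_eq_zero.2 hxy⟩
          have hz' : (x, y) = (f z).1 + (0, (D.d l' k).hom w) := by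
            rw [show ((0 : K.X n), (D.d l' k).hom w) = bb.1 from hw]
            exact congrArg Subtype.val hz
          refine ⟨⟨z⟩, w, ?_, ?_⟩
          · have := congrArg Prod.fst hz'
            simpa using this.symm
          · exact (congrArg Prod.snd hz').symm)
        (fun i hi => hφ i (by omega))
      have e : ∀ i ≠ k, Nonempty (K.X i ≅ K'.X i) := fun i hi => by
        have := hr i hi
        exact ⟨asIso (r.f i)⟩
      refine ⟨K', φ', fun i => ?_, fun i => ?_, fun i hi => ?_, fun i hi => hφ' i (by
        push_cast at hi; omega)⟩
      · by_cases hi : i = k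
        · subst hi
          exact Module.Finite.equiv (asIso ι).toLinearEquiv
        · obtain ⟨e⟩ := e i hi
          have := hKf i
          exact Module.Finite.equiv e.toLinearEquiv
      · by_cases hi : i = k
        · subst hi
          exact Module.Projective.of_equiv (asIso ι).toLinearEquiv
        · obtain ⟨e⟩ := e i hi
          have := hKp i
          exact Module.Projective.of_equiv e.toLinearEquiv
      · obtain ⟨e⟩ := e i (by push_cast at hi; omega)
        exact (hK0 i (by push_cast at hi; omega)).of_iso e.symm
  obtain ⟨K, φ, hKf, hKp, hK0, hφ⟩ := key (b + 2 - a).toNat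
  obtain ⟨n, hn⟩ : ∃ n : ℤ, n = b + 1 - (b + 2 - a).toNat := ⟨_, rfl⟩
  rw [← hn] at hK0 hφ
  obtain ⟨k, hk⟩ : ∃ k, k + 1 = n := ⟨n - 1, by omega⟩
  have hD0 : ∀ i ≤ n, Subsingleton (D.X i) := fun i hi =>
    ModuleCat.subsingleton_of_isZero (hD i (by omega))
  have hKn := hKf n
  obtain ⟨K', φ', ι, r, hr, hι, hιd, hφ'⟩ := exists_attach_coneExact φ k n hk (hK0 k (by omega))
    (ModuleCat.of R (LinearMap.ker (K.d n (n + 1)).hom))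
    (ModuleCat.ofHom (Submodule.subtype _)) (fun j => by
          by_cases hj : n + 1 = j
          · subst hj
            ext x
            exact x.2
          · rw [K.shape n j (by simpa using hj), comp_zero]) 0 (by
        ext x
        have := hD0 n le_rfl
        exact Subsingleton.elim _ _) (by
        intro l hl x y hx hxy
        have := hD0 k (by omega)
        exact ⟨⟨x, hx _⟩, 0, rfl, Subsingleton.elim _ _⟩) hφ
  have e : ∀ i ≠ k, Nonempty (K.X i ≅ K'.X i) := fun i hi => by
    have := hr i hi
    exact ⟨asIso (r.f i)⟩
  have hK'0 : ∀ i, (i < k ∨ max b k < i) → IsZero (K'.X i) := fun i hi => by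
    obtain ⟨e⟩ := e i (by omega)
    exact (hK0 i (by omega)).of_iso e.symm
  refine ⟨K', φ', k, k, max b k, fun i => ?_, fun i hi => ?_, hK'0, fun i => ?_⟩
  · by_cases hi : i = k
    · subst hi
      exact Module.Finite.equiv (asIso ι).toLinearEquiv
    · obtain ⟨e⟩ := e i hi
      have := hKf i
      exact Module.Finite.equiv e.toLinearEquiv
  · obtain ⟨e⟩ := e i hi
    have := hKp i
    exact Module.Projective.of_equiv e.toLinearEquiv
  · by_cases hi : k ≤ i
    · exact hφ' i hi
    intro j l hij hli x y hx hxy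
    have := hD0 i (by omega)
    refine ⟨0, 0, ?_, Subsingleton.elim _ _⟩
    rw [map_zero]
    by_cases hj : j = k
    · subst hj
      obtain ⟨x, rfl⟩ := (ModuleCat.bijective_of_isIso ι).2 x
      have h1 := ModuleCat.hom_congr hιd x
      have h2 := (h1.symm.trans (hx n))
      have := hr n (by omega)
      have h3 : x.1 = 0 := (ModuleCat.bijective_of_isIso (r.f n)).1 (by
        rw [map_zero]; exact h2)
      obtain rfl : x = 0 := Subtype.ext h3
      simp
    · have := ModuleCat.subsingleton_of_isZero (hK'0 j (by omega))
      exact Subsingleton.elim _ _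

end ConeExact

section MappingCone

open CategoryTheory CategoryTheory.Limits CochainComplex.HomComplex CochainComplex

variable {R : Type u} [CommRing R] {K D : CochainComplex (ModuleCat.{u} R) ℤ}

lemma mappingCone_acyclic_of_coneExact {φ : K ⟶ D} (h : ∀ i, ConeExact φ i) :
    (mappingCone φ).Acyclic := by
  intro i
  rw [HomologicalComplex.exactAt_iff' _ (i - 1) i (i + 1) (by simp) (by simp),
    ShortComplex.moduleCat_exact_iff]
  intro z hz
  change ((mappingCone φ).d i (i + 1)).hom z = 0 at hz
  have hid := ModuleCat.hom_congr (mappingCone.id_X φ i (i + 1) rfl) z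
  have h1 : ∀ m, (K.d (i + 1) m).hom (((mappingCone.fst φ).1.v i (i + 1) rfl).hom z) = 0 := by
    intro m
    by_cases hm : i + 1 + 1 = m
    · subst hm
      have := ModuleCat.hom_congr (mappingCone.d_fst_v φ i (i + 1) (i + 1 + 1) rfl rfl) z
      have h2 : -(K.d (i + 1) (i + 1 + 1)).hom
          (((mappingCone.fst φ).1.v i (i + 1) rfl).hom z) = 0 := by
        rw [← map_zero ((mappingCone.fst φ).1.v (i + 1) (i + 1 + 1) rfl).hom, ← hz]
        exact this.symm
      exact neg_eq_zero.1 h2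
    · rw [K.shape _ _ (by simpa using hm)]; rfl
  have h2 : (φ.f (i + 1)).hom (((mappingCone.fst φ).1.v i (i + 1) rfl).hom z) =
      (D.d i (i + 1)).hom (-((mappingCone.snd φ).v i i (add_zero i)).hom z) := by
    have := ModuleCat.hom_congr (mappingCone.d_snd_v φ i (i + 1) rfl) z
    have h3 : (φ.f (i + 1)).hom (((mappingCone.fst φ).1.v i (i + 1) rfl).hom z) +
      (D.d i (i + 1)).hom (((mappingCone.snd φ).v i i (add_zero i)).hom z) = 0 := by
        rw [← map_zero ((mappingCone.snd φ).v (i + 1) (i + 1) (add_zero _)).hom, ← hz]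
        exact this.symm
    rw [map_neg, eq_neg_iff_add_eq_zero, h3]
  obtain ⟨x', y', hx', hy'⟩ := h i (i + 1) (i - 1) rfl (by omega) _ _ h1 h2
  refine ⟨((mappingCone.inl φ).v i (i - 1) (by omega)).hom (-x') +
    ((mappingCone.inr φ).f (i - 1)).hom (-y'), ?_⟩
  change ((mappingCone φ).d (i - 1) i).hom _ = _
  have e1 := ModuleCat.hom_congr (mappingCone.inl_v_d φ i (i - 1) (i + 1) (by omega)
    (by omega)) (-x')
  have e2 := ModuleCat.hom_congr ((mappingCone.inr φ).comm (i - 1) i) (-y')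
  rw [map_add]
  refine (congrArg₂ (· + ·) e1 e2).trans ?_
  refine Eq.trans ?_ hid
  change ((mappingCone.inr φ).f i).hom ((φ.f i).hom (-x')) -
    ((mappingCone.inl φ).v (i + 1) i (by omega)).hom ((K.d i (i + 1)).hom (-x')) +
    ((mappingCone.inr φ).f i).hom ((D.d (i - 1) i).hom (-y')) =
    ((mappingCone.inl φ).v (i + 1) i (by omega)).hom (((mappingCone.fst φ).1.v i (i + 1) rfl).hom z)
    + ((mappingCone.inr φ).f i).hom (((mappingCone.snd φ).v i i (add_zero i)).hom z)
  rw [← hx', eq_neg_iff_add_eq_zero.1 hy' |> fun h => (eq_neg_of_add_eq_zero_right h)]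
  simp only [map_neg, map_add]
  abel

noncomputable def mappingConeXEquiv (φ : K ⟶ D) (i j : ℤ) (hij : i + 1 = j) :
    (mappingCone φ).X i ≃ₗ[R] (K.X j × D.X i) :=
  LinearEquiv.ofLinearMap
    (((mappingCone.fst φ).1.v i j hij).hom.prod ((mappingCone.snd φ).v i i (add_zero i)).hom)
    (((mappingCone.inl φ).v j i (by omega)).hom.coprod ((mappingCone.inr φ).f i).hom)
    (by
      have e1 := ModuleCat.hom_congr (mappingCone.inl_v_fst_v φ j i (by omega))
      have e2 := ModuleCat.hom_congr (mappingCone.inl_v_snd_v φ j i (by omega))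
      have e3 := ModuleCat.hom_congr (mappingCone.inr_f_fst_v φ i j hij)
      have e4 := ModuleCat.hom_congr (mappingCone.inr_f_snd_v φ i)
      refine LinearMap.ext fun p => Prod.ext ?_ ?_
      · exact (map_add _ _ _).trans ((congrArg₂ (· + ·) (e1 p.1) (e3 p.2)).trans (add_zero _))
      · exact (map_add _ _ _).trans ((congrArg₂ (· + ·) (e2 p.1) (e4 p.2)).trans (zero_add _)))
    (LinearMap.ext fun z => ModuleCat.hom_congr (mappingCone.id_X φ i j hij) z)

lemma Lifts.of_coneExact {C : ChainComplex (ModuleCat.{u} R) ℤ}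
    (hC : ∀ n, Module.Injective R (C.X n)) (hR : Lifts C R) (hD : ∀ n, Lifts C (D.X n))
    (φ : K ⟶ D) (m a b : ℤ) (hK : ∀ i ≠ m, Module.Projective R (K.X i))
    (hK0 : ∀ i, (i < a ∨ b < i) → IsZero (K.X i)) (hD0 : ∀ i, (i < a ∨ b < i) → IsZero (D.X i))
    (h : ∀ i, ConeExact φ i) : Lifts C (K.X m) := by
  have hac := mappingCone_acyclic_of_coneExact h
  have key : Lifts C ((mappingCone φ).X (m - 1)) := by
    have hz : ∀ n, n < a - 1 ∨ b < n → Subsingleton ((mappingCone φ).X n) := fun n hn => by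
      have := ModuleCat.subsingleton_of_isZero (hK0 (n + 1) (by omega))
      have := ModuleCat.subsingleton_of_isZero (hD0 n (by omega))
      exact (mappingConeXEquiv φ n (n + 1) rfl).toEquiv.subsingleton
    refine bounded_exact_chase (E := fun n => (mappingCone φ).X n)
      (fun i j => ((mappingCone φ).d i j).hom) (a - 1) b (m - 1)
      (fun n hn => hz n (Or.inl hn)) (fun n hn => hz n (Or.inr hn)) ?_ ?_
      (fun M _ _ => Lifts C M) ?_ ?_ ?_ ?_ ?_
    · intro i j k _ _ x
      exact ModuleCat.hom_congr ((mappingCone φ).d_comp_d i j k) x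
    · intro i j k hij hjk x hx
      have := hac j
      rw [HomologicalComplex.exactAt_iff' _ i j k (by simp; omega) (by simp; omega),
        ShortComplex.moduleCat_exact_iff] at this
      exact this x hx
    · intro M _ _ hM
      exact of_subsingleton M
    · intro M' M M'' _ _ _ _ _ _ i p hi hip hp h' h
      exact of_surjective hC hi hip hp h' h
    · intro M' M M'' _ _ _ _ _ _ i p hi hip hp h h''
      exact of_injective hC hi hip hp h h''
    · intro M' M M'' _ _ _ _ _ _ i p hi hip hp h' h''
      exact extension hC hi hip hp h' h''
    · intro n hn
      have := hK (n + 1) (by omega)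
      refine of_equiv (mappingConeXEquiv φ n (n + 1) rfl).symm ?_
      exact extension hC (i := LinearMap.inl R (K.X (n + 1)) (D.X n))
        (p := LinearMap.snd R (K.X (n + 1)) (D.X n)) LinearMap.inl_injective
        Function.Exact.inl_snd LinearMap.snd_surjective (of_projective hR _) (hD n)
  exact of_retract (LinearMap.inl R (K.X m) (D.X (m - 1))) (LinearMap.fst R _ _)
    (LinearMap.ext fun x => rfl) (of_equiv (mappingConeXEquiv φ (m - 1) m (by omega)) key)

end MappingCone

section HomComplex

open CategoryTheory CategoryTheory.Limits CochainComplex.HomComplex CochainComplex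

variable {R : Type u} [CommRing R] {K D : CochainComplex (ModuleCat.{u} R) ℤ}

/-- If the cone of `φ : K ⟶ D` is acyclic, then every cocycle `K ⟶ D` of degree `n` is, up to
a coboundary, the composite of `φ` with a cocycle `D ⟶ D`. -/
lemma exists_cocycle_comp_of_cone_acyclic [D.IsKInjective] (φ : K ⟶ D)
    (h : (mappingCone φ).Acyclic) {m n n' : ℤ} (hm : m + 1 = n) (hn' : n + 1 = n')
    (z : Cochain K D n) (hz : δ n n' z = 0) :
    ∃ (β : Cochain D D n) (α : Cochain K D m), δ n n' β = 0 ∧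
      z = (Cochain.ofHom φ).comp β (zero_add n) + δ m n α := by
  have hw : δ n' (n' + 1) (mappingCone.descCochain φ z (0 : Cochain D D n') hn') = 0 := by
    rw [mappingCone.δ_descCochain φ _ _ _ _ rfl, hz]
    simp
  obtain ⟨γ, hγ⟩ := IsKInjective.eq_δ_of_cocycle (Cocycle.mk _ (n' + 1) rfl hw) h n hn'
  change δ n n' γ = mappingCone.descCochain φ z 0 hn' at hγ
  obtain ⟨α, β, rfl⟩ : ∃ (α : Cochain K D m) (β : Cochain D D n),
      γ = mappingCone.descCochain φ α β hm := by
    refine ⟨(mappingCone.inl φ).comp γ (by omega), (Cochain.ofHom (mappingCone.inr φ)).comp γ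
      (zero_add n), ?_⟩
    rw [mappingCone.ext_cochain_from_iff φ m n hm]
    simp
  rw [mappingCone.δ_descCochain φ _ _ _ _ hn'] at hγ
  have h1 := congrArg (fun c => (mappingCone.inl φ).comp c (show -1 + n' = n by omega)) hγ
  have h2 := congrArg (fun c => (Cochain.ofHom (mappingCone.inr φ)).comp c (zero_add n')) hγ
  simp only [mappingCone.inl_descCochain, mappingCone.inr_descCochain] at h1 h2
  have h2' : δ n n' β = 0 := by simpa using h2
  have h1' : δ m n α + n'.negOnePow • (Cochain.ofHom φ).comp β (zero_add n) = z := by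
    simpa using h1
  refine ⟨n'.negOnePow • β, α, by rw [δ_units_smul, h2', smul_zero], ?_⟩
  rw [← h1', add_comm, Cochain.comp_units_smul]

lemma exists_eq_δ_of_homotopy {n m n' : ℤ} (hm : m + 1 = n) (hn' : n + 1 = n')
    (h : ∀ f : K ⟶ D⟦n⟧, Nonempty (Homotopy f 0)) (β : Cochain K D n) (hβ : δ n n' β = 0) :
    ∃ w : Cochain K D m, δ m n w = β := by
  let z := Cocycle.mk β n' hn' hβ
  have hz : z ∈ coboundaries K D n := by
    rw [← CohomologyClass.toHom_mk_eq_zero_iff, CohomologyClass.toHom_mk,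
      HomotopyCategory.quotient_map_eq_zero_iff]
    exact h _
  exact (mem_coboundaries_iff z m hm).1 hz

section Dualizing

variable [D.IsKInjective] (φ : K ⟶ D) (h : (mappingCone φ).Acyclic)

include h

lemma exists_eq_δ_of_cone_acyclic {m n n' : ℤ} (hm : m + 1 = n) (hn' : n + 1 = n')
    (hD : ∀ f : D ⟶ D⟦n⟧, Nonempty (Homotopy f 0))
    (z : Cochain K D n) (hz : δ n n' z = 0) : ∃ y : Cochain K D m, δ m n y = z := by
  obtain ⟨β, α, hβ, rfl⟩ := exists_cocycle_comp_of_cone_acyclic φ h hm hn' z hz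
  obtain ⟨w, rfl⟩ := exists_eq_δ_of_homotopy hm hn' hD β hβ
  exact ⟨(Cochain.ofHom φ).comp w (zero_add m) + α, by rw [δ_add, δ_ofHom_comp]⟩

lemma exists_eq_smul_add_δ_of_cone_acyclic
    (hD : ∀ f : D ⟶ D, ∃ r : R, Nonempty (Homotopy f (r • 𝟙 D)))
    (z : Cochain K D 0) (hz : δ 0 1 z = 0) :
    ∃ (r : R) (y : Cochain K D (-1)), z = r • Cochain.ofHom φ + δ (-1) 0 y := by
  obtain ⟨β, α, hβ, rfl⟩ := exists_cocycle_comp_of_cone_acyclic φ h (neg_add_cancel 1)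
    (zero_add 1) z hz
  obtain ⟨f, rfl⟩ : ∃ f : D ⟶ D, β = Cochain.ofHom f :=
    ⟨Cocycle.homOf (Cocycle.mk β 1 (zero_add 1) hβ), by simp⟩
  obtain ⟨r, ⟨H⟩⟩ := hD f
  obtain ⟨w, hw⟩ := Cochain.equivHomotopy _ _ H
  refine ⟨r, (Cochain.ofHom φ).comp w (zero_add _) + α, ?_⟩
  rw [δ_add, δ_ofHom_comp, hw, Cochain.comp_add, ← Cochain.ofHom_comp]
  have : Cochain.ofHom (φ ≫ (r • 𝟙 D)) = r • Cochain.ofHom φ := by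
    ext p
    simp
  rw [this]
  abel

lemma eq_zero_of_smul_eq_δ (hD : ∀ r : R, Nonempty (Homotopy (r • 𝟙 D) 0) → r = 0)
    (r : R) (y : Cochain K D (-1)) (hr : r • Cochain.ofHom φ = δ (-1) 0 y) : r = 0 := by
  have hcoc : δ 0 1 (mappingCone.descCochain φ y (Cochain.ofHom (r • 𝟙 D))
      (neg_add_cancel 1)) = 0 := by
    rw [mappingCone.δ_descCochain φ _ _ _ _ (zero_add 1), ← hr, ← Cochain.ofHom_comp, δ_ofHom]
    have : Cochain.ofHom (φ ≫ (r • 𝟙 D)) = r • Cochain.ofHom φ := by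
      ext p
      simp
    rw [this]
    simp
  obtain ⟨γ, hγ⟩ := IsKInjective.eq_δ_of_cocycle (Cocycle.mk _ 1 (zero_add 1) hcoc) h (-1)
    (neg_add_cancel 1)
  change δ (-1) 0 γ = mappingCone.descCochain φ y _ (neg_add_cancel 1) at hγ
  have h2 := congrArg (fun c => (Cochain.ofHom (mappingCone.inr φ)).comp c (zero_add 0)) hγ
  simp only [mappingCone.inr_descCochain, ← δ_ofHom_comp] at h2
  exact hD r ⟨(Cochain.equivHomotopy _ _).symm ⟨_, by rw [← h2, Cochain.ofHom_zero, add_zero]⟩⟩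

end Dualizing

/-- Cochains of degree `n` between bounded complexes of modules form a finite product of
modules of linear maps. -/
lemma cochain_equiv_pi (a b n : ℤ) (hK : ∀ i, (i < a ∨ b < i) → IsZero (K.X i)) :
    ∃ (ι : Type) (_ : Finite ι) (s t : ι → ℤ),
      Nonempty (Cochain K D n ≃ₗ[R] ∀ i : ι, (K.X (s i) →ₗ[R] D.X (t i))) := by
  classical
  refine ⟨Set.Icc a b, inferInstance, fun i => i.1, fun i => i.1 + n, ⟨?_⟩⟩
  have hz : ∀ p, p ∉ Set.Icc a b → IsZero (K.X p) := fun p hp => hK p (by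
    by_contra! h
    exact hp ⟨h.1, h.2⟩)
  let f : Cochain K D n →ₗ[R] ∀ i : Set.Icc a b, (K.X i.1 →ₗ[R] D.X (i.1 + n)) :=
    { toFun := fun z i => (z.v i.1 (i.1 + n) rfl).hom
      map_add' := fun x y => rfl
      map_smul' := fun r x => rfl }
  refine LinearEquiv.ofBijective f ⟨fun x y hxy => ?_, fun g => ?_⟩
  · ext p q hpq : 1
    subst hpq
    by_cases hp : p ∈ Set.Icc a b
    · exact ModuleCat.hom_ext (congrFun hxy ⟨p, hp⟩)
    · exact (hz p hp).eq_of_src _ _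
  · let z : Cochain K D n := Cochain.mk fun p q hpq => if hp : p ∈ Set.Icc a b then
      ModuleCat.ofHom (g ⟨p, hp⟩) ≫ eqToHom (by rw [hpq]) else 0
    refine ⟨z, funext fun i => ?_⟩
    have : z.v i.1 (i.1 + n) rfl = ModuleCat.ofHom (g i) := by
      rw [Cochain.mk_v, dif_pos i.2]
      simp
    exact congrArg ModuleCat.Hom.hom this

lemma subsingleton_cochain (a b n : ℤ) (hK : ∀ i, (i < a ∨ b < i) → IsZero (K.X i))
    (hD : ∀ i, (i < a ∨ b < i) → IsZero (D.X i)) (hn : n < a - b ∨ b - a < n) :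
    Subsingleton (Cochain K D n) := by
  refine ⟨fun x y => ?_⟩
  ext p q hpq : 1
  by_cases hp : p < a ∨ b < p
  · exact (hK p hp).eq_of_src _ _
  · exact (hD q (by omega)).eq_of_tgt _ _

/-- Over a noetherian ring with a dualizing complex, total acyclicity of complexes of injective
modules can be tested on `R` and a single finitely generated module. -/
theorem exists_testModule [IsNoetherianRing R] (D : CochainComplex (ModuleCat.{u} R) ℤ)
    (h1 : ∀ n, Injective (D.X n)) (h2 : ∃ a b : ℤ, ∀ n, (n < a ∨ b < n) → IsZero (D.X n))
    (h3 : ∀ n, Module.Finite R (D.homology n))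
    (h4 : ∀ f : D ⟶ D, ∃! r : R, Nonempty (Homotopy f (r • 𝟙 D)))
    (h5 : ∀ n : ℤ, n ≠ 0 → ∀ f : D ⟶ D⟦n⟧, Nonempty (Homotopy f 0)) :
    ∃ Q : ModuleCat.{u} R, Module.Finite R Q ∧ ∀ C : ChainComplex (ModuleCat.{u} R) ℤ,
      (∀ n, Module.Injective R (C.X n)) → Lifts C R →
      (Lifts C Q ↔ ∀ (I : Type u) [AddCommGroup I] [Module R I], Module.Injective R I →
        Lifts C I) := by
  obtain ⟨a, b, hD0⟩ := h2
  obtain ⟨K, φ, m, a', b', hfin, hproj, hK0, hcone⟩ := exists_finite_resolution D a b hD0 h3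
  have hDinj : ∀ n, Module.Injective R (D.X n) := fun n =>
    Module.injective_module_of_injective_object R (D.X n)
  refine ⟨K.X m, hfin m, fun C hC hR => ⟨fun hQ I _ _ hI => ?_, fun hI => ?_⟩⟩
  · have hac := mappingCone_acyclic_of_coneExact hcone
    have : D.IsStrictlyGE a := by
      rw [isStrictlyGE_iff]
      exact fun i hi => hD0 i (Or.inl hi)
    have : D.IsKInjective := isKInjective_of_injective D a
    have hK0' : ∀ i, (i < min a a' ∨ max b b' < i) → IsZero (K.X i) :=
      fun i hi => hK0 i (by omega)
    have hD0' : ∀ i, (i < min a a' ∨ max b b' < i) → IsZero (D.X i) :=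
      fun i hi => hD0 i (by omega)
    refine Lifts.injective_of_dualizing (X := fun n => K.X n) (D := fun n => D.X n)
      (T := fun n => Cochain K D n)
      (fun n => cochain_equiv_pi _ _ n hK0') (fun i j => δ_hom R K D i j)
      (min a a' - max b b') (max b b' - min a a').toNat
      (fun n hn => subsingleton_cochain _ _ n hK0' hD0' (Or.inl hn))
      (fun n hn => subsingleton_cochain _ _ n hK0' hD0' (Or.inr (by omega)))
      (fun i j k _ _ x => δ_δ i j k x)
      (fun i j k hij hjk hj x hx => exists_eq_δ_of_cone_acyclic φ hac hij hjk (h5 j hj) x hx)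
      (LinearMap.toSpanSingleton R _ (Cochain.ofHom φ))
      (fun r => ?_)
      (fun x hx => exists_eq_smul_add_δ_of_cone_acyclic φ hac (fun f => (h4 f).exists) x hx)
      (fun r y hr => eq_zero_of_smul_eq_δ φ hac (fun r hr => ?_) r y hr) hC hR m hQ hproj I
    · change δ 0 1 (r • Cochain.ofHom φ) = 0
      rw [δ_smul, δ_ofHom, smul_zero]
    · refine (h4 0).unique (hr.map fun H => H.symm) ⟨Homotopy.ofEq (by simp)⟩
  · exact Lifts.of_coneExact hC hR (fun n => hI _ (hDinj n)) φ m (min a a') (max b b') hproj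
      (fun i hi => hK0 i (by omega)) (fun i hi => hD0 i (by omega)) hcone

end HomComplex

namespace CategoryTheory

open CategoryTheory.Limits
open scoped ZeroObject

variable {𝒜 : Type v} [Category.{u} 𝒜] [Abelian 𝒜]

/-- A class of objects of an abelian category which contains the zero objects and is closed under
filtered colimits, extensions, and cokernels of monomorphisms. -/
structure ObjectProperty.IsFilteredCoresolving (P : ObjectProperty 𝒜) : Prop where
  of_isZero : ∀ Z : 𝒜, IsZero Z → P Z
  of_isColimit : ∀ {J : Type u} [SmallCategory J] [IsFiltered J] {K : J ⥤ 𝒜} {c : Cocone K},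
    IsColimit c → (∀ j, P (K.obj j)) → P c.pt
  of_extension : ∀ {S : ShortComplex 𝒜}, S.ShortExact → P S.X₁ → P S.X₃ → P S.X₂
  of_cokernel : ∀ {S : ShortComplex 𝒜}, S.ShortExact → P S.X₁ → P S.X₂ → P S.X₃

lemma shortExact_cokernel {X Y : 𝒜} (f : X ⟶ Y) [Mono f] :
    (ShortComplex.mk f (cokernel.π f) (cokernel.condition f)).ShortExact where
  exact := ShortComplex.exact_of_g_is_cokernel _ (cokernelIsCokernel f)

namespace ObjectProperty.IsFilteredCoresolving

variable {P : ObjectProperty 𝒜} (hP : P.IsFilteredCoresolving)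
include hP

lemma of_iso {X Y : 𝒜} (e : X ≅ Y) (h : P X) : P Y := by
  refine hP.of_extension (S := ShortComplex.mk e.hom (cokernel.π e.hom) (by simp))
    (shortExact_cokernel e.hom) h (hP.of_isZero _ ?_)
  exact isZero_cokernel_of_epi _


lemma of_cokernel_mono {X Y : 𝒜} (f : X ⟶ Y) [Mono f] (hX : P X) (hc : P (cokernel f)) : P Y :=
  hP.of_extension (shortExact_cokernel f) hX hc

lemma biprod {X Y : 𝒜} (hX : P X) (hY : P Y) : P (X ⊞ Y) :=
  hP.of_extension (ShortComplex.Splitting.ofHasBinaryBiproduct X Y).shortExact hX hY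

variable [IsGrothendieckAbelian.{u} 𝒜]

lemma sigma_finite {α : Type u} [Finite α] (f : α → 𝒜) (h : ∀ a, P (f a)) : P (∐ f) := by
  refine Finite.induction_empty_option
    (P := fun α : Type u => ∀ f : α → 𝒜, (∀ a, P (f a)) → P (∐ f)) ?_ ?_ ?_ α f h
  · intro α β e ih f h
    exact hP.of_iso (Sigma.whiskerEquiv (f := f ∘ e) e (fun _ => Iso.refl _))
      (ih (f ∘ e) (fun a => h _))
  · intro f h
    refine hP.of_isZero _ ?_
    rw [IsZero.iff_id_eq_zero]
    ext b
    exact b.elim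
  · intro α _ ih f h
    refine hP.of_iso (X := f none ⊞ ∐ (fun a : α => f (some a))) ?_
      (hP.biprod (h _) (ih _ fun a => h _))
    refine ⟨biprod.desc (Sigma.ι f none) (Limits.Sigma.desc fun a => Sigma.ι f (some a)),
      Limits.Sigma.desc (fun b => match b with
        | none => biprod.inl
        | some a => Sigma.ι (fun a : α => f (some a)) a ≫ biprod.inr), ?_, ?_⟩
    · ext <;> simp
    · ext b
      cases b <;> simp

lemma sigma {α : Type u} (F : Discrete α ⥤ 𝒜) {c : Cocone F} (hc : IsColimit c)
    (h : ∀ a, P (F.obj a)) : P c.pt := by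
  refine hP.of_iso ((CoproductsFromFiniteFiltered.liftToFinsetColimitCocone
    F).isColimit.coconePointUniqueUpToIso hc) ?_
  have : P (colimit (CoproductsFromFiniteFiltered.liftToFinsetObj F)) :=
    hP.of_isColimit (colimit.isColimit (CoproductsFromFiniteFiltered.liftToFinsetObj F))
      (fun s => hP.sigma_finite _ fun a => h _)
  exact this

end ObjectProperty.IsFilteredCoresolving

/-- The monomorphisms whose cokernel belongs to `P`. -/
def ObjectProperty.monosWithCokernel (P : ObjectProperty 𝒜) : MorphismProperty 𝒜 :=
  fun _ _ f => Mono f ∧ P (cokernel f)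

namespace ObjectProperty.IsFilteredCoresolving

variable {P : ObjectProperty 𝒜} (hP : P.IsFilteredCoresolving)
include hP

lemma isStableUnderCobaseChange : P.monosWithCokernel.IsStableUnderCobaseChange where
  of_isPushout {A A' B B' f g f' g'} h hg := by
    obtain ⟨h1, h2⟩ := hg
    have hm : Mono f' := (MorphismProperty.monomorphisms 𝒜).of_isPushout h
      ((MorphismProperty.monomorphisms.iff _).2 h1)
    have := isIso_cokernel_map_of_isPushout h.flip
    exact ⟨hm, hP.of_iso (asIso (cokernel.map _ _ _ _ h.flip.w)) h2⟩

variable [IsGrothendieckAbelian.{u} 𝒜]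

lemma isStableUnderCoproducts :
    MorphismProperty.IsStableUnderCoproducts.{u} P.monosWithCokernel where
  isStableUnderCoproductsOfShape α := ⟨by
    intro X₁ X₂ c₁ c₂ hc₁ hc₂ f hf φ hφ
    have hmono : Mono φ := (MorphismProperty.monomorphisms 𝒜).colimitsOfShape_le (J := Discrete α) _
      (MorphismProperty.colimitsOfShape.mk' X₁ X₂ c₁ c₂ hc₁ hc₂ f (fun a => (hf a).1) φ hφ)
    refine ⟨hmono, ?_⟩
    let K : Discrete α ⥤ 𝒜 := Discrete.functor fun a => cokernel (f.app ⟨a⟩)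
    let c : Cocone K := Cocone.mk (cokernel φ) (Discrete.natTrans fun a =>
      cokernel.map _ _ (c₁.ι.app a) (c₂.ι.app a) (hφ a).symm)
    have hc : IsColimit c :=
      { desc := fun s => cokernel.desc φ
          (hc₂.desc (Cocone.mk s.pt (Discrete.natTrans fun a => cokernel.π (f.app a) ≫ s.ι.app a)))
          (hc₁.hom_ext fun a => by
            rw [← Category.assoc, hφ, Category.assoc, hc₂.fac]
            simp [K])
        fac := fun s a => by
          rw [← cancel_epi (cokernel.π (f.app a))]
          simp [c]
        uniq := fun s m hm => by
          rw [← cancel_epi (cokernel.π φ)]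
          refine hc₂.hom_ext fun a => ?_
          simp [← hm, c] }
    exact hP.sigma K (c := c) hc (fun a => (hf a).2)⟩


omit [IsGrothendieckAbelian.{u} 𝒜] in
lemma of_transfiniteComposition {J : Type u} [LinearOrder J] [OrderBot J] [SuccOrder J]
    [WellFoundedLT J] {X Y : 𝒜} {f : X ⟶ Y}
    (h : P.monosWithCokernel.TransfiniteCompositionOfShape J f) (hX : P X) : P Y := by
  have key (j : J) : P (h.F.obj j) := by
    induction j using SuccOrder.limitRecOn with
    | isMin j hj =>
      obtain rfl := hj.eq_bot
      exact hP.of_iso h.isoBot.symm hX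
    | succ j hj ih =>
      obtain ⟨h1, h2⟩ := h.map_mem j hj
      exact hP.of_cokernel_mono _ ih h2
    | isSuccLimit j hj ih =>
      have := hj.nonempty_Iio.to_subtype
      exact hP.of_isColimit (h.F.isColimitOfIsWellOrderContinuous j hj) (fun i => ih _ i.2)
  exact hP.of_isColimit h.isColimit key

end ObjectProperty.IsFilteredCoresolving

section

variable [IsGrothendieckAbelian.{u} 𝒜] (P : ObjectProperty 𝒜) (F : 𝒜)

/-- The inclusions of those subobjects of `F` whose cokernel belongs to `P`. -/
def ObjectProperty.generatingMonos : MorphismProperty 𝒜 :=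
  MorphismProperty.ofHoms (fun X : {X : Subobject F // P (cokernel X.arrow)} => X.1.arrow)

omit [IsGrothendieckAbelian.{u} 𝒜] in
lemma ObjectProperty.generatingMonos_le_monosWithCokernel :
    P.generatingMonos F ≤ P.monosWithCokernel := by
  rintro _ _ _ ⟨X⟩
  exact ⟨inferInstance, X.2⟩

instance : MorphismProperty.IsSmall.{u} (P.generatingMonos F) := by
  dsimp [ObjectProperty.generatingMonos]
  infer_instance

instance : MorphismProperty.HasSmallObjectArgument.{u} (P.generatingMonos F) := by
  obtain ⟨κ, hκ', hκ⟩ := HasCardinalLT.exists_regular_cardinal.{u} (Subobject F)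
  have : Fact κ.IsRegular := ⟨hκ'⟩
  have : Nonempty κ.ord.ToType := by simpa using hκ'.ne_zero
  have := WellFoundedLT.toOrderBot κ.ord.ToType
  exact ⟨κ, inferInstance, inferInstance,
    { preservesColimit {A B X Y} i hi f hf := by
        let hf' : (MorphismProperty.monomorphisms 𝒜).TransfiniteCompositionOfShape κ.ord.ToType f :=
          { toTransfiniteCompositionOfShape := hf.toTransfiniteCompositionOfShape
            map_mem j hj := by
              have := (hf.attachCells j hj).pushouts_coproducts
              simp only [MorphismProperty.ofHoms_homFamily] at this
              refine (?_ : _ ≤ MorphismProperty.monomorphisms 𝒜) _ this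
              simp only [MorphismProperty.pushouts_le_iff, MorphismProperty.coproducts_le_iff]
              exact fun _ _ _ h => (P.generatingMonos_le_monosWithCokernel F _ h).1 }
        have (j j' : κ.ord.ToType) (φ : j ⟶ j') : Mono (hf'.F.map φ) := hf'.mem_map φ
        apply IsGrothendieckAbelian.preservesColimit_coyoneda_obj_of_mono (Y := hf'.F) (κ := κ)
        obtain ⟨S⟩ := hi
        exact Subobject.hasCardinalLT_of_mono hκ S.1.arrow }⟩

variable {P}

lemma ObjectProperty.IsFilteredCoresolving.exists_rlp (hP : P.IsFilteredCoresolving) (X : 𝒜) :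
    ∃ (T : 𝒜) (t : T ⟶ X), P T ∧ (P.generatingMonos F).rlp t := by
  let I := P.generatingMonos F
  have := hP.isStableUnderCobaseChange
  have := hP.isStableUnderCoproducts
  have := I.smallObjectκ_isRegular
  refine ⟨_, SmallObject.πObj I I.smallObjectκ (0 : (0 : 𝒜) ⟶ X), ?_, SmallObject.rlp_πObj I _ _⟩
  obtain ⟨h⟩ := SmallObject.transfiniteCompositionsOfShape_ιObj I I.smallObjectκ (0 : (0 : 𝒜) ⟶ X)
  refine hP.of_transfiniteComposition (h.ofLE ?_) (hP.of_isZero _ (isZero_zero _))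
  simp only [MorphismProperty.pushouts_le_iff, MorphismProperty.coproducts_le_iff]
  exact P.generatingMonos_le_monosWithCokernel F

end

end CategoryTheory

namespace CategoryTheory

open CategoryTheory.Limits
open scoped ZeroObject

variable {𝒜 : Type v} [Category.{u} 𝒜] [Abelian 𝒜] {P : ObjectProperty 𝒜} {F : 𝒜}

/-- Every nonzero object in `P` receives a nonzero map from `F` with image in `P`. -/
def ObjectProperty.Generates (P : ObjectProperty 𝒜) (F : 𝒜) : Prop :=
  ∀ C : 𝒜, P C → ¬ IsZero C → ∃ q : F ⟶ C, q ≠ 0 ∧ P (image q)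

lemma ObjectProperty.generatingMonos_arrow (X : Subobject F) (h : P (cokernel X.arrow)) :
    P.generatingMonos F X.arrow :=
  ⟨(⟨X, h⟩ : {X : Subobject F // P (cokernel X.arrow)})⟩

namespace ObjectProperty.IsFilteredCoresolving

variable (hP : P.IsFilteredCoresolving) [Projective F] (hF : P.Generates F)
include hP hF

lemma exists_pushouts {X C : 𝒜} (f : X ⟶ C) [Mono f] (hX : P X) (hC : P C) (hf : ¬ IsIso f) :
    ∃ (X' : 𝒜) (i : X ⟶ X') (p : X' ⟶ C) (_ : (P.generatingMonos F).pushouts i)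
      (_ : ¬ IsIso i) (_ : Mono p), P X' ∧ i ≫ p = f := by
  have hz : ¬ IsZero (cokernel f) := fun hz => hf <| by
    have : Epi f := Abelian.epi_of_cokernel_π_eq_zero f (hz.eq_of_tgt _ _)
    exact isIso_of_mono_of_epi f
  obtain ⟨q, hq, hq'⟩ := hF _ (hP.of_cokernel (shortExact_cokernel f) hX hC) hz
  let g : F ⟶ C := Projective.factorThru q (cokernel.π f)
  have hg : g ≫ cokernel.π f = q := Projective.factorThru_comp _ _
  let s := pullback.snd f g
  have sq : IsPullback s (pullback.fst f g) g f := (IsPullback.of_hasPullback f g).flip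
  have hm : Mono (cokernel.map _ _ _ _ sq.w) := Abelian.mono_cokernel_map_of_isPullback sq
  have hs : P (cokernel s) :=
    hP.of_iso (image.isoStrongEpiMono (f := q) (cokernel.π s) (cokernel.map _ _ _ _ sq.w)
      (by simp [hg])).symm hq'
  have po := IsPushout.of_hasPushout (pullback.fst f g) (pullback.snd f g)
  have hs' : P (cokernel (Subobject.mk s).arrow) := by
    refine hP.of_iso ?_ hs
    exact (cokernelEpiComp (Subobject.underlyingIso s).inv (Subobject.mk s).arrow).symm ≪≫
      cokernelIsoOfEq (by simp) |>.symm
  have hi : (P.generatingMonos F).pushouts (pushout.inl (pullback.fst f g) (pullback.snd f g)) :=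
    by
      refine ⟨_, _, _, (Subobject.underlyingIso s).hom ≫ pullback.fst f g,
    pushout.inr _ _, P.generatingMonos_arrow _ hs',
    po.of_iso ((Subobject.underlyingIso s).symm) (Iso.refl _) (Iso.refl _)
      (Iso.refl _) (by simp) ((Category.comp_id _).trans (Subobject.underlyingIso_arrow s).symm)
        (by simp) (by simp)⟩
  have e₁ : pushout.inl (pullback.fst f g) (pullback.snd f g) ≫
      pushout.desc f g pullback.condition = f := pushout.inl_desc _ _ _
  have e₂ : pushout.inr (pullback.fst f g) (pullback.snd f g) ≫
      pushout.desc f g pullback.condition = g := pushout.inr_desc _ _ _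
  refine ⟨_, _, pushout.desc f g pullback.condition, hi, ?_, ?_, ?_, e₁⟩
  · intro h
    apply hq
    have h0 : pushout.desc f g pullback.condition ≫ cokernel.π f = 0 := by
      rw [← cancel_epi (pushout.inl (pullback.fst f g) (pullback.snd f g)), ← Category.assoc, e₁]
      simp
    rw [← hg, ← e₂, Category.assoc, h0, comp_zero]
  · exact po.mono_of_isPullback_of_mono (IsPullback.of_hasPullback f g) _ e₁ e₂
  · have := hP.isStableUnderCobaseChange
    obtain ⟨h1, h2⟩ := ((MorphismProperty.pushouts_le_iff).2
      (P.generatingMonos_le_monosWithCokernel F)) _ hi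
    exact hP.of_cokernel_mono _ hX h2

lemma exists_larger_subobject {C : 𝒜} (hC : P C) (A : Subobject C) (hA : P (A : 𝒜)) (hA' : A ≠ ⊤) :
    ∃ (A' : Subobject C) (h : A < A'), P (A' : 𝒜) ∧
      (P.generatingMonos F).pushouts (Subobject.ofLE A A' h.le) := by
  have hA'' : ¬ IsIso A.arrow := by rwa [Subobject.isIso_arrow_iff_eq_top]
  obtain ⟨X', i, p, hi, hi', hp, hX', fac⟩ := hP.exists_pushouts hF A.arrow hA hC hA''
  have hlt : A < Subobject.mk p := by
    conv_lhs => rw [← Subobject.mk_arrow A]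
    exact Subobject.mk_lt_mk_of_comm i fac hi'
  refine ⟨Subobject.mk p, hlt, hP.of_iso (Subobject.underlyingIso p).symm hX',
    (MorphismProperty.arrow_mk_iso_iff _ ?_).2 hi⟩
  refine Arrow.isoMk (Iso.refl _) (Subobject.underlyingIso p) ?_
  rw [← cancel_mono p]
  simp [fac]

open scoped Classical in
/-- A larger subobject in `P` if there is one, and the top subobject otherwise. -/
noncomputable def largerSubobject {C : 𝒜} (hC : P C) (A : Subobject C) : Subobject C :=
  if h : P (A : 𝒜) ∧ A ≠ ⊤ then (hP.exists_larger_subobject hF hC A h.1 h.2).choose else ⊤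

variable {C : 𝒜} (hC : P C)

lemma largerSubobject_top : hP.largerSubobject hF hC ⊤ = ⊤ := by
  simp [largerSubobject]

lemma lt_largerSubobject (A : Subobject C) (hA : A ≠ ⊤) : A < hP.largerSubobject hF hC A := by
  dsimp only [largerSubobject]
  split_ifs with h
  · exact (hP.exists_larger_subobject hF hC A h.1 h.2).choose_spec.choose
  · exact lt_top_iff_ne_top.2 hA

lemma le_largerSubobject (A : Subobject C) : A ≤ hP.largerSubobject hF hC A := by
  by_cases hA : A = ⊤
  · rw [hA, largerSubobject_top]
  · exact (hP.lt_largerSubobject hF hC A hA).le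

lemma prop_largerSubobject (A : Subobject C) : P (hP.largerSubobject hF hC A : 𝒜) := by
  dsimp only [largerSubobject]
  split_ifs with h
  · exact (hP.exists_larger_subobject hF hC A h.1 h.2).choose_spec.choose_spec.1
  · exact hP.of_iso (asIso (⊤ : Subobject C).arrow).symm hC

lemma pushouts_largerSubobject (A : Subobject C) (hA : P (A : 𝒜)) :
    (P.generatingMonos F).pushouts (Subobject.ofLE _ _ (hP.le_largerSubobject hF hC A)) := by
  by_cases h : A = ⊤
  · subst h
    have : IsIso (Subobject.ofLE _ _ (hP.le_largerSubobject hF hC (⊤ : Subobject C))) := by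
      have : IsIso (hP.largerSubobject hF hC (⊤ : Subobject C)).arrow := by
        rw [Subobject.isIso_arrow_iff_eq_top, largerSubobject_top]
      have h2 : IsIso (Subobject.ofLE _ _ (hP.le_largerSubobject hF hC (⊤ : Subobject C)) ≫
        (hP.largerSubobject hF hC (⊤ : Subobject C)).arrow) := by
        rw [Subobject.ofLE_arrow]
        infer_instance
      exact IsIso.of_isIso_comp_right _ (hP.largerSubobject hF hC (⊤ : Subobject C)).arrow
    have hz : P (cokernel (⊤ : Subobject F).arrow) :=
      hP.of_isZero _ (isZero_cokernel_of_epi _)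
    exact MorphismProperty.isomorphisms_le_pushouts _
      (fun _ => ⟨_, _, _, P.generatingMonos_arrow _ hz, 0, inferInstance⟩) _
        (MorphismProperty.isomorphisms.infer_property _)
  · refine (MorphismProperty.arrow_mk_iso_iff _ ?_).1
      (hP.exists_larger_subobject hF hC A hA h).choose_spec.choose_spec.2
    exact Arrow.isoMk (Iso.refl _)
      (Subobject.isoOfEq _ _ ((by simp [largerSubobject, hA, h]))) (by simp)

lemma pushouts_ofLE_of_eq {A B : Subobject C} (h : A ≤ B) (hB : B = hP.largerSubobject hF hC A)
    (hA : P (A : 𝒜)) : (P.generatingMonos F).pushouts (Subobject.ofLE A B h) := by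
  subst hB
  exact hP.pushouts_largerSubobject hF hC A hA

variable [IsGrothendieckAbelian.{u} 𝒜] (J : Type u) [LinearOrder J] [OrderBot J] [SuccOrder J]
  [WellFoundedLT J]

/-- The transfinite iteration of `largerSubobject`, starting with `⊥`. -/
noncomputable def filtration (j : J) : Subobject C :=
  transfiniteIterate (hP.largerSubobject hF hC) j ⊥

variable {J}

lemma filtration_mono {i j : J} (h : i ≤ j) :
    hP.filtration hF hC J i ≤ hP.filtration hF hC J j :=
  monotone_transfiniteIterate _ _ (hP.le_largerSubobject hF hC) h

omit [OrderBot J] in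
lemma filtration_succ (j : J) (hj : ¬ IsMax j) :
    hP.filtration hF hC J (Order.succ j) = hP.largerSubobject hF hC (hP.filtration hF hC J j) :=
  transfiniteIterate_succ _ _ _ hj

variable (J)

/-- The functor to the category of subobjects attached to `filtration`. -/
noncomputable def filtrationMonoOver : J ⥤ MonoOver C where
  obj j := MonoOver.mk (hP.filtration hF hC J j).arrow
  map f := MonoOver.homMk (Subobject.ofLE _ _ (hP.filtration_mono hF hC (leOfHom f)))

/-- The functor attached to `filtration`. -/
noncomputable def filtrationFunctor : J ⥤ 𝒜 where
  obj j := (hP.filtration hF hC J j : 𝒜)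
  map f := Subobject.ofLE _ _ (hP.filtration_mono hF hC (leOfHom f))

instance : (hP.filtrationFunctor hF hC J).IsWellOrderContinuous where
  nonempty_isColimit m hm := ⟨by
    have := hm.nonempty_Iio.to_subtype
    let c := (Set.principalSegIio m).cocone (hP.filtrationMonoOver hF hC J ⋙ MonoOver.forget _)
    have : Mono c.pt.hom := inferInstanceAs (Mono (hP.filtration hF hC J m).arrow)
    refine IsGrothendieckAbelian.isColimitMapCoconeOfSubobjectMkEqISup
      ((Set.principalSegIio m).monotone.functor ⋙ hP.filtrationMonoOver hF hC J) c ?_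
    change Subobject.mk (hP.filtration hF hC J m).arrow =
      ⨆ j : Set.Iio m, Subobject.mk (hP.filtration hF hC J j.1).arrow
    simp only [Subobject.mk_arrow]
    exact transfiniteIterate_limit (hP.largerSubobject hF hC) ⊥ m hm⟩

variable {J} in
lemma prop_filtration (j : J) : P (hP.filtration hF hC J j : 𝒜) := by
  induction j using SuccOrder.limitRecOn with
  | isMin j hj =>
    obtain rfl := hj.eq_bot
    refine hP.of_isZero _ ?_
    have : hP.filtration hF hC J ⊥ = ⊥ := transfiniteIterate_bot _ _
    rw [this]
    exact Limits.IsZero.of_iso (isZero_zero _) Subobject.botCoeIsoZero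
  | succ j hj ih =>
    rw [filtration_succ _ _ _ _ hj]
    exact hP.prop_largerSubobject hF hC _
  | isSuccLimit j hj ih =>
    have := hj.nonempty_Iio.to_subtype
    exact hP.of_isColimit
      ((hP.filtrationFunctor hF hC J).isColimitOfIsWellOrderContinuous j hj) (fun i => ih _ i.2)

/-- The inclusion of the bottom step in a step of the filtration is a transfinite composition of
pushouts of generating monomorphisms. -/
noncomputable def transfiniteCompositionOfShapeFiltration (j : J) :
    (P.generatingMonos F).pushouts.TransfiniteCompositionOfShape (Set.Iic j)
    ((hP.filtrationFunctor hF hC J).map (homOfLE bot_le : ⊥ ⟶ j)) where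
  F := (Set.initialSegIic j).monotone.functor ⋙ hP.filtrationFunctor hF hC J
  isoBot := Iso.refl _
  incl :=
    { app k := (hP.filtrationFunctor hF hC J).map (homOfLE k.2)
      naturality k k' h := by
        change Subobject.ofLE _ _ _ ≫ Subobject.ofLE _ _ _ = Subobject.ofLE _ _ _ ≫ 𝟙 _
        rw [Category.comp_id]
        exact Subobject.ofLE_comp_ofLE _ _ _ _ _ }
  isColimit := colimitOfDiagramTerminal isTerminalTop _
  fac := by
    change 𝟙 _ ≫ _ = _
    exact Category.id_comp _
  map_mem k hk := by
    refine hP.pushouts_ofLE_of_eq hF hC (hP.filtration_mono hF hC (i := k.1)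
      (Order.le_succ k)) ?_ (hP.prop_filtration hF hC _)
    rw [← filtration_succ _ _ _ _ (Set.not_isMax_coe _ hk)]
    exact congrArg _ (congrArg Subtype.val (Set.Iic.succ_eq_of_not_isMax hk))

lemma llp_rlp_filtration (j : J) :
    (P.generatingMonos F).rlp.llp
      ((hP.filtrationFunctor hF hC J).map (homOfLE bot_le : ⊥ ⟶ j)) := by
  have h := MorphismProperty.transfiniteCompositionsOfShape_le_llp_rlp _ _ _
    (hP.transfiniteCompositionOfShapeFiltration hF hC J j).mem
  rwa [MorphismProperty.rlp_pushouts] at h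

omit J [LinearOrder J] [OrderBot J] [SuccOrder J] [WellFoundedLT J] in
include hC in
lemma exists_lift_of_rlp {T X : 𝒜} (t : T ⟶ X) (ht : (P.generatingMonos F).rlp t) (c : C ⟶ X) :
    ∃ l : C ⟶ T, l ≫ t = c := by
  let κ := Order.succ (Cardinal.mk (Shrink.{u} (Subobject C)))
  have : Nonempty κ.ord.ToType := by simp [κ]
  have := WellFoundedLT.toOrderBot κ.ord.ToType
  obtain ⟨j, hj⟩ : ∃ j : κ.ord.ToType, hP.filtration hF hC κ.ord.ToType j = ⊤ := by
    refine top_mem_range_transfiniteIterate (hP.largerSubobject hF hC) ⊥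
      (hP.lt_largerSubobject hF hC) (hP.largerSubobject_top hF hC) (fun h => ?_)
    have h1 : HasCardinalLT (Subobject C) (Cardinal.mk κ.ord.ToType) :=
      lt_of_lt_of_le (Order.lt_succ _) (by simp [κ])
    simpa [hasCardinalLT_iff_cardinal_mk_lt] using h1.of_injective _ h
  have hbot : hP.filtration hF hC κ.ord.ToType ⊥ = ⊥ := transfiniteIterate_bot _ _
  have hz : IsZero ((hP.filtrationFunctor hF hC κ.ord.ToType).obj ⊥) := by
    change IsZero (hP.filtration hF hC κ.ord.ToType ⊥ : 𝒜)
    rw [hbot]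
    exact (isZero_zero _).of_iso Subobject.botCoeIsoZero
  have := (Subobject.isIso_arrow_iff_eq_top _).2 hj
  have := hP.llp_rlp_filtration hF hC κ.ord.ToType j _ ht
  have sq : CommSq 0 ((hP.filtrationFunctor hF hC κ.ord.ToType).map (homOfLE bot_le : ⊥ ⟶ j)) t
    ((hP.filtration hF hC κ.ord.ToType j).arrow ≫ c) := ⟨hz.eq_of_src _ _⟩
  obtain ⟨l, hl⟩ : ∃ l : (hP.filtration hF hC κ.ord.ToType j : 𝒜) ⟶ T,
    l ≫ t = (hP.filtration hF hC κ.ord.ToType j).arrow ≫ c := ⟨sq.lift, sq.fac_right⟩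
  refine ⟨inv (hP.filtration hF hC κ.ord.ToType j).arrow ≫ l, ?_⟩
  rw [Category.assoc, hl, IsIso.inv_hom_id_assoc]

omit C hC J [LinearOrder J] [OrderBot J] [SuccOrder J] [WellFoundedLT J] in
/-- Every object has a `P`-precover. -/
lemma exists_precover (X : 𝒜) :
    ∃ (T : 𝒜) (t : T ⟶ X), P T ∧ ∀ (C : 𝒜) (_ : P C) (c : C ⟶ X), ∃ l : C ⟶ T, l ≫ t = c := by
  obtain ⟨T, t, hT, ht⟩ := hP.exists_rlp F X
  exact ⟨T, t, hT, fun C hC c => hP.exists_lift_of_rlp hF hC t ht c⟩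

end ObjectProperty.IsFilteredCoresolving

end CategoryTheory

namespace CategoryTheory

open CategoryTheory.Limits SmallObject

attribute [local instance] IsFiltered.isConnected

/-- A partial order which is small admits no strictly increasing transfinite sequences indexed by a
sufficiently large well-order without maximal elements. -/
lemma exists_wellOrder_forall_not_strictMono (A : Type w) [Small.{u} A] [PartialOrder A] :
    ∃ (J : Type u) (_ : LinearOrder J) (_ : OrderBot J) (_ : SuccOrder J) (_ : WellFoundedLT J)
      (_ : NoMaxOrder J), ∀ f : J → A, (∀ i j, i ≤ j → f i ≤ f j) →
      ∃ j, f (Order.succ j) = f j := by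
  let κ := Order.succ (max (Cardinal.mk (Shrink.{u} A)) Cardinal.aleph0)
  have hκ : Cardinal.aleph0 ≤ κ := (le_max_right _ _).trans (Order.le_succ _)
  have : Nonempty κ.ord.ToType := by simp [κ]
  have : NoMaxOrder κ.ord.ToType := Cardinal.noMaxOrder hκ
  refine ⟨κ.ord.ToType, inferInstance, WellFoundedLT.toOrderBot _, inferInstance, inferInstance,
    inferInstance, fun f hf => ?_⟩
  by_contra! h
  have hs : StrictMono f := fun i j hij =>
    ((hf _ _ (Order.le_succ i)).lt_of_ne (h i).symm).trans_le (hf _ _ (Order.succ_le_of_lt hij))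
  have h1 : Cardinal.mk (Shrink.{u} A) < Cardinal.mk κ.ord.ToType := by
    simp [κ]
  exact h1.not_ge (Cardinal.mk_le_of_injective
    (f := fun j => equivShrink A (f j)) ((equivShrink A).injective.comp hs.injective))

lemma hasIterationOfShape_of_filtered (𝒟 : Type w) [Category.{u} 𝒟]
    (h : ∀ (J : Type u) [LinearOrder J] [Nonempty J], HasColimitsOfShape J 𝒟)
    (J : Type u) [LinearOrder J] [OrderBot J] : HasIterationOfShape J 𝒟 where
  hasColimitsOfShape_of_isSuccLimit j hj := by
    have : Nonempty (Set.Iio j) := ⟨⟨⊥, hj.bot_lt⟩⟩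
    exact h _
  hasColimitsOfShape := h J

/-- In a category with filtered colimits, a monotone invariant with values in a small partial order
becomes stationary. -/
lemma exists_stationary {𝒟 : Type w} [Category.{u} 𝒟]
    (h : ∀ (J : Type u) [LinearOrder J] [Nonempty J], HasColimitsOfShape J 𝒟)
    {A : Type*} [Small.{u} A] [PartialOrder A] (k : 𝒟 → A)
    (hk : ∀ {X Y : 𝒟}, (X ⟶ Y) → k X ≤ k Y) (X : 𝒟) :
    ∃ Y : 𝒟, ∀ {Z : 𝒟}, (Y ⟶ Z) → k Z = k Y := by
  by_contra! H
  choose s f hs using H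
  obtain ⟨J, _, _, _, _, _, hJ⟩ := exists_wellOrder_forall_not_strictMono.{u} A
  have := hasIterationOfShape_of_filtered 𝒟 h J
  let Φ : SuccStruct 𝒟 := { X₀ := X, succ := s, toSucc := f }
  obtain ⟨j, hj⟩ := hJ (fun j => k ((Φ.iterationFunctor J).obj j))
    fun i j hij => hk ((Φ.iterationFunctor J).map (homOfLE hij))
  have h1 := (Φ.prop_iterationFunctor_map_succ j (not_isMax j)).succ_eq
  exact hs ((Φ.iterationFunctor J).obj j) ((congrArg k h1).trans hj)

lemma mono_of_isColimit_of_forall_comp_eq_zero {𝒜 : Type v} [Category.{u} 𝒜] [Abelian 𝒜]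
    [IsGrothendieckAbelian.{u} 𝒜] {F : ℕ ⥤ 𝒜} {c : Cocone F} (hc : IsColimit c) {W : 𝒜}
    (f : c.pt ⟶ W) (h : ∀ (n : ℕ) {Z : 𝒜} (z : Z ⟶ F.obj n), z ≫ c.ι.app n ≫ f = 0 →
      z ≫ F.map (homOfLE n.le_succ) = 0) : Mono f := by
  have : AB5OfSize.{0, 0} 𝒜 := AB5OfSize_of_univLE.{0, 0, u, u} 𝒜
  have : HasExactColimitsOfShape ℕ 𝒜 := AB5OfSize.ofShape ℕ
  have : PreservesFiniteLimits (colim : (ℕ ⥤ 𝒜) ⥤ 𝒜) :=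
    HasExactColimitsOfShape.preservesFiniteLimits
  let φ : F ⟶ (Functor.const ℕ).obj W := (c.extend f).ι
  have hφ (n : ℕ) : (kernel.ι φ).app n ≫ F.map (homOfLE n.le_succ) = 0 :=
    h n _ (NatTrans.congr_app (kernel.condition φ) n)
  let S := ShortComplex.mk (kernel.ι φ) φ (kernel.condition φ)
  have hS : (S.map (colim : (ℕ ⥤ 𝒜) ⥤ 𝒜)).Exact :=
    (S.exact_of_f_is_kernel (kernelIsKernel φ)).map _
  have hS0 : colim.map (kernel.ι φ) = 0 := by
    refine colimit.hom_ext fun n => ?_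
    have h1 : colimit.ι (kernel φ) n ≫ colim.map (kernel.ι φ) =
      (kernel.ι φ).app n ≫ colimit.ι F n := colimit.ι_map _ _
    have h2 : colimit.ι (kernel φ) n ≫ (0 : colim.obj (kernel φ) ⟶ colim.obj F) = 0 := comp_zero
    refine h1.trans (Eq.trans ?_ h2.symm)
    rw [← colimit.w F (homOfLE n.le_succ), reassoc_of% hφ n, zero_comp]
  have hm : Mono (colim.map φ) := hS.mono_g hS0
  obtain ⟨e, he⟩ : ∃ e : colim.obj F ≅ c.pt, ∀ n, c.ι.app n ≫ e.inv = colimit.ι F n :=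
    ⟨(colimit.isColimit F).coconePointUniqueUpToIso hc,
      (colimit.isColimit F).comp_coconePointUniqueUpToIso_inv hc⟩
  obtain ⟨e', he'⟩ : ∃ e' : colim.obj ((Functor.const ℕ).obj W) ≅ W,
      ∀ n, colimit.ι ((Functor.const ℕ).obj W) n ≫ e'.hom = 𝟙 W :=
    ⟨(colimit.isColimit _).coconePointUniqueUpToIso (isColimitConstCocone ℕ W),
      IsColimit.comp_coconePointUniqueUpToIso_hom _ _⟩
  have hf : f = e.inv ≫ colim.map φ ≫ e'.hom := by
    refine hc.hom_ext fun n => ?_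
    have h1 : colimit.ι F n ≫ colim.map φ = 
        (c.ι.app n ≫ f) ≫ colimit.ι ((Functor.const ℕ).obj W) n := colimit.ι_map φ n
    rw [reassoc_of% he n, reassoc_of% h1]
    exact ((Category.comp_id _).symm.trans (congrArg ((c.ι.app n ≫ f) ≫ ·) (he' n).symm)).trans
      (Category.assoc _ _ _)
  rw [hf]
  exact mono_comp _ _

section

variable {𝒜 : Type v} [Category.{u} 𝒜] [Abelian 𝒜] [IsGrothendieckAbelian.{u} 𝒜]
  {𝒟 : Type w} [Category.{u} 𝒟] (U : 𝒟 ⥤ 𝒜)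
  (h : ∀ (J : Type u) [LinearOrder J] [Nonempty J], HasColimitsOfShape J 𝒟)

include h

lemma exists_hom_forall_kernel_eq (T : 𝒟) :
    ∃ (T' : 𝒟) (t : T ⟶ T'), ∀ {W : 𝒟} (f : T' ⟶ W) {Z : 𝒜} (z : Z ⟶ U.obj T),
      z ≫ U.map (t ≫ f) = 0 → z ≫ U.map t = 0 := by
  have h' (J : Type u) [LinearOrder J] [Nonempty J] : HasColimitsOfShape J (Under T) := by
    have := h J
    infer_instance
  obtain ⟨Y, hY⟩ := exists_stationary h'
    (fun Y : Under T => kernelSubobject (U.map Y.hom)) (fun {X Y} f => by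
      have := kernelSubobject_comp_le (U.map X.hom) (U.map f.right)
      simpa only [← U.map_comp, Under.w f] using this) (Under.mk (𝟙 T))
  refine ⟨Y.right, Y.hom, fun {W} f Z z hz => ?_⟩
  have h1 := hY (Under.homMk f : Y ⟶ Under.mk (Y.hom ≫ f))
  have h2 : (kernelSubobject (U.map (Y.hom ≫ f))).Factors z := by
    exact (kernelSubobject_factors_iff _ _).2 hz
  rw [show kernelSubobject (U.map (Y.hom ≫ f)) = _ from h1] at h2
  exact (kernelSubobject_factors_iff _ _).1 h2

lemma exists_hom_forall_mono [HasColimitsOfShape ℕ 𝒟] [PreservesColimitsOfShape ℕ U] (T : 𝒟) :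
    ∃ (G : 𝒟) (_ : T ⟶ G), ∀ {W : 𝒟} (f : G ⟶ W), Mono (U.map f) := by
  choose s t ht using exists_hom_forall_kernel_eq U h
  obtain ⟨F, rfl, hy⟩ : ∃ F : ℕ ⥤ 𝒟, F.obj 0 = T ∧
      ∀ (n : ℕ) {W : 𝒟} (f : F.obj (n + 1) ⟶ W) {Z : 𝒜} (z : Z ⟶ U.obj (F.obj n)),
        z ≫ U.map (F.map (homOfLE n.le_succ) ≫ f) = 0 →
          z ≫ U.map (F.map (homOfLE n.le_succ)) = 0 := by
    let Y : ℕ → 𝒟 := fun n => Nat.rec T (fun _ => s) n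
    let y (n : ℕ) : Y n ⟶ Y (n + 1) := t (Y n)
    have hF (n : ℕ) := Functor.ofSequence_map_homOfLE_succ y n
    refine ⟨Functor.ofSequence y, rfl, fun n W f Z z hz => ?_⟩
    refine Eq.trans (congrArg (fun g => z ≫ U.map g) (hF n)) (ht (Y n) f z ?_)
    exact Eq.trans (congrArg (fun g => z ≫ U.map (g ≫ f)) (hF n)).symm hz
  refine ⟨colimit F, colimit.ι F 0, fun {W} f => ?_⟩
  let hc := isColimitOfPreserves U (colimit.isColimit F)
  refine mono_of_isColimit_of_forall_comp_eq_zero hc (U.map f) fun n Z z hz => ?_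
  refine hy n (colimit.ι F (n + 1) ≫ f) z ?_
  have h1 : U.map (F.map (homOfLE n.le_succ) ≫ colimit.ι F (n + 1) ≫ f) =
      U.map (colimit.ι F n) ≫ U.map f := by
    rw [← U.map_comp]
    exact congrArg U.map (colimit.w_assoc F (homOfLE n.le_succ) f)
  rw [h1]
  exact hz

/-- A category with filtered colimits and a weakly terminal object, equipped with a functor to a
Grothendieck abelian category preserving sequential colimits, has a weakly terminal object all of
whose endomorphisms become invertible. -/
lemma exists_weaklyTerminal_forall_isIso [HasColimitsOfShape ℕ 𝒟] [PreservesColimitsOfShape ℕ U]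
    (T : 𝒟) (hT : ∀ Y : 𝒟, Nonempty (Y ⟶ T)) :
    ∃ G : 𝒟, (∀ Y : 𝒟, Nonempty (Y ⟶ G)) ∧ ∀ e : G ⟶ G, IsIso (U.map e) := by
  obtain ⟨G, g, hG⟩ := exists_hom_forall_mono U h T
  have hG' (Y : 𝒟) : Nonempty (Y ⟶ G) := (hT Y).map (· ≫ g)
  refine ⟨G, hG', fun e => ?_⟩
  by_contra he
  have := hG e
  have he' : ¬ Epi (U.map e) := fun _ => he (isIso_of_mono_of_epi _)
  obtain ⟨J, _, _, _, _, _, hJ⟩ := exists_wellOrder_forall_not_strictMono.{u} (Subobject (U.obj G))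
  have := hasIterationOfShape_of_filtered 𝒟 h J
  let Φ : SuccStruct 𝒟 := { X₀ := G, succ := fun _ => G, toSucc := fun Y => (hG' Y).some ≫ e }
  have hΦ {X Y : 𝒟} (f : X ⟶ Y) (hf : Φ.prop f) :
      ¬ Epi (U.map f) ∧ ∀ {W : 𝒟} (f : Y ⟶ W), Mono (U.map f) := by
    have h' (Z : 𝒟) : ¬ Epi (U.map (Φ.toSucc Z)) := fun hZ => he' <| by
      have : Epi (U.map (hG' Z).some ≫ U.map e) := U.map_comp (hG' Z).some e ▸ hZ
      exact epi_of_epi (U.map (hG' Z).some) (U.map e)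
    obtain ⟨_⟩ := hf
    exact ⟨h' _, fun f => hG f⟩
  let F := Φ.iterationFunctor J
  obtain ⟨p⟩ := hG' (colimit F)
  obtain ⟨j, hj⟩ := hJ (fun j => imageSubobject (U.map (colimit.ι F j ≫ p))) fun i j hij => by
    have := imageSubobject_comp_le (U.map (F.map (homOfLE hij))) (U.map (colimit.ι F j ≫ p))
    simpa only [← U.map_comp, colimit.w_assoc] using this
  obtain ⟨h1, h2⟩ := hΦ _ (Φ.prop_iterationFunctor_map_succ j (not_isMax j))
  have := h2 (colimit.ι F (Order.succ j) ≫ p)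
  set m := U.map (colimit.ι F (Order.succ j) ≫ p)
  set f := U.map (F.map (homOfLE (Order.le_succ j)))
  have hfm : U.map (colimit.ι F j ≫ p) = f ≫ m := by
    rw [← U.map_comp, colimit.w_assoc]
  rw [hfm] at hj
  have hle : imageSubobject m ≤ Subobject.mk (image.ι f ≫ m) := by
    rw [hj]
    refine imageSubobject_le _ (factorThruImage f ≫ (Subobject.underlyingIso _).inv) ?_
    simp
  have h3 : (Subobject.mk (image.ι f ≫ m)).Factors m :=
    Subobject.factors_of_le _ hle (by
      conv_rhs => rw [← imageSubobject_arrow_comp m]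
      exact Subobject.factors_comp_arrow _)
  have h4 : Subobject.factorThru _ m h3 ≫ (Subobject.underlyingIso _).hom ≫ image.ι f = 𝟙 _ := by
    rw [← cancel_mono m]
    simp
  have : IsSplitEpi (image.ι f) := .mk' ⟨_, (Category.assoc _ _ _).trans h4⟩
  have : IsIso (image.ι f) := isIso_of_mono_of_isSplitEpi _
  apply h1
  rw [← image.fac f]
  exact epi_comp _ _

end

end CategoryTheory

namespace CategoryTheory

open CategoryTheory.Limits

namespace ObjectProperty.IsFilteredCoresolving

variable {𝒜 : Type v} [Category.{u} 𝒜] [Abelian 𝒜] {P : ObjectProperty 𝒜} {F : 𝒜}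
  [IsGrothendieckAbelian.{u} 𝒜] (hP : P.IsFilteredCoresolving)
include hP

omit [IsGrothendieckAbelian.{u} 𝒜] in
lemma isClosedUnderColimitsOfShape (J : Type u) [SmallCategory J] [IsFiltered J] :
    P.IsClosedUnderColimitsOfShape J where
  colimitsOfShape_le := by
    rintro X ⟨h⟩
    exact hP.of_isColimit h.isColimit h.prop_diag_obj

/-- Every object has a `P`-cover. -/
lemma exists_cover [Projective F] (hF : P.Generates F) (X : 𝒜) :
    ∃ (T : 𝒜) (t : T ⟶ X), P T ∧ (∀ (C : 𝒜) (_ : P C) (c : C ⟶ X), ∃ l : C ⟶ T, l ≫ t = c) ∧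
      ∀ e : T ⟶ T, e ≫ t = t → IsIso e := by
  obtain ⟨T, t, hT, ht⟩ := hP.exists_precover hF X
  have hJ (J : Type u) [LinearOrder J] [Nonempty J] :
      HasColimitsOfShape J (CostructuredArrow P.ι X) := by
    have := hP.isClosedUnderColimitsOfShape J
    infer_instance
  let ε : ULift.{u} ℕ ≌ ℕ := OrderIso.equivalence ⟨Equiv.ulift, Iff.rfl⟩
  have := hP.isClosedUnderColimitsOfShape (ULift.{u} ℕ)
  have : HasColimitsOfShape ℕ (CostructuredArrow P.ι X) := hasColimitsOfShape_of_equivalence ε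
  let U := CostructuredArrow.proj P.ι X ⋙ P.ι
  have : PreservesColimitsOfShape ℕ U := by
    have : PreservesColimitsOfShape (ULift.{u} ℕ) U := by
      unfold U
      infer_instance
    exact preservesColimitsOfShape_of_equiv ε U
  obtain ⟨G, hG, he⟩ := exists_weaklyTerminal_forall_isIso U hJ
    (CostructuredArrow.mk (Y := (⟨T, hT⟩ : P.FullSubcategory)) t) (fun Y => by
      obtain ⟨l, hl⟩ := ht _ Y.left.property Y.hom
      exact ⟨CostructuredArrow.homMk (ObjectProperty.homMk l) hl⟩)
  refine ⟨G.left.obj, G.hom, G.left.property, fun C hC c => ?_, fun e h => ?_⟩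
  · obtain ⟨f⟩ := hG (CostructuredArrow.mk (Y := (⟨C, hC⟩ : P.FullSubcategory)) c)
    exact ⟨f.left.hom, CostructuredArrow.w f⟩
  · exact he (CostructuredArrow.homMk (ObjectProperty.homMk e) h)

end ObjectProperty.IsFilteredCoresolving

end CategoryTheory

section

variable {R : Type u} [CommRing R] {J : Type u} [SmallCategory J] [IsFiltered J]
  {F : J ⥤ ModuleCat.{u} R} {c : Cocone F} (hc : IsColimit c)
include hc

lemma ModuleCat.exists_map_eq_zero {j : J} (y : F.obj j) (hy : c.ι.app j y = 0) :
    ∃ (k : J) (g : j ⟶ k), F.map g y = 0 := by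
  obtain ⟨k, f, g, h⟩ := Concrete.isColimit_exists_of_rep_eq F hc y (0 : F.obj j)
    (hy.trans (map_zero (c.ι.app j).hom).symm)
  exact ⟨k, f, h.trans (map_zero (F.map g).hom)⟩

lemma ModuleCat.exists_comp_map_eq_zero {N : Type u} [AddCommGroup N] [Module R N]
    [Module.Finite R N] {j : J} (f : N →ₗ[R] F.obj j) (hf : (c.ι.app j).hom ∘ₗ f = 0) :
    ∃ (k : J) (g : j ⟶ k), (F.map g).hom ∘ₗ f = 0 := by
  classical
  have key (s : Finset N) : ∃ (k : J) (g : j ⟶ k), ∀ x ∈ s, F.map g (f x) = 0 := by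
    induction s using Finset.induction_on with
    | empty => exact ⟨j, 𝟙 j, by simp⟩
    | insert a s _ ih =>
      obtain ⟨k, g, hg⟩ := ih
      obtain ⟨l, h, hh⟩ := ModuleCat.exists_map_eq_zero hc (f a) (LinearMap.congr_fun hf a)
      obtain ⟨m, p, q, hpq⟩ := IsFilteredOrEmpty.cocone_objs k l
      have e := IsFiltered.coeq_condition (g ≫ p) (h ≫ q)
      refine ⟨_, (g ≫ p) ≫ IsFiltered.coeqHom (g ≫ p) (h ≫ q), fun x hx => ?_⟩
      rcases Finset.mem_insert.1 hx with rfl | hx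
      · rw [e, Category.assoc, F.map_comp]
        exact (congrArg (F.map (q ≫ _)) hh).trans (map_zero (F.map (q ≫ _)).hom)
      · rw [Category.assoc, F.map_comp]
        exact (congrArg (F.map (p ≫ _)) (hg x hx)).trans (map_zero (F.map (p ≫ _)).hom)
  obtain ⟨s, hs⟩ := Module.Finite.fg_top (R := R) (M := N)
  obtain ⟨k, g, hg⟩ := key s
  exact ⟨k, g, LinearMap.ext_on hs fun x hx => hg x hx⟩

lemma ModuleCat.exists_ι_comp_eq {N : Type u} [AddCommGroup N] [Module R N] [IsNoetherianRing R]
    [Module.Finite R N] (f : N →ₗ[R] c.pt) :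
    ∃ (j : J) (g : N →ₗ[R] F.obj j), (c.ι.app j).hom ∘ₗ g = f := by
  classical
  obtain ⟨n, e, he⟩ := Module.Finite.exists_fin' R N
  have key (x : c.pt) : ∃ (j : J) (y : F.obj j), c.ι.app j y = x :=
    Concrete.isColimit_exists_rep F hc x
  choose j y hy using fun i : Fin n => key (f (e (Pi.single i 1)))
  obtain ⟨S, hS⟩ := IsFiltered.sup_objs_exists (Finset.univ.image j)
  have u (i : Fin n) : j i ⟶ S := (hS (Finset.mem_image_of_mem j (Finset.mem_univ i))).some
  let h : (Fin n → R) →ₗ[R] F.obj S := (Pi.basisFun R (Fin n)).constr R fun i => F.map (u i) (y i)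
  have hh : (c.ι.app S).hom ∘ₗ h = f ∘ₗ e := by
    refine (Pi.basisFun R (Fin n)).ext fun i => ?_
    have h1 : h (Pi.basisFun R (Fin n) i) = F.map (u i) (y i) := Module.Basis.constr_basis _ _ _ _
    rw [LinearMap.comp_apply, h1, LinearMap.comp_apply, Pi.basisFun_apply, ← hy i]
    exact ModuleCat.hom_congr (c.w (u i)) (y i)
  obtain ⟨k, g, hg⟩ := ModuleCat.exists_comp_map_eq_zero hc (h ∘ₗ (LinearMap.ker e).subtype) (by
    rw [← LinearMap.comp_assoc, hh]
    ext x
    simp)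
  have hk : LinearMap.ker e ≤ LinearMap.ker ((F.map g).hom ∘ₗ h) := fun x hx =>
    LinearMap.congr_fun hg ⟨x, hx⟩
  obtain ⟨l, hl⟩ : ∃ l : N →ₗ[R] F.obj k, l ∘ₗ e = (F.map g).hom ∘ₗ h :=
    ⟨(LinearMap.ker e).liftQ _ hk ∘ₗ (e.quotKerEquivOfSurjective he).symm.toLinearMap, by
      ext x
      simp⟩
  refine ⟨k, l, ?_⟩
  rw [← LinearMap.cancel_right he, LinearMap.comp_assoc, hl, ← hh, ← LinearMap.comp_assoc]
  congr 1
  exact congrArg ModuleCat.Hom.hom (c.w g)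

end

section InjLifts

variable {R : Type u} [CommRing R]

lemma Module.Injective.of_linear_retract {M N : Type u} [AddCommGroup M] [Module R M]
    [AddCommGroup N] [Module R N] [Module.Injective R M] (s : N →ₗ[R] M) (r : M →ₗ[R] N) (h : r ∘ₗ s = .id) :
    Module.Injective R N where
  out X Y _ _ _ _ f hf g := by
    obtain ⟨e, he⟩ := Module.Injective.out f hf (s ∘ₗ g)
    exact ⟨r ∘ₗ e, fun x => (congrArg r (he x)).trans (LinearMap.congr_fun h (g x))⟩

lemma Module.Injective.of_split {A B C : Type u} [AddCommGroup A] [Module R A] [AddCommGroup B]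
    [Module R B] [AddCommGroup C] [Module R C] [Module.Injective R A] [Module.Injective R C]
    (i : A →ₗ[R] B) (r : B →ₗ[R] A) (p : B →ₗ[R] C) (σ : C →ₗ[R] B)
    (h : ∀ x, i (r x) + σ (p x) = x) : Module.Injective R B where
  out X Y _ _ _ _ f hf g := by
    obtain ⟨e, he⟩ := Module.Injective.out f hf (r ∘ₗ g)
    obtain ⟨e', he'⟩ := Module.Injective.out f hf (p ∘ₗ g)
    exact ⟨i ∘ₗ e + σ ∘ₗ e', fun x => by simp [he, he', h]⟩

lemma exists_splitting {A B C : Type u} [AddCommGroup A] [Module R A] [AddCommGroup B]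
    [Module R B] [AddCommGroup C] [Module R C] [Module.Injective R A] {i : A →ₗ[R] B}
    {p : B →ₗ[R] C} (hi : Function.Injective i) (hip : Function.Exact i p)
    (hp : Function.Surjective p) :
    ∃ (r : B →ₗ[R] A) (σ : C →ₗ[R] B), (∀ x, i (r x) + σ (p x) = x) ∧ ∀ x, p (σ x) = x := by
  obtain ⟨r, hr⟩ := Module.Injective.out i hi LinearMap.id
  let q : B →ₗ[R] B := LinearMap.id - i ∘ₗ r
  have hq : LinearMap.ker p ≤ LinearMap.ker q := fun x hx => by
    obtain ⟨y, rfl⟩ := (hip x).1 hx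
    simp [q, hr]
  obtain ⟨σ, hσ⟩ : ∃ σ : C →ₗ[R] B, ∀ x, σ (p x) = q x :=
    ⟨(LinearMap.ker p).liftQ q hq ∘ₗ (p.quotKerEquivOfSurjective hp).symm.toLinearMap, fun x => by
      simp⟩
  refine ⟨r, σ, fun x => by simp [hσ, q], fun x => ?_⟩
  obtain ⟨y, rfl⟩ := hp x
  rw [hσ]
  simp [q, hip.apply_apply_eq_zero]

variable (R) in
/-- Complexes of injective modules which are `Hom(N, -)`-acyclic. -/
def injLifts (N : Type u) [AddCommGroup N] [Module R N] :
    ObjectProperty (ChainComplex (ModuleCat.{u} R) ℤ) :=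
  fun C => (∀ n, Module.Injective R (C.X n)) ∧ Lifts C N

variable {N : Type u} [AddCommGroup N] [Module R N]

lemma injLifts.of_isZero (C : ChainComplex (ModuleCat.{u} R) ℤ) (hC : IsZero C) :
    injLifts R N C := by
  have h (n : ℤ) : Subsingleton (C.X n) :=
    ModuleCat.subsingleton_of_isZero ((HomologicalComplex.eval _ _ n).map_isZero hC)
  refine ⟨fun n => ⟨fun _ _ _ _ _ _ _ _ _ => ⟨0, fun _ => Subsingleton.elim _ _⟩⟩, ?_⟩
  exact fun i j k _ _ f _ => ⟨0, LinearMap.ext fun _ => Subsingleton.elim _ _⟩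

lemma injLifts.of_isColimit [IsNoetherianRing R] [Module.Finite R N] {J : Type u} [SmallCategory J]
    [IsFiltered J] {K : J ⥤ ChainComplex (ModuleCat.{u} R) ℤ} {c : Cocone K} (hc : IsColimit c)
    (h : ∀ j, injLifts R N (K.obj j)) : injLifts R N c.pt := by
  have hcn (n : ℤ) : IsColimit ((HomologicalComplex.eval _ _ n).mapCocone c) :=
    isColimitOfPreserves _ hc
  refine ⟨fun n => Module.Baer.injective fun I g => ?_, fun i j k hi hj f hf => ?_⟩
  · obtain ⟨a, g, rfl⟩ := ModuleCat.exists_ι_comp_eq (hcn n) g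
    have : Module.Injective R (((K ⋙ HomologicalComplex.eval _ _ n)).obj a) := (h a).1 n
    obtain ⟨e, he⟩ := Module.Injective.out I.subtype I.subtype_injective g
    exact ⟨((c.ι.app a).f n).hom ∘ₗ e, fun x hx => congrArg ((c.ι.app a).f n) (he ⟨x, hx⟩)⟩
  · obtain ⟨a, g, hg⟩ := ModuleCat.exists_ι_comp_eq (hcn j) f
    obtain ⟨b, t, ht⟩ := ModuleCat.exists_comp_map_eq_zero (hcn k) (((K.obj a).d j k).hom ∘ₗ g) (by
      refine Eq.trans (LinearMap.ext fun x => ?_) hf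
      rw [← hg]
      exact (ModuleCat.hom_congr ((c.ι.app a).comm j k) (g x)).symm)
    obtain ⟨l, hl⟩ := (h b).2 i j k hi hj (((K.map t).f j).hom ∘ₗ g) (by
      refine Eq.trans (LinearMap.ext fun x => ?_) ht
      exact ModuleCat.hom_congr ((K.map t).comm j k) (g x))
    refine ⟨((c.ι.app b).f i).hom ∘ₗ l, LinearMap.ext fun x => ?_⟩
    refine (ModuleCat.hom_congr ((c.ι.app b).comm i j) (l x)).trans ?_
    refine (congrArg ((c.ι.app b).f j) (LinearMap.congr_fun hl x)).trans ?_
    refine Eq.trans ?_ (LinearMap.congr_fun hg x)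
    exact ModuleCat.hom_congr (congrArg (fun q => q.f j) (c.w t)) (g x)

section ShortExact

variable {S : ShortComplex (ChainComplex (ModuleCat.{u} R) ℤ)} (hS : S.ShortExact)
include hS

lemma shortExact_chainComplex (n : ℤ) : Function.Injective (S.f.f n).hom ∧
    Function.Exact (S.f.f n).hom (S.g.f n).hom ∧ Function.Surjective (S.g.f n).hom := by
  have h := (HomologicalComplex.shortExact_iff_degreewise_shortExact S).1 hS n
  exact ⟨h.moduleCat_injective_f,
    (ShortComplex.ShortExact.moduleCat_exact_iff_function_exact _).1 h.exact,
    h.moduleCat_surjective_g⟩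

lemma injLifts.of_extension (h₁ : injLifts R N S.X₁) (h₃ : injLifts R N S.X₃) :
    injLifts R N S.X₂ := by
  have e := shortExact_chainComplex hS
  have := h₁.1
  have := h₃.1
  choose r σ hr hσ using fun n => exists_splitting (e n).1 (e n).2.1 (e n).2.2
  refine ⟨fun n => .of_split _ (r n) _ (σ n) (hr n), fun i j k hi hj f hf => ?_⟩
  have cf (a b x) : (S.X₂.d a b) (S.f.f a x) = S.f.f b (S.X₁.d a b x) :=
    ModuleCat.hom_congr (S.f.comm a b) x
  have cg (a b x) : (S.X₃.d a b) (S.g.f a x) = S.g.f b (S.X₂.d a b x) :=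
    ModuleCat.hom_congr (S.g.comm a b) x
  have hf' (x) : S.X₂.d j k (f x) = 0 := LinearMap.congr_fun hf x
  have hdd (a b c x) : S.X₂.d b c (S.X₂.d a b x) = 0 :=
    LinearMap.congr_fun (ChainComplex.hom_d_comp_hom_d (C := S.X₂) a b c) x
  obtain ⟨g', hg'⟩ := h₃.2 i j k hi hj ((S.g.f j).hom ∘ₗ f) (LinearMap.ext fun x => by
    change S.X₃.d j k (S.g.f j (f x)) = 0
    rw [cg, hf', map_zero])
  have hg (x) : S.X₃.d i j (g' x) = S.g.f j (f x) := LinearMap.congr_fun hg' x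
  let u : N →ₗ[R] S.X₂.X j := f - (S.X₂.d i j).hom ∘ₗ σ i ∘ₗ g'
  have hu (x) : S.f.f j (r j (u x)) = u x := by
    have h1 : S.g.f j (u x) = 0 := by
      change S.g.f j (f x - S.X₂.d i j (σ i (g' x))) = 0
      rw [map_sub, ← cg, ← hg, sub_eq_zero]
      exact (congrArg _ (hσ i _)).symm
    have h2 := hr j (u x)
    erw [h1, map_zero, add_zero] at h2
    exact h2
  obtain ⟨a, ha⟩ := h₁.2 i j k hi hj (r j ∘ₗ u) (LinearMap.ext fun x => (e k).1 (by
    refine (cf j k _).symm.trans ?_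
    refine (congrArg (S.X₂.d j k) (hu x)).trans ?_
    change S.X₂.d j k (f x - S.X₂.d i j (σ i (g' x))) = _
    rw [map_sub, hf', hdd, sub_zero]
    exact (map_zero (S.f.f k).hom).symm))
  refine ⟨σ i ∘ₗ g' + (S.f.f i).hom ∘ₗ a, LinearMap.ext fun x => ?_⟩
  have h3 : S.X₂.d i j (S.f.f i (a x)) = u x :=
    (cf i j _).trans ((congrArg (S.f.f j) (LinearMap.congr_fun ha x)).trans (hu x))
  change S.X₂.d i j (σ i (g' x) + S.f.f i (a x)) = _
  rw [map_add, h3]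
  change _ + (f x - S.X₂.d i j (σ i (g' x))) = _
  abel

lemma injLifts.of_cokernel (h₁ : injLifts R N S.X₁) (h₂ : injLifts R N S.X₂) :
    injLifts R N S.X₃ := by
  have e := shortExact_chainComplex hS
  have := h₁.1
  have := h₂.1
  choose r σ hr hσ using fun n => exists_splitting (e n).1 (e n).2.1 (e n).2.2
  refine ⟨fun n => .of_linear_retract (σ n) (S.g.f n).hom (LinearMap.ext (hσ n)),
    fun i j k hi hj f hf => ?_⟩
  have cf (a b x) : (S.X₂.d a b) (S.f.f a x) = S.f.f b (S.X₁.d a b x) :=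
    ModuleCat.hom_congr (S.f.comm a b) x
  have cg (a b x) : (S.X₃.d a b) (S.g.f a x) = S.g.f b (S.X₂.d a b x) :=
    ModuleCat.hom_congr (S.g.comm a b) x
  have hf' (x) : S.X₃.d j k (f x) = 0 := LinearMap.congr_fun hf x
  have hdd (a b c x) : S.X₂.d b c (S.X₂.d a b x) = 0 :=
    LinearMap.congr_fun (ChainComplex.hom_d_comp_hom_d (C := S.X₂) a b c) x
  have hσ' (n x) : S.g.f n (σ n x) = x := hσ n x
  let u : N →ₗ[R] S.X₂.X k := (S.X₂.d j k).hom ∘ₗ σ j ∘ₗ f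
  have hu (x) : S.f.f k (r k (u x)) = u x := by
    have h1 : S.g.f k (u x) = 0 := by
      change S.g.f k (S.X₂.d j k (σ j (f x))) = 0
      rw [← cg, hσ', hf']
    have h2 := hr k (u x)
    erw [h1, map_zero, add_zero] at h2
    exact h2
  obtain ⟨a, ha⟩ := h₁.2 j k (k - 1) hj (by omega) (r k ∘ₗ u) (LinearMap.ext fun x => (e _).1 (by
    refine (cf _ _ _).symm.trans ?_
    refine (congrArg (S.X₂.d _ _) (hu x)).trans ?_
    exact (hdd _ _ _ _).trans (map_zero (S.f.f _).hom).symm))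
  obtain ⟨b, hb⟩ := h₂.2 i j k hi hj (σ j ∘ₗ f - (S.f.f j).hom ∘ₗ a) (LinearMap.ext fun x => by
    change S.X₂.d j k (σ j (f x) - S.f.f j (a x)) = 0
    rw [map_sub, cf, sub_eq_zero]
    exact ((congrArg (S.f.f k) (LinearMap.congr_fun ha x)).trans (hu x)).symm)
  refine ⟨(S.g.f i).hom ∘ₗ b, LinearMap.ext fun x => ?_⟩
  refine (cg i j _).trans ((congrArg (S.g.f j) (LinearMap.congr_fun hb x)).trans ?_)
  change S.g.f j (σ j (f x) - S.f.f j (a x)) = _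
  rw [map_sub, hσ']
  exact (congrArg (f x - ·) ((e j).2.1.apply_apply_eq_zero (a x))).trans (sub_zero _)

end ShortExact

variable (R N) in
lemma injLifts_isFilteredCoresolving [IsNoetherianRing R] [Module.Finite R N] :
    (injLifts R N).IsFilteredCoresolving where
  of_isZero := injLifts.of_isZero
  of_isColimit := injLifts.of_isColimit
  of_extension hS := injLifts.of_extension hS
  of_cokernel hS := injLifts.of_cokernel hS

end InjLifts

section LoewenheimSkolem

variable (R N : Type u) [CommRing R]

/-- Formal expressions for elements of a complex of injective `R`-modules which is
`Hom(N, -)`-acyclic. -/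
inductive LSTerm : ℤ → Type u
  | base (n : ℤ) : LSTerm n
  | add (n : ℤ) (s t : LSTerm n) : LSTerm n
  | smul (n : ℤ) (r : R) (t : LSTerm n) : LSTerm n
  | d (i j : ℤ) (t : LSTerm i) : LSTerm j
  | inj (n : ℤ) (I : Ideal R) (p : I → LSTerm n) : LSTerm n
  | lift (i j : ℤ) (p : N → LSTerm j) (a : N) : LSTerm i

variable {R N} [AddCommGroup N] [Module R N]

namespace LSTerm

variable {C : ChainComplex (ModuleCat.{u} R) ℤ} (x : ∀ n, C.X n)

open Classical in
/-- The value of a formal expression in a complex. -/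
noncomputable def eval : ∀ {n : ℤ}, LSTerm R N n → C.X n
  | _, base n => x n
  | _, add _ s t => eval s + eval t
  | _, smul _ r t => r • eval t
  | _, d i j t => C.d i j (eval t)
  | _, inj n I p => if h : ∃ y : C.X n, ∀ a : I, (a : R) • y = eval (p a) then h.choose else 0
  | _, lift i j p a => if h : ∃ g : N →ₗ[R] C.X i, ∀ a, C.d i j (g a) = eval (p a) then
      h.choose a else 0

variable (N) in
/-- The values of the formal expressions in degree `n`. -/
noncomputable def values (n : ℤ) : Submodule R (C.X n) where
  carrier := Set.range (eval (N := N) x (n := n))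
  add_mem' := by
    rintro _ _ ⟨s, rfl⟩ ⟨t, rfl⟩
    exact ⟨add n s t, by rw [eval]⟩
  zero_mem' := ⟨smul n 0 (base n), by rw [eval, zero_smul]⟩
  smul_mem' := by
    rintro r _ ⟨t, rfl⟩
    exact ⟨smul n r t, by rw [eval]⟩

lemma d_mem_values {i : ℤ} (j : ℤ) {y : C.X i} (hy : y ∈ values N x i) :
    (C.d i j).hom y ∈ values N x j := by
  obtain ⟨t, rfl⟩ := hy
  exact ⟨d i j t, by rw [eval]⟩

lemma injective_values [∀ n, Module.Injective R (C.X n)] (n : ℤ) :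
    Module.Injective R (values N x n) := by
  refine Module.Baer.injective fun I g => ?_
  obtain ⟨e, he⟩ := Module.Injective.out I.subtype I.subtype_injective ((values N x n).subtype ∘ₗ g)
  choose p hp using fun a => (g a).2
  have h : ∃ y : C.X n, ∀ a : I, (a : R) • y = eval x (p a) := ⟨e 1, fun a => by
    rw [hp, ← map_smul, smul_eq_mul, mul_one]
    exact he a⟩
  have hm : h.choose ∈ values N x n := ⟨inj n I p, by rw [eval, dif_pos h]⟩
  refine ⟨LinearMap.toSpanSingleton R _ ⟨h.choose, hm⟩, fun r hr => Subtype.ext ?_⟩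
  exact (h.choose_spec ⟨r, hr⟩).trans (hp _)

variable (N) in
/-- The subcomplex of values of the formal expressions. -/
noncomputable def subcomplex : ChainComplex (ModuleCat.{u} R) ℤ where
  X n := ModuleCat.of R (values N x n)
  d i j := ModuleCat.ofHom ((C.d i j).hom.restrict fun _ hy => d_mem_values x j hy)
  shape i j h := ModuleCat.hom_ext <| LinearMap.ext fun y =>
    Subtype.ext (ModuleCat.hom_congr (C.shape i j h) y.1)
  d_comp_d' i j k _ _ := ModuleCat.hom_ext <| LinearMap.ext fun y =>
    Subtype.ext (ModuleCat.hom_congr (C.d_comp_d i j k) y.1)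

variable (N) in
/-- The inclusion of the subcomplex of values. -/
noncomputable def subcomplexι : subcomplex N x ⟶ C where
  f n := ModuleCat.ofHom (values N x n).subtype
  comm' _ _ _ := rfl

instance : Mono (subcomplexι N x) := by
  have (n : ℤ) : Mono ((subcomplexι N x).f n) :=
    (ModuleCat.mono_iff_injective _).2 Subtype.val_injective
  exact HomologicalComplex.mono_of_mono_f _ this

lemma injLifts_subcomplex (hC : injLifts R N C) : injLifts R N (subcomplex N x) := by
  have := hC.1
  refine ⟨fun n => injective_values x n, fun i j k hi hj f hf => ?_⟩
  obtain ⟨g, hg⟩ := hC.2 i j k hi hj ((values N x j).subtype ∘ₗ f) (LinearMap.ext fun a =>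
    congrArg Subtype.val (LinearMap.congr_fun hf a))
  choose p hp using fun a => (f a).2
  have h : ∃ g : N →ₗ[R] C.X i, ∀ a, C.d i j (g a) = eval x (p a) := ⟨g, fun a => by
    rw [hp]
    exact LinearMap.congr_fun hg a⟩
  refine ⟨h.choose.codRestrict (values N x i) fun a => ⟨lift i j p a, by rw [eval, dif_pos h]⟩,
    LinearMap.ext fun a => Subtype.ext ?_⟩
  exact (h.choose_spec a).trans (hp a)

end LSTerm

section Free

/-- The complex `X ⟶ X` in degrees `n` and `n - 1`. -/
noncomputable def diskComplex (X : ModuleCat.{u} R) (n : ℤ) : ChainComplex (ModuleCat.{u} R) ℤ :=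
  HomologicalComplex.double (𝟙 X) (c := ComplexShape.down ℤ) (i₀ := n) (i₁ := n - 1) (by simp)

lemma exists_diskComplex_hom (X : ModuleCat.{u} R) (n : ℤ) : ∃ i : X ⟶ (diskComplex X n).X n,
    ∀ (C : ChainComplex (ModuleCat.{u} R) ℤ), Function.Bijective
      fun g : diskComplex X n ⟶ C => i ≫ g.f n :=
  ⟨(HomologicalComplex.doubleXIso₀ _ _).inv, fun _ =>
    (HomologicalComplex.evalCompCoyonedaCorepresentableByDoubleId _ (by omega)
      X).homEquiv.bijective⟩

instance projective_diskComplex (X : ModuleCat.{u} R) [Projective X] (n : ℤ) :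
    Projective (diskComplex X n) where
  factors {C D} f g _ := by
    obtain ⟨i, hi⟩ := exists_diskComplex_hom X n
    have : Epi (g.f n) := inferInstanceAs (Epi ((HomologicalComplex.eval _ _ n).map g))
    obtain ⟨l, hl⟩ := (hi _).2 (Projective.factorThru (i ≫ f.f n) (g.f n))
    refine ⟨l, (hi _).1 ?_⟩
    have h : (i ≫ l.f n) ≫ g.f n = i ≫ f.f n :=
      (congrArg (· ≫ g.f n) hl).trans (Projective.factorThru_comp _ _)
    exact (Category.assoc _ _ _).symm.trans h

variable (R) in
/-- The free complex on a graded set. -/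
noncomputable def freeComplex (W : ℤ → Type u) : ChainComplex (ModuleCat.{u} R) ℤ :=
  ∐ fun n => diskComplex (ModuleCat.of R (W n →₀ R)) n

lemma projective_sigma {𝒜 : Type v} [Category.{w} 𝒜] {β : Type*} (g : β → 𝒜) [HasCoproduct g]
    (h : ∀ b, Projective (g b)) : Projective (∐ g) where
  factors f e _ := ⟨Limits.Sigma.desc fun b => Projective.factorThru (Limits.Sigma.ι g b ≫ f) e, by
    cat_disch⟩

instance projective_freeComplex (W : ℤ → Type u) : Projective (freeComplex R W) :=
  projective_sigma _ fun n => by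
    have : Projective (ModuleCat.of R (W n →₀ R)) :=
      (IsProjective.iff_projective _).1 inferInstance
    exact projective_diskComplex _ n

lemma exists_freeComplex_epi {W : ℤ → Type u} {C : ChainComplex (ModuleCat.{u} R) ℤ}
    (f : ∀ n, W n → C.X n) (hf : ∀ n, Function.Surjective (f n)) :
    ∃ g : freeComplex R W ⟶ C, Epi g := by
  choose i hi using fun n => exists_diskComplex_hom (ModuleCat.of R (W n →₀ R)) n
  choose g hg using fun n =>
    (hi n C).2 (ModuleCat.ofHom (Finsupp.linearCombination R (f n)))
  obtain ⟨p, hp⟩ : ∃ p : freeComplex R W ⟶ C, ∀ n, ∃ q : ModuleCat.of R (W n →₀ R) ⟶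
      (freeComplex R W).X n, q ≫ p.f n = ModuleCat.ofHom (Finsupp.linearCombination R (f n)) := by
    refine ⟨Limits.Sigma.desc g, fun n => ⟨i n ≫ (Limits.Sigma.ι
      (fun n => diskComplex (ModuleCat.of R (W n →₀ R)) n) n).f n, Eq.trans ?_ (hg n)⟩⟩
    refine (Category.assoc _ _ _).trans (congrArg (i n ≫ ·) ?_)
    exact congrArg (fun t => t.f n) (Limits.Sigma.ι_desc g n)
  refine ⟨p, HomologicalComplex.epi_of_epi_f _ fun n => ?_⟩
  obtain ⟨q, hq⟩ := hp n
  have : Epi (q ≫ p.f n) := by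
    rw [hq, ModuleCat.epi_iff_surjective]
    intro y
    obtain ⟨w, rfl⟩ := hf n y
    exact ⟨Finsupp.single w 1, by simp⟩
  exact epi_of_epi q (p.f n)

end Free

lemma injLifts_generates [IsNoetherianRing R] [Module.Finite R N] :
    (injLifts R N).Generates (freeComplex R (LSTerm R N)) := by
  intro C hC hz
  obtain ⟨m, c, hc⟩ : ∃ (m : ℤ) (c : C.X m), c ≠ 0 := by
    by_contra! h
    refine hz ((IsZero.iff_id_eq_zero _).2 ?_)
    ext n y
    exact h n y
  let x : ∀ n, C.X n := Pi.single m c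
  let f (n : ℤ) (t : LSTerm R N n) : (LSTerm.subcomplex N x).X n := ⟨t.eval x, t, rfl⟩
  obtain ⟨g, hg⟩ := exists_freeComplex_epi f (by
      rintro n ⟨_, t, rfl⟩
      exact ⟨t, rfl⟩)
  refine ⟨g ≫ LSTerm.subcomplexι N x, fun h0 => hc ?_, ?_⟩
  · have h1 : LSTerm.subcomplexι N x = 0 := (cancel_epi g).1 (h0.trans comp_zero.symm)
    have h2 : x m = 0 := by
      have := ModuleCat.hom_congr (congrArg (fun q => q.f m) h1) (f m (.base m))
      change (LSTerm.base m : LSTerm R N m).eval x = 0 at this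
      rwa [LSTerm.eval] at this
    exact (Pi.single_eq_same (M := fun n => C.X n) m c).symm.trans h2
  · have := strongEpi_of_epi g
    exact (injLifts_isFilteredCoresolving R N).of_iso
      (image.isoStrongEpiMono g (LSTerm.subcomplexι N x) rfl) (LSTerm.injLifts_subcomplex x hC)

end LoewenheimSkolem

section Translation

variable {R : Type u} [CommRing R] {C : ChainComplex (ModuleCat.{u} R) ℤ}

lemma exactAt_iff_forall (n : ℤ) : C.ExactAt n ↔
    ∀ x : C.X n, C.d n (n - 1) x = 0 → ∃ y : C.X (n + 1), C.d (n + 1) n y = x := by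
  rw [C.exactAt_iff' (n + 1) n (n - 1) (by simp) (by simp), ShortComplex.moduleCat_exact_iff]
  rfl

lemma lifts_self_iff : Lifts C R ↔ ∀ n, C.ExactAt n := by
  simp only [exactAt_iff_forall]
  constructor
  · intro h n x hx
    obtain ⟨g, hg⟩ := h (n + 1) n (n - 1) rfl (by omega) (LinearMap.toSpanSingleton R _ x)
      (LinearMap.ext_ring (by simpa using hx))
    exact ⟨g 1, (LinearMap.congr_fun hg 1).trans (by simp)⟩
  · rintro h i j k rfl hk f hf
    obtain rfl : k = j - 1 := by omega
    obtain ⟨y, hy⟩ := h j (f 1) (LinearMap.congr_fun hf 1)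
    exact ⟨LinearMap.toSpanSingleton R _ y, LinearMap.ext_ring (by simpa using hy)⟩

lemma lifts_iff_coyoneda (I : ModuleCat.{u} R) : Lifts C I ↔
    ∀ n, (((preadditiveCoyoneda.obj (Opposite.op I)).mapHomologicalComplex _).obj C).ExactAt n := by
  have h (n : ℤ) :
      (((preadditiveCoyoneda.obj (Opposite.op I)).mapHomologicalComplex _).obj C).ExactAt n
      ↔ ∀ f : I ⟶ C.X n, f ≫ C.d n (n - 1) = 0 → ∃ g : I ⟶ C.X (n + 1), g ≫ C.d (n + 1) n = f := by
    rw [HomologicalComplex.exactAt_iff' _ (n + 1) n (n - 1) (by simp) (by simp),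
      ShortComplex.ab_exact_iff]
    rfl
  simp only [h]
  constructor
  · intro h n f hf
    obtain ⟨g, hg⟩ := h (n + 1) n (n - 1) rfl (by omega) f.hom (congrArg ModuleCat.Hom.hom hf)
    exact ⟨ModuleCat.ofHom g, ModuleCat.hom_ext hg⟩
  · rintro h i j k rfl hk f hf
    obtain rfl : k = j - 1 := by omega
    obtain ⟨g, hg⟩ := h j (ModuleCat.ofHom f) (ModuleCat.hom_ext hf)
    exact ⟨g.hom, congrArg ModuleCat.Hom.hom hg⟩

lemma lifts_prod_iff (hC : ∀ n, Module.Injective R (C.X n)) {M N : Type u} [AddCommGroup M]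
    [Module R M] [AddCommGroup N] [Module R N] :
    Lifts C (M × N) ↔ Lifts C M ∧ Lifts C N := by
  refine ⟨fun h => ⟨.of_retract _ _ (LinearMap.fst_comp_inl R M N) h,
    .of_retract _ _ (LinearMap.snd_comp_inr R M N) h⟩, fun h => ?_⟩
  exact .extension hC LinearMap.inl_injective Function.Exact.inl_snd LinearMap.snd_surjective h.1
    h.2

/-- A module testing `Hom(I, -)`-acyclicity for all injective modules `I` at once. -/
def IsTestModule (N : Type u) [AddCommGroup N] [Module R N] : Prop :=
  ∀ C : ChainComplex (ModuleCat.{u} R) ℤ, injLifts R N C ↔ (∀ n, Injective (C.X n)) ∧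
    (∀ n, C.ExactAt n) ∧ ∀ I : ModuleCat.{u} R, Injective I → ∀ n,
      (((preadditiveCoyoneda.obj (Opposite.op I)).mapHomologicalComplex _).obj C).ExactAt n

lemma IsDualizingComplex.exists_isTestModule [IsNoetherianRing R]
    {D : CochainComplex (ModuleCat.{u} R) ℤ} (hD : IsDualizingComplex R D) :
    ∃ (N : Type u) (_ : AddCommGroup N) (_ : Module R N), Module.Finite R N ∧
      IsTestModule (R := R) N := by
  obtain ⟨Q, hQ, h⟩ := exists_testModule D hD.1 hD.2.1 hD.2.2.1 hD.2.2.2.1 hD.2.2.2.2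
  have hi (M : ModuleCat.{u} R) : Injective M ↔ Module.Injective R M :=
    (Module.injective_iff_injective_object R M).symm
  refine ⟨R × Q, inferInstance, inferInstance, inferInstance, fun C => ?_⟩
  simp only [hi, ← lifts_iff_coyoneda, ← lifts_self_iff]
  refine and_congr_right fun hC => (lifts_prod_iff hC).trans <| and_congr_right fun hC' =>
    (h C hC hC').trans ⟨fun h I => h I, fun h I _ _ => h (ModuleCat.of R I)⟩

end Translation

section Cycles

variable {R : Type u} [CommRing R] {C : ChainComplex (ModuleCat.{u} R) ℤ}

lemma exists_cycles_cokernel (hC : ∀ n, C.ExactAt n) : ∃ π : C.X 1 ⟶ kernel (C.d 0 (-1)),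
    π ≫ kernel.ι _ = C.d 1 0 ∧ Epi π ∧ ∀ (Y : ModuleCat.{u} R) (α : C.X 1 ⟶ Y), C.d 2 1 ≫ α = 0 →
      ∃ φ : kernel (C.d 0 (-1)) ⟶ Y, π ≫ φ = α := by
  let π : C.X 1 ⟶ kernel (C.d 0 (-1)) := kernel.lift _ (C.d 1 0) (C.d_comp_d _ _ _)
  have h : π ≫ kernel.ι _ = C.d 1 0 := kernel.lift_ι _ _ _
  have hι : Function.Injective (kernel.ι (C.d 0 (-1))) :=
    (ModuleCat.mono_iff_injective _).1 inferInstance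
  have hπ : Function.Surjective π := fun x => by
    obtain ⟨y, hy⟩ := (exactAt_iff_forall 0).1 (hC 0) (kernel.ι (C.d 0 (-1)) x)
      (ModuleCat.hom_congr (kernel.condition (C.d 0 (-1))) x)
    exact ⟨y, hι ((ModuleCat.hom_congr h y).trans hy)⟩
  refine ⟨π, h, (ModuleCat.epi_iff_surjective _).2 hπ, fun Y α hα => ?_⟩
  obtain ⟨φ, hφ⟩ := exists_eq_comp_of_surjective hπ α.hom fun x hx => by
    obtain ⟨y, rfl⟩ := (exactAt_iff_forall 1).1 (hC 1) x
      ((ModuleCat.hom_congr h x).symm.trans ((congrArg (kernel.ι (C.d 0 (-1))) hx).trans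
        (map_zero _)))
    exact ModuleCat.hom_congr hα y
  exact ⟨ModuleCat.ofHom φ, ModuleCat.hom_ext hφ⟩

end Cycles

section Endomorphisms

variable {R : Type u} [CommRing R] {C : ChainComplex (ModuleCat.{u} R) ℤ}

lemma exists_endo_above {i j k : ℤ} (hi : j + 1 = i) (hk : k + 1 = j) (h : Lifts C (C.X i))
    (f : C.X j ⟶ C.X j) (hf : C.d i j ≫ f ≫ C.d j k = 0) :
    ∃ g : C.X i ⟶ C.X i, g ≫ C.d i j = C.d i j ≫ f := by
  obtain ⟨g, hg⟩ := h i j k hi hk (C.d i j ≫ f).hom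
    (congrArg ModuleCat.Hom.hom ((Category.assoc _ _ _).trans hf))
  exact ⟨ModuleCat.ofHom g, ModuleCat.hom_ext hg⟩

lemma exists_endo_below {i j k : ℤ} (hi : j + 1 = i) (hk : k + 1 = j) (hC : C.ExactAt j)
    [Module.Injective R (C.X k)] (f : C.X j ⟶ C.X j) (hf : C.d i j ≫ f ≫ C.d j k = 0) :
    ∃ g : C.X k ⟶ C.X k, f ≫ C.d j k = C.d j k ≫ g := by
  subst hi
  obtain rfl : k = j - 1 := by omega
  obtain ⟨l, hl⟩ := exists_eq_comp_of_surjective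
    (LinearMap.surjective_rangeRestrict (C.d j (j - 1)).hom) (f ≫ C.d j (j - 1)).hom fun x hx => by
      obtain ⟨y, rfl⟩ := (exactAt_iff_forall j).1 hC x (congrArg Subtype.val hx)
      exact ModuleCat.hom_congr hf y
  obtain ⟨g, rfl⟩ := exists_extension (Submodule.subtype_injective _) l
  exact ⟨ModuleCat.ofHom g, ModuleCat.hom_ext hl.symm⟩

/-- A family of endomorphisms is a chain map in degrees between `-k` and `k`. -/
def IsPartialEndo (C : ChainComplex (ModuleCat.{u} R) ℤ) (k : ℕ) (F : ∀ n, C.X n ⟶ C.X n) : Prop :=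
  (∀ i j : ℤ, j + 1 = i → -k ≤ j → i ≤ k → F i ≫ C.d i j = C.d i j ≫ F j) ∧
    ∀ i j l : ℤ, j + 1 = i → l + 1 = j → -k ≤ j → j ≤ k → C.d i j ≫ F j ≫ C.d j l = 0

lemma IsPartialEndo.exists_succ (hC : ∀ n, Module.Injective R (C.X n))
    (hC' : ∀ n, C.ExactAt n) (hC'' : ∀ n, Lifts C (C.X n)) {k : ℕ} {F : ∀ n, C.X n ⟶ C.X n}
    (hF : IsPartialEndo C k F) : ∃ F' : ∀ n, C.X n ⟶ C.X n, IsPartialEndo C (k + 1) F' ∧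
      ∀ n : ℤ, -k ≤ n → n ≤ k → F' n = F n := by
  obtain ⟨a, ha⟩ := exists_endo_above (i := k + 1) (j := k) (k := k - 1) rfl (by omega) (hC'' _)
    (F k) (hF.2 _ _ _ rfl (by omega) (by omega) le_rfl)
  have := hC (-(k : ℤ) - 1)
  obtain ⟨b, hb⟩ := exists_endo_below (i := -k + 1) (j := -k) (k := -k - 1) rfl (by omega) (hC' _)
    (F (-k)) (hF.2 _ _ _ rfl (by omega) (by omega) (by omega))
  let F' : ∀ n, C.X n ⟶ C.X n := Function.update (Function.update F (k + 1) a) (-k - 1) b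
  have h0 (n : ℤ) (h : -k ≤ n) (h' : n ≤ k) : F' n = F n :=
    (Function.update_of_ne (by omega) _ _).trans (Function.update_of_ne (by omega) _ _)
  have hb' : F' (-k - 1) = b := Function.update_self ..
  have ha' : F' (k + 1) = a := by
    refine (Function.update_of_ne (by omega) _ _).trans (Function.update_self ..)
  have h1 (i j : ℤ) (hi : j + 1 = i) (h : -((k + 1 : ℕ) : ℤ) ≤ j) (h' : i ≤ (k + 1 : ℕ)) :
      F' i ≫ C.d i j = C.d i j ≫ F' j := by
    push_cast at h h'
    by_cases hi' : i = k + 1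
    · obtain rfl : j = k := by omega
      subst hi'
      rw [ha', h0 _ (by omega) le_rfl, ha]
    by_cases hj' : j = -k - 1
    · obtain rfl : i = -k := by omega
      subst hj'
      rw [hb', h0 _ le_rfl (by omega), hb]
    rw [h0 i (by omega) (by omega), h0 j (by omega) (by omega),
      hF.1 i j hi (by omega) (by omega)]
  refine ⟨F', ⟨h1, fun i j l hi hl h h' => ?_⟩, h0⟩
  by_cases hj : j ≤ k
  · by_cases hj' : -k ≤ j
    · rw [h0 j hj' hj, hF.2 i j l hi hl hj' hj]
    · rw [← Category.assoc, ← h1 i j hi h (by omega), Category.assoc, C.d_comp_d, comp_zero]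
  · rw [h1 j l hl (by omega) h', ← Category.assoc, C.d_comp_d, zero_comp]

lemma exists_chain_endo (hC : ∀ n, Module.Injective R (C.X n))
    (hC' : ∀ n, C.ExactAt n) (hC'' : ∀ n, Lifts C (C.X n)) (f : C.X 0 ⟶ C.X 0)
    (hf : C.d 1 0 ≫ f ≫ C.d 0 (-1) = 0) : ∃ F : C ⟶ C, F.f 0 = f := by
  have h0 : IsPartialEndo C 0 (Function.update (fun n => 𝟙 _) 0 f) := by
    refine ⟨fun i j _ _ _ => by simp at *; omega, fun i j l hi hl h h' => ?_⟩
    obtain rfl : j = 0 := by simp at *; omega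
    obtain rfl : i = 1 := by omega
    obtain rfl : l = -1 := by omega
    rw [Function.update_self]
    exact hf
  choose s hs hs' using fun (k : ℕ) (F : {F // IsPartialEndo C k F}) =>
    F.2.exists_succ hC hC' hC''
  let S (k : ℕ) : {F // IsPartialEndo C k F} := Nat.rec ⟨_, h0⟩ (fun k F => ⟨s k F, hs k F⟩) k
  have hS (k : ℕ) (m : ℕ) (hkm : k ≤ m) (n : ℤ) (h : -k ≤ n) (h' : n ≤ k) :
      (S m).1 n = (S k).1 n := by
    induction m, hkm using Nat.le_induction with
    | base => rfl
    | succ m hm ih => exact (hs' m (S m) n (by omega) (by omega)).trans ih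
  refine ⟨{ f := fun n => (S n.natAbs).1 n, comm' := fun i j hij => ?_ }, ?_⟩
  · obtain rfl : j + 1 = i := hij
    let m := max (j + 1).natAbs j.natAbs
    rw [← hS (j + 1).natAbs m (le_max_left _ _) (j + 1) (by omega) (by omega),
      ← hS j.natAbs m (le_max_right _ _) j (by omega) (by omega)]
    exact (S m).2.1 _ _ rfl (by omega) (by omega)
  · exact Function.update_self (0 : ℤ) f fun n => 𝟙 (C.X n)

end Endomorphisms

section Covers

variable {R : Type u} [CommRing R]

lemma exists_cover_in_degree_one {P : ObjectProperty (ChainComplex (ModuleCat.{u} R) ℤ)}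
    (h : ∀ S, ∃ (C : ChainComplex (ModuleCat.{u} R) ℤ) (c : C ⟶ S), P C ∧
      (∀ (C' : ChainComplex (ModuleCat.{u} R) ℤ) (_ : P C') (c' : C' ⟶ S),
        ∃ l : C' ⟶ C, l ≫ c = c') ∧ ∀ e : C ⟶ C, e ≫ c = c → IsIso e) (X : ModuleCat.{u} R) :
    ∃ (C : ChainComplex (ModuleCat.{u} R) ℤ) (α : C.X 1 ⟶ X), P C ∧ C.d 2 1 ≫ α = 0 ∧
      (∀ (C' : ChainComplex (ModuleCat.{u} R) ℤ) (_ : P C') (α' : C'.X 1 ⟶ X),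
        C'.d 2 1 ≫ α' = 0 → ∃ l : C' ⟶ C, l.f 1 ≫ α = α') ∧
      ∀ e : C ⟶ C, e.f 1 ≫ α = α → IsIso e := by
  let S := (HomologicalComplex.single (ModuleCat.{u} R) (ComplexShape.down ℤ) 1).obj X
  let s : S.X 1 ≅ X := HomologicalComplex.singleObjXSelf (ComplexShape.down ℤ) 1 X
  obtain ⟨C, c, hP, hc, he⟩ := h S
  have hd : C.d 2 1 ≫ c.f 1 = 0 := by
    rw [← c.comm, HomologicalComplex.single_obj_d, comp_zero]
  refine ⟨C, c.f 1 ≫ s.hom, hP, ?_, fun C' hC' α' hα' => ?_, fun e hec => he e ?_⟩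
  · rw [← Category.assoc, hd, zero_comp]
  · obtain ⟨l, hl⟩ := hc C' hC' (HomologicalComplex.mkHomToSingle α' fun i hi => by
      obtain rfl : i = 2 := hi.symm
      exact hα')
    refine ⟨l, ?_⟩
    rw [← Category.assoc, ← HomologicalComplex.comp_f, hl, HomologicalComplex.mkHomToSingle_f]
    exact (Category.assoc _ _ _).trans (by simp [s])
  · refine HomologicalComplex.to_single_hom_ext ((cancel_mono s.hom).1 ?_)
    rw [HomologicalComplex.comp_f, Category.assoc, hec]

lemma IsTestModule.exists_isCover [IsNoetherianRing R] {N : Type u} [AddCommGroup N] [Module R N]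
    [Module.Finite R N] (hN : IsTestModule (R := R) N) (X : ModuleCat.{u} R) :
    ∃ (G : ModuleCat.{u} R) (φ : G ⟶ X), IsCover (fun N => IsGorensteinInjective N) φ := by
  obtain ⟨C, α, hC, hα, hl, he⟩ := exists_cover_in_degree_one (P := injLifts R N)
    (fun S => (injLifts_isFilteredCoresolving R N).exists_cover injLifts_generates S) X
  obtain ⟨h1, h2, h3⟩ := (hN C).1 hC
  obtain ⟨π, hπ, _, hdesc⟩ := exists_cycles_cokernel h2
  obtain ⟨φ, hφ⟩ := hdesc X α hα
  refine ⟨kernel (C.d 0 (-1)), φ, ⟨⟨C, h1, h2, h3, ⟨Iso.refl _⟩⟩, fun G' hG' ψ => ?_⟩,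
    fun f hf => ?_⟩
  · obtain ⟨C', h1', h2', h3', ⟨i⟩⟩ := hG'
    obtain ⟨π', hπ', _, -⟩ := exists_cycles_cokernel h2'
    have hd : C'.d 2 1 ≫ π' = 0 := by
      rw [← cancel_mono (kernel.ι (C'.d 0 (-1))), Category.assoc, hπ', C'.d_comp_d, zero_comp]
    obtain ⟨l, hl⟩ := hl C' ((hN C').2 ⟨h1', h2', h3'⟩) (π' ≫ i.inv ≫ ψ) (by
      rw [← Category.assoc, hd, zero_comp])
    let k : kernel (C'.d 0 (-1)) ⟶ kernel (C.d 0 (-1)) :=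
      kernel.map _ _ (l.f 0) (l.f (-1)) (l.comm 0 (-1)).symm
    have hk : π' ≫ k = l.f 1 ≫ π := by
      rw [← cancel_mono (kernel.ι (C.d 0 (-1))), Category.assoc, Category.assoc, hπ,
        kernel.lift_ι, ← Category.assoc, hπ', l.comm]
    refine ⟨i.hom ≫ k, ?_⟩
    rw [← cancel_epi i.inv, ← cancel_epi π', Category.assoc, i.inv_hom_id_assoc,
      ← Category.assoc, hk, Category.assoc, hφ, hl]
  · obtain ⟨g, hg⟩ := Injective.factors (f ≫ kernel.ι (C.d 0 (-1))) (kernel.ι (C.d 0 (-1)))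
    obtain ⟨F, rfl⟩ := exists_chain_endo hC.1 h2 (fun n => (lifts_iff_coyoneda _).2 (h3 _ (h1 n))) g
      (by rw [← hπ, Category.assoc, reassoc_of% hg, kernel.condition, comp_zero, comp_zero])
    have hF : F.f 1 ≫ π = π ≫ f := by
      rw [← cancel_mono (kernel.ι (C.d 0 (-1))), Category.assoc, Category.assoc, hπ, F.comm, ← hg,
        reassoc_of% hπ]
    have := he F (by rw [← hφ, reassoc_of% hF, hf])
    let k : kernel (C.d 0 (-1)) ⟶ kernel (C.d 0 (-1)) :=
      kernel.map _ _ ((inv F).f 0) ((inv F).f (-1)) ((inv F).comm 0 (-1)).symm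
    have hk : k ≫ kernel.ι _ = kernel.ι _ ≫ (inv F).f 0 := kernel.lift_ι _ _ _
    refine ⟨k, ?_, ?_⟩
    · rw [← cancel_mono (kernel.ι (C.d 0 (-1))), Category.assoc, hk, ← reassoc_of% hg,
        ← HomologicalComplex.comp_f, IsIso.hom_inv_id]
      simp
    · rw [← cancel_mono (kernel.ι (C.d 0 (-1))), Category.assoc, ← hg, reassoc_of% hk,
        ← HomologicalComplex.comp_f, IsIso.inv_hom_id]
      simp

end Covers

/-- If `R` is a commutative noetherian ring possessing a dualizing complex,
then the class of Gorenstein injective `R`-modules is covering. -/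
theorem gorensteinInjective_covering_of_dualizingComplex
    (R : Type u) [CommRing R] [IsNoetherianRing R]
    (hD : ∃ D : CochainComplex (ModuleCat.{u} R) ℤ, IsDualizingComplex R D) :
    ∀ X : ModuleCat.{u} R, ∃ (G : ModuleCat.{u} R) (φ : G ⟶ X),
      IsCover (fun N => IsGorensteinInjective N) φ := by
  obtain ⟨D, hD⟩ := hD
  obtain ⟨N, _, _, _, hN⟩ := hD.exists_isTestModule
  exact hN.exists_isCover
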